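/- Let A, B, C, D be integers with gcd(A, B, C, D) = 1 and Δ := A·D − B·C ≠ 0. Then: (i) for every integer n with n² − 4Δ not a perfect square, the partial sums Σ_{q=1}^{Q} 𝔖_q(n) converge as Q → ∞ to a limit 𝔖(n); and (ii) for every α₀ ∈ (0, 1) and every η with 0 < η < min(α₀/6, 1/20), there is a constant C such that for all N ≥ 2, the number of integers n ∈ [1, N] with n² − 4Δ not a perfect square and |Σ_{q ≤ N^{α₀}} 𝔖_q(n) − 𝔖(n)| ≥ N^{−η} is at most C · N^{1−η}. -/

import Mathlib

/-- The Ramanujan sum `c_q(x) = Σ_{r (mod q), gcd(r,q)=1} e^{2πi r x / q}`,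
viewed as a function of `x ∈ ℤ/qℤ`. -/
noncomputable def ramanujanSum (q : ℕ) (x : ZMod q) : ℂ :=
  ∑ r ∈ (Finset.range q).filter (fun r => Nat.Coprime r q),
    Complex.exp (2 * Real.pi * Complex.I * ((r * x.val : ℕ) : ℂ) / q)

/-- The linear form `ℒ(γ) = A·a + B·b + C·c + D·d` on `SL₂(ℤ/qℤ)`. -/
def Lform (A B C D : ℤ) {q : ℕ} (γ : Matrix.SpecialLinearGroup (Fin 2) (ZMod q)) : ZMod q :=
  (A : ZMod q) * γ.1 0 0 + (B : ZMod q) * γ.1 0 1 +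
    (C : ZMod q) * γ.1 1 0 + (D : ZMod q) * γ.1 1 1

/-- The singular series term `𝔖_q(n) = |SL₂(ℤ/qℤ)|⁻¹ Σ_{γ ∈ SL₂(ℤ/qℤ)} c_q(ℒ(γ) − n)`
(a real number), with junk value `0` at `q = 0`. -/
noncomputable def singSeriesTerm (A B C D : ℤ) (q : ℕ) (n : ℤ) : ℝ :=
  if h : q = 0 then 0 else
    haveI : NeZero q := ⟨h⟩
    ((Fintype.card (Matrix.SpecialLinearGroup (Fin 2) (ZMod q)) : ℂ)⁻¹ *
      ∑ γ : Matrix.SpecialLinearGroup (Fin 2) (ZMod q),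
        ramanujanSum q (Lform A B C D γ - (n : ZMod q))).re

namespace SingSeries

lemma stdAddChar_natCast {q : ℕ} [NeZero q] (m : ℕ) :
    ZMod.stdAddChar (m : ZMod q) = Complex.exp (2 * Real.pi * Complex.I * (m : ℂ) / q) := by
  have h := ZMod.stdAddChar_coe (N := q) (m : ℤ)
  simpa using h

lemma ramanujanSum_eq_sum_units (q : ℕ) [NeZero q] (x : ZMod q) :
    ramanujanSum q x = ∑ r : (ZMod q)ˣ, ZMod.stdAddChar ((r : ZMod q) * x) := by
  symm
  unfold ramanujanSum
  refine Finset.sum_bij' (fun r _ => (r : ZMod q).val)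
    (fun r hr => ZMod.unitOfCoprime r (by simpa using (Finset.mem_filter.mp hr).2)) ?_ ?_ ?_ ?_ ?_
  · intro r _
    simpa [ZMod.val_lt] using ZMod.val_coe_unit_coprime r
  · simp
  · intro r _
    ext
    simp
  · intro r hr
    simp only [Finset.mem_filter, Finset.mem_range] at hr
    simp [ZMod.val_cast_of_lt hr.1]
  · intro r _
    rw [← stdAddChar_natCast]
    simp

lemma sum_stdAddChar_mul {q : ℕ} [NeZero q] (y : ZMod q) :
    ∑ t : ZMod q, ZMod.stdAddChar (y * t) = if y = 0 then (q : ℂ) else 0 := by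
  have := AddChar.sum_mulShift (R' := ℂ) y (ZMod.isPrimitive_stdAddChar q)
  simpa [mul_comm] using this

lemma sum_ramanujanSum_add_mul {q : ℕ} [NeZero q] (x y : ZMod q) :
    ∑ t : ZMod q, ramanujanSum q (x + y * t) = if y = 0 then q * ramanujanSum q x else 0 := by
  simp_rw [ramanujanSum_eq_sum_units, mul_add, AddChar.map_add_eq_mul]
  rw [Finset.sum_comm]
  simp_rw [← Finset.mul_sum, ← mul_assoc, sum_stdAddChar_mul]
  split_ifs with h
  · simp [h, Finset.mul_sum, mul_comm]
  · simp [h]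

lemma ramanujanSum_unit_mul {q : ℕ} [NeZero q] (u : (ZMod q)ˣ) (x : ZMod q) :
    ramanujanSum q (u * x) = ramanujanSum q x := by
  simp_rw [ramanujanSum_eq_sum_units, ← mul_assoc, ← Units.val_mul]
  exact Fintype.sum_equiv (Equiv.mulRight u) _ _ (fun r => rfl)

lemma ramanujanSum_conj {q : ℕ} [NeZero q] (x : ZMod q) :
    (starRingEnd ℂ) (ramanujanSum q x) = ramanujanSum q x := by
  rw [ramanujanSum_eq_sum_units, map_sum]
  refine Fintype.sum_equiv (Equiv.neg _) _ _ (fun r => ?_)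
  simp only [Equiv.neg_apply, Units.val_neg, neg_mul]
  rw [AddChar.map_neg_eq_conj]

lemma norm_ramanujanSum_le {q : ℕ} [NeZero q] (x : ZMod q) : ‖ramanujanSum q x‖ ≤ q := by
  rw [ramanujanSum_eq_sum_units]
  refine (norm_sum_le _ _).trans ?_
  simp only [AddChar.norm_apply, Finset.sum_const, nsmul_eq_mul, mul_one, Finset.card_univ]
  rw [ZMod.card_units_eq_totient]
  exact_mod_cast Nat.totient_le q

/-- The Ramanujan sum to a prime power modulus. -/
lemma ramanujanSum_prime_pow {p : ℕ} [Fact p.Prime] (k : ℕ) (x : ZMod (p ^ (k + 1))) :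
    ramanujanSum (p ^ (k + 1)) x =
      (if x = 0 then (p : ℂ) ^ (k + 1) else 0) - (if (p : ZMod (p ^ (k + 1))) * x = 0 then (p : ℂ) ^ k else 0) := by
  have hp := (Fact.out : p.Prime)
  have h1 : ∀ m ∈ Finset.range (p^(k+1)), Nat.Coprime m (p^(k+1)) ↔ ¬ p ∣ m := by
    intro m _
    rw [Nat.coprime_pow_right_iff (by omega), Nat.coprime_comm, hp.coprime_iff_not_dvd]
  have e1 : ramanujanSum (p ^ (k + 1)) x =
      ∑ r ∈ (Finset.range (p^(k+1))).filter (fun r => ¬ p ∣ r), ZMod.stdAddChar ((r : ZMod (p ^ (k + 1))) * x) := by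
    unfold ramanujanSum
    rw [Finset.filter_congr h1]
    refine Finset.sum_congr rfl fun r _ => ?_
    rw [← stdAddChar_natCast]
    simp
  have e2 : ∑ r ∈ Finset.range (p^(k+1)), ZMod.stdAddChar ((r : ZMod (p ^ (k + 1))) * x) =
      if x = 0 then (p : ℂ) ^ (k + 1) else 0 := by
    have := sum_stdAddChar_mul x
    rw [Nat.cast_pow] at this
    rw [← this]
    refine Finset.sum_bij' (fun r _ => (r : ZMod (p^(k+1)))) (fun r _ => r.val) ?_ ?_ ?_ ?_ ?_
    · simp
    · simp [ZMod.val_lt]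
    · intro a ha
      exact ZMod.val_cast_of_lt (by simpa using ha)
    · simp
    · intro a _; rw [mul_comm]
  have e3 : ∑ r ∈ (Finset.range (p^(k+1))).filter (fun r => p ∣ r), ZMod.stdAddChar ((r : ZMod (p ^ (k + 1))) * x)
      = if (p : ZMod (p ^ (k + 1))) * x = 0 then (p : ℂ) ^ k else 0 := by
    have : ∑ r ∈ (Finset.range (p^(k+1))).filter (fun r => p ∣ r), ZMod.stdAddChar ((r : ZMod (p ^ (k + 1))) * x)
      = ∑ s ∈ Finset.range (p^k), (ZMod.stdAddChar ((p : ZMod (p ^ (k + 1))) * x)) ^ s := by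
      refine Finset.sum_bij' (fun r _ => r / p) (fun s _ => p * s) ?_ ?_ ?_ ?_ ?_
      · intro r hr
        simp only [Finset.mem_filter, Finset.mem_range] at hr ⊢
        rw [Nat.div_lt_iff_lt_mul hp.pos, ← pow_succ]; exact hr.1
      · intro s hs
        simp only [Finset.mem_filter, Finset.mem_range] at hs ⊢
        exact ⟨by rw [pow_succ']; exact Nat.mul_lt_mul_of_pos_left hs hp.pos, dvd_mul_right _ _⟩
      · intro r hr
        exact Nat.mul_div_cancel' (Finset.mem_filter.mp hr).2
      · intro s _
        exact Nat.mul_div_cancel_left s hp.pos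
      · intro r hr
        obtain ⟨s, rfl⟩ := (Finset.mem_filter.mp hr).2
        rw [Nat.mul_div_cancel_left s hp.pos, ← AddChar.map_nsmul_eq_pow, nsmul_eq_mul]
        push_cast
        congr 1; ring
    rw [this]
    split_ifs with h
    · simp [h]
    · have hne : (ZMod.stdAddChar ((p : ZMod (p ^ (k + 1))) * x) : ℂ) ≠ 1 := by
        intro h'
        rw [← AddChar.map_zero_eq_one (ZMod.stdAddChar (N := p ^ (k+1)))] at h'
        exact h (ZMod.injective_stdAddChar h')
      rw [geom_sum_eq hne, ← AddChar.map_nsmul_eq_pow, nsmul_eq_mul, ← mul_assoc]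
      have : ((p ^ k : ℕ) : ZMod (p ^ (k + 1))) * p = 0 := by
        rw [← Nat.cast_mul, ← pow_succ]; simp
      rw [this]; simp
  rw [e1, ← e2, ← e3, ← Finset.sum_filter_add_sum_filter_not (Finset.range (p^(k+1))) (fun r => p ∣ r)]
  ring

/-- Ramanujan sums are multiplicative in the modulus. -/
lemma ramanujanSum_mul {q₁ q₂ : ℕ} [NeZero q₁] [NeZero q₂] (h : q₁.Coprime q₂) (x : ℤ) :
    ramanujanSum (q₁ * q₂) (x : ZMod (q₁ * q₂)) =
      ramanujanSum q₁ (x : ZMod q₁) * ramanujanSum q₂ (x : ZMod q₂) := by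
  have hb : IsCoprime (q₁ : ℤ) q₂ := Nat.isCoprime_iff_coprime.mpr h
  obtain ⟨A₂, A₁, hA⟩ := hb
  have hu1 : IsUnit (A₁ : ZMod q₁) := by
    refine IsUnit.of_mul_eq_one (q₂ : ZMod q₁) ?_
    have := congrArg (Int.cast : ℤ → ZMod q₁) hA
    simpa using this
  have hu2 : IsUnit (A₂ : ZMod q₂) := by
    refine IsUnit.of_mul_eq_one (q₁ : ZMod q₂) ?_
    have := congrArg (Int.cast : ℤ → ZMod q₂) hA
    simpa using this
  obtain ⟨u₁, hu₁⟩ := hu1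
  obtain ⟨u₂, hu₂⟩ := hu2
  have key : ∀ z : ℤ, ZMod.stdAddChar (z : ZMod (q₁ * q₂)) =
      ZMod.stdAddChar ((u₁ : ZMod q₁) * (z : ZMod q₁)) * ZMod.stdAddChar ((u₂ : ZMod q₂) * (z : ZMod q₂)) := by
    intro z
    rw [hu₁, hu₂, ← Int.cast_mul, ← Int.cast_mul, ZMod.stdAddChar_coe, ZMod.stdAddChar_coe,
      ZMod.stdAddChar_coe, ← Complex.exp_add]
    congr 1
    have h1 : (q₁ : ℂ) ≠ 0 := by exact_mod_cast NeZero.ne q₁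
    have h2 : (q₂ : ℂ) ≠ 0 := by exact_mod_cast NeZero.ne q₂
    have hA' : (A₂ : ℂ) * q₁ + A₁ * q₂ = 1 := by exact_mod_cast hA
    push_cast
    field_simp
    linear_combination (-(z : ℂ)) * hA'
  rw [← ramanujanSum_unit_mul u₁ (x : ZMod q₁), ← ramanujanSum_unit_mul u₂ (x : ZMod q₂)]
  simp_rw [ramanujanSum_eq_sum_units]
  rw [Finset.sum_mul_sum, ← Finset.sum_product', Finset.univ_product_univ]
  let e : (ZMod (q₁ * q₂))ˣ ≃* (ZMod q₁)ˣ × (ZMod q₂)ˣ :=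
    (Units.mapEquiv (ZMod.chineseRemainder h).toMulEquiv).trans MulEquiv.prodUnits
  refine Fintype.sum_equiv e.toEquiv _ _ (fun r => ?_)
  obtain ⟨z, hz⟩ := ZMod.intCast_surjective (r : ZMod (q₁ * q₂))
  have hr : ((e r).1 : ZMod q₁) = z ∧ ((e r).2 : ZMod q₂) = z := by
    have : (((e r).1 : ZMod q₁), ((e r).2 : ZMod q₂)) = ZMod.chineseRemainder h r := rfl
    rw [← hz, map_intCast] at this
    exact ⟨congrArg Prod.fst this, congrArg Prod.snd this⟩
  have := key (z * x)
  simp only [MulEquiv.toEquiv_eq_coe, EquivLike.coe_coe] at *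
  rw [hr.1, hr.2, ← hz, ← Int.cast_mul, this]
  push_cast
  congr 2 <;> ring

open Matrix

/-- The singular series term as a complex-valued function on `ℤ/qℤ`. -/
noncomputable def cterm (A B C D : ℤ) (q : ℕ) [NeZero q] (x : ZMod q) : ℂ :=
  (Fintype.card (SpecialLinearGroup (Fin 2) (ZMod q)) : ℂ)⁻¹ *
    ∑ γ : SpecialLinearGroup (Fin 2) (ZMod q), ramanujanSum q (Lform A B C D γ - x)

lemma singSeriesTerm_eq_cterm (A B C D : ℤ) (q : ℕ) [NeZero q] (n : ℤ) :
    (singSeriesTerm A B C D q n : ℂ) = cterm A B C D q (n : ZMod q) := by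
  have h : singSeriesTerm A B C D q n = (cterm A B C D q (n : ZMod q)).re := by
    rw [singSeriesTerm, dif_neg (NeZero.ne q)]
    rfl
  rw [h]
  apply Complex.conj_eq_iff_re.mp
  unfold cterm
  rw [map_mul, map_inv₀, map_sum, Complex.conj_natCast]
  simp_rw [ramanujanSum_conj]

lemma abs_singSeriesTerm (A B C D : ℤ) (q : ℕ) [NeZero q] (n : ℤ) :
    |singSeriesTerm A B C D q n| = ‖cterm A B C D q (n : ZMod q)‖ := by
  rw [← singSeriesTerm_eq_cterm, Complex.norm_real, Real.norm_eq_abs]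

section CRT

variable {q₁ q₂ : ℕ}

private def toFst (q₁ q₂ : ℕ) : ZMod (q₁ * q₂) →+* ZMod q₁ :=
  ZMod.castHom (dvd_mul_right q₁ q₂) (ZMod q₁)

private def toSnd (q₁ q₂ : ℕ) : ZMod (q₁ * q₂) →+* ZMod q₂ :=
  ZMod.castHom (dvd_mul_left q₂ q₁) (ZMod q₂)

lemma chineseRemainder_eq (h : q₁.Coprime q₂) (x : ZMod (q₁ * q₂)) :
    ZMod.chineseRemainder h x = (toFst q₁ q₂ x, toSnd q₁ q₂ x) := by
  obtain ⟨z, rfl⟩ := ZMod.intCast_surjective x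
  rw [map_intCast, map_intCast, map_intCast]
  rfl

lemma map_sl_bijective (h : q₁.Coprime q₂) :
    Function.Bijective (fun γ : SpecialLinearGroup (Fin 2) (ZMod (q₁ * q₂)) =>
      (SpecialLinearGroup.map (toFst q₁ q₂) γ, SpecialLinearGroup.map (toSnd q₁ q₂) γ)) := by
  have hinj : ∀ x y : ZMod (q₁ * q₂), toFst q₁ q₂ x = toFst q₁ q₂ y →
      toSnd q₁ q₂ x = toSnd q₁ q₂ y → x = y := by
    intro x y h1 h2
    apply (ZMod.chineseRemainder h).injective
    rw [chineseRemainder_eq, chineseRemainder_eq, h1, h2]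
  constructor
  · intro γ γ' hγ
    simp only [Prod.mk.injEq] at hγ
    ext i j
    refine hinj _ _ ?_ ?_
    · have := congrArg (fun g : SpecialLinearGroup (Fin 2) (ZMod q₁) => g.1 i j) hγ.1
      simpa using! this
    · have := congrArg (fun g : SpecialLinearGroup (Fin 2) (ZMod q₂) => g.1 i j) hγ.2
      simpa using! this
  · rintro ⟨γ₁, γ₂⟩
    let M : Matrix (Fin 2) (Fin 2) (ZMod (q₁ * q₂)) :=
      fun i j => (ZMod.chineseRemainder h).symm (γ₁.1 i j, γ₂.1 i j)
    have hM1 : ∀ i j, toFst q₁ q₂ (M i j) = γ₁.1 i j := by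
      intro i j
      have := chineseRemainder_eq h (M i j)
      rw [show M i j = (ZMod.chineseRemainder h).symm (γ₁.1 i j, γ₂.1 i j) from rfl,
        RingEquiv.apply_symm_apply] at this
      exact (congrArg Prod.fst this).symm
    have hM2 : ∀ i j, toSnd q₁ q₂ (M i j) = γ₂.1 i j := by
      intro i j
      have := chineseRemainder_eq h (M i j)
      rw [show M i j = (ZMod.chineseRemainder h).symm (γ₁.1 i j, γ₂.1 i j) from rfl,
        RingEquiv.apply_symm_apply] at this
      exact (congrArg Prod.snd this).symm
    have hdet : M.det = 1 := by
      refine hinj _ _ ?_ ?_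
      · rw [Matrix.det_fin_two, map_sub, map_mul, map_mul, map_one]
        simp only [hM1]
        rw [← Matrix.det_fin_two]; exact γ₁.2
      · rw [Matrix.det_fin_two, map_sub, map_mul, map_mul, map_one]
        simp only [hM2]
        rw [← Matrix.det_fin_two]; exact γ₂.2
    refine ⟨⟨M, hdet⟩, ?_⟩
    refine Prod.ext ?_ ?_
    · ext i j; exact hM1 i j
    · ext i j; exact hM2 i j

lemma Lform_map {R : ℕ} {S : ℕ} (φ : ZMod R →+* ZMod S) (A B C D : ℤ)
    (γ : SpecialLinearGroup (Fin 2) (ZMod R)) :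
    Lform A B C D (SpecialLinearGroup.map φ γ) = φ (Lform A B C D γ) := by
  simp [Lform]

lemma cterm_mul [NeZero q₁] [NeZero q₂] (A B C D : ℤ) (h : q₁.Coprime q₂)
    (x : ZMod (q₁ * q₂)) :
    cterm A B C D (q₁ * q₂) x =
      cterm A B C D q₁ (ZMod.chineseRemainder h x).1 *
        cterm A B C D q₂ (ZMod.chineseRemainder h x).2 := by
  let e := Equiv.ofBijective _ (map_sl_bijective h)
  have hc : ∀ z : ZMod (q₁ * q₂), ramanujanSum (q₁ * q₂) z =
      ramanujanSum q₁ (toFst q₁ q₂ z) * ramanujanSum q₂ (toSnd q₁ q₂ z) := by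
    intro z
    obtain ⟨z, rfl⟩ := ZMod.intCast_surjective z
    rw [ramanujanSum_mul h, map_intCast, map_intCast]
  unfold cterm
  rw [Fintype.card_congr e, Fintype.card_prod, chineseRemainder_eq]
  rw [mul_mul_mul_comm, Finset.sum_mul_sum, ← Finset.sum_product', Finset.univ_product_univ]
  congr 1
  · push_cast; rw [mul_inv]
  · refine Fintype.sum_equiv e _ _ (fun γ => ?_)
    rw [hc, map_sub, map_sub, ← Lform_map, ← Lform_map]
    rfl

lemma singSeriesTerm_mul (A B C D : ℤ) (h : q₁.Coprime q₂) (n : ℤ) :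
    singSeriesTerm A B C D (q₁ * q₂) n =
      singSeriesTerm A B C D q₁ n * singSeriesTerm A B C D q₂ n := by
  rcases Nat.eq_zero_or_pos q₁ with rfl | h1
  · simp [singSeriesTerm]
  rcases Nat.eq_zero_or_pos q₂ with rfl | h2
  · simp [singSeriesTerm]
  have : NeZero q₁ := ⟨h1.ne'⟩
  have : NeZero q₂ := ⟨h2.ne'⟩
  apply Complex.ofReal_injective
  rw [Complex.ofReal_mul]
  simp_rw [singSeriesTerm_eq_cterm]
  rw [cterm_mul A B C D h, map_intCast]
  rfl

/-- The mean square of the singular series term over residue classes (`0` when `q = 0`). -/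
noncomputable def meanSq (A B C D : ℤ) (q : ℕ) : ℝ :=
  if h : q = 0 then 0 else
    haveI : NeZero q := ⟨h⟩
    (q : ℝ)⁻¹ * ∑ x : ZMod q, ‖cterm A B C D q x‖ ^ 2

lemma meanSq_eq (A B C D : ℤ) (q : ℕ) [NeZero q] :
    meanSq A B C D q = (q : ℝ)⁻¹ * ∑ x : ZMod q, ‖cterm A B C D q x‖ ^ 2 := by
  rw [meanSq, dif_neg (NeZero.ne q)]

lemma meanSq_nonneg (A B C D : ℤ) (q : ℕ) : 0 ≤ meanSq A B C D q := by
  unfold meanSq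
  split_ifs
  · rfl
  · positivity

lemma meanSq_mul (A B C D : ℤ) (h : q₁.Coprime q₂) :
    meanSq A B C D (q₁ * q₂) = meanSq A B C D q₁ * meanSq A B C D q₂ := by
  rcases Nat.eq_zero_or_pos q₁ with rfl | h1
  · simp [meanSq]
  rcases Nat.eq_zero_or_pos q₂ with rfl | h2
  · simp [meanSq]
  have : NeZero q₁ := ⟨h1.ne'⟩
  have : NeZero q₂ := ⟨h2.ne'⟩
  simp_rw [meanSq_eq]
  rw [mul_mul_mul_comm, Finset.sum_mul_sum, ← Finset.sum_product', Finset.univ_product_univ]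
  congr 1
  · push_cast; rw [mul_inv]
  · refine Fintype.sum_equiv (ZMod.chineseRemainder h).toEquiv _ _ (fun x => ?_)
    rw [cterm_mul A B C D h, norm_mul, mul_pow]
    rfl

end CRT

lemma cterm_one (A B C D : ℤ) (x : ZMod 1) : cterm A B C D 1 x = 1 := by
  unfold cterm
  have : ∀ y : ZMod 1, ramanujanSum 1 y = 1 := by
    intro y
    rw [Subsingleton.elim y 0]
    simp [ramanujanSum]
  simp [this]

lemma singSeriesTerm_one (A B C D : ℤ) (n : ℤ) : singSeriesTerm A B C D 1 n = 1 := by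
  apply Complex.ofReal_injective
  rw [singSeriesTerm_eq_cterm, cterm_one]; simp

lemma meanSq_one (A B C D : ℤ) : meanSq A B C D 1 = 1 := by
  rw [meanSq_eq]
  simp [cterm_one]

section Smith

variable {R : Type*} [CommRing R]

/-- The element of `SL₂` with the given entries. -/
def slMk (a b c d : R) (h : a * d - b * c = 1) : SpecialLinearGroup (Fin 2) R :=
  ⟨!![a, b; c, d], by rw [det_fin_two_of]; exact h⟩

@[simp] lemma slMk_zero_zero (a b c d : R) (h : a * d - b * c = 1) :
    (slMk a b c d h).1 0 0 = a := rfl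

@[simp] lemma slMk_zero_one (a b c d : R) (h : a * d - b * c = 1) :
    (slMk a b c d h).1 0 1 = b := rfl

@[simp] lemma slMk_one_zero (a b c d : R) (h : a * d - b * c = 1) :
    (slMk a b c d h).1 1 0 = c := rfl

@[simp] lemma slMk_one_one (a b c d : R) (h : a * d - b * c = 1) :
    (slMk a b c d h).1 1 1 = d := rfl

lemma sl_ext {γ δ : SpecialLinearGroup (Fin 2) R} (h00 : γ.1 0 0 = δ.1 0 0)
    (h01 : γ.1 0 1 = δ.1 0 1) (h10 : γ.1 1 0 = δ.1 1 0) (h11 : γ.1 1 1 = δ.1 1 1) : γ = δ := by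
  ext i j
  fin_cases i <;> fin_cases j
  exacts [h00, h01, h10, h11]

lemma sl_mul_apply (γ δ : SpecialLinearGroup (Fin 2) R) (i j : Fin 2) :
    (γ * δ).1 i j = γ.1 i 0 * δ.1 0 j + γ.1 i 1 * δ.1 1 j := by
  have h : (γ * δ).1 = γ.1 * δ.1 := rfl
  rw [h, Matrix.mul_apply, Fin.sum_univ_two]

/-- The linear form with coefficients `A, B, C, D` in an arbitrary commutative ring. -/
def linForm (A B C D : R) (γ : SpecialLinearGroup (Fin 2) R) : R :=
  A * γ.1 0 0 + B * γ.1 0 1 + C * γ.1 1 0 + D * γ.1 1 1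

/-- The linear form is equivalent to `γ ↦ a + Δ d` under two-sided multiplication. -/
def IsNormalizable (A B C D : R) : Prop :=
  ∃ U V : SpecialLinearGroup (Fin 2) R, ∀ γ,
    linForm A B C D (U * γ * V) = γ.1 0 0 + (A * D - B * C) * γ.1 1 1

lemma isNormalizable_of_isUnit (A B C D : R) (hA : IsUnit A) : IsNormalizable A B C D := by
  obtain ⟨u, hu⟩ := hA.exists_right_inv
  refine ⟨slMk u (-C) 0 A (by linear_combination hu), slMk 1 0 (-(B * u)) 1 (by ring), fun γ => ?_⟩
  simp only [linForm, sl_mul_apply,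
    slMk_zero_zero, slMk_zero_one, slMk_one_zero, slMk_one_one]
  linear_combination (γ.1 0 0 - B * u * γ.1 0 1) * hu

lemma IsNormalizable.rotate_right {A B C D : R} (h : IsNormalizable B (-A) D (-C)) :
    IsNormalizable A B C D := by
  obtain ⟨U, V, h⟩ := h
  refine ⟨U, V * slMk 0 1 (-1) 0 (by ring), fun γ => ?_⟩
  rw [show A * D - B * C = B * (-C) - (-A) * D by ring, ← h γ, ← mul_assoc]
  set δ := U * γ * V
  simp only [linForm, sl_mul_apply,
    slMk_zero_zero, slMk_zero_one, slMk_one_zero, slMk_one_one]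
  ring

lemma IsNormalizable.rotate_left {A B C D : R} (h : IsNormalizable (-C) (-D) A B) :
    IsNormalizable A B C D := by
  obtain ⟨U, V, h⟩ := h
  refine ⟨slMk 0 1 (-1) 0 (by ring) * U, V, fun γ => ?_⟩
  rw [show A * D - B * C = (-C) * B - (-D) * A by ring, ← h γ, mul_assoc, mul_assoc, ← mul_assoc U]
  set δ := U * γ * V
  simp only [linForm, sl_mul_apply,
    slMk_zero_zero, slMk_zero_one, slMk_one_zero, slMk_one_one]
  ring

lemma isNormalizable_of_exists_isUnit (A B C D : R)
    (h : IsUnit A ∨ IsUnit B ∨ IsUnit C ∨ IsUnit D) : IsNormalizable A B C D := by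
  rcases h with h | h | h | h
  · exact isNormalizable_of_isUnit _ _ _ _ h
  · exact (isNormalizable_of_isUnit _ _ _ _ h).rotate_right
  · exact (isNormalizable_of_isUnit _ _ _ _ h.neg).rotate_left
  · exact (IsNormalizable.rotate_left (isNormalizable_of_isUnit _ _ _ _ h.neg)).rotate_right

lemma IsNormalizable.sum_eq [Fintype R] [DecidableEq R] {M : Type*} [AddCommMonoid M]
    {A B C D : R} (h : IsNormalizable A B C D) (F : R → M) :
    ∑ γ : SpecialLinearGroup (Fin 2) R, F (linForm A B C D γ) =
      ∑ γ : SpecialLinearGroup (Fin 2) R, F (γ.1 0 0 + (A * D - B * C) * γ.1 1 1) := by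
  obtain ⟨U, V, h⟩ := h
  symm
  exact Fintype.sum_equiv ((Equiv.mulLeft U).trans (Equiv.mulRight V)) _ _
    (fun γ => by rw [← h γ]; rfl)

/-- Splitting a sum over `SL₂(R)` according to whether the upper left entry is a unit. -/
lemma sum_sl_two [Fintype R] [DecidableEq R] [DecidablePred (IsUnit (M := R))] {M : Type*} [AddCommMonoid M]
    (hR : ∀ a : R, ¬ IsUnit a → IsNilpotent a) (F : R → R → M) :
    ∑ γ : SpecialLinearGroup (Fin 2) R, F (γ.1 0 0) (γ.1 1 1) =
      ∑ a : Rˣ, ∑ b : R, ∑ c : R, F a (↑a⁻¹ * (1 + b * c)) +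
      ∑ a ∈ Finset.univ.filter (fun a : R => ¬ IsUnit a), ∑ _b : Rˣ, ∑ d : R, F a d := by
  rw [← Finset.sum_filter_add_sum_filter_not Finset.univ
    (fun γ : SpecialLinearGroup (Fin 2) R => IsUnit (γ.1 0 0))]
  have hb : ∀ γ : SpecialLinearGroup (Fin 2) R, ¬ IsUnit (γ.1 0 0) → IsUnit (γ.1 0 1) := by
    intro γ hγ
    have hdet := γ.2
    rw [Matrix.det_fin_two] at hdet
    have h1 : IsNilpotent (γ.1 0 0 * γ.1 1 1) := (Commute.all _ _).isNilpotent_mul_right (hR _ hγ)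
    have h2 : IsUnit (γ.1 0 1 * γ.1 1 0) := by
      rw [show γ.1 0 1 * γ.1 1 0 = γ.1 0 0 * γ.1 1 1 - 1 by linear_combination -hdet]
      exact h1.isUnit_sub_one
    exact isUnit_of_mul_isUnit_left h2
  congr 1
  · simp_rw [← Finset.sum_product', Finset.univ_product_univ]
    refine Finset.sum_bij' (fun γ hγ => ((Finset.mem_filter.mp hγ).2.unit, γ.1 0 1, γ.1 1 0))
      (fun x _ => slMk x.1 x.2.1 x.2.2 (↑x.1⁻¹ * (1 + x.2.1 * x.2.2)) (by
        rw [← mul_assoc, Units.mul_inv]; ring)) ?_ ?_ ?_ ?_ ?_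
    · simp
    · simp
    · intro γ hγ
      have hu := (Finset.mem_filter.mp hγ).2
      have hdet := γ.2
      rw [Matrix.det_fin_two] at hdet
      refine sl_ext rfl rfl rfl ?_
      simp only [slMk_one_one]
      rw [show 1 + γ.1 0 1 * γ.1 1 0 = γ.1 0 0 * γ.1 1 1 by linear_combination -hdet, ← mul_assoc,
        IsUnit.val_inv_mul, one_mul]
    · rintro ⟨a, b, c⟩ _
      ext <;> simp
    · intro γ hγ
      have hu := (Finset.mem_filter.mp hγ).2
      have hdet := γ.2
      rw [Matrix.det_fin_two] at hdet
      simp only [IsUnit.unit_spec]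
      rw [show 1 + γ.1 0 1 * γ.1 1 0 = γ.1 0 0 * γ.1 1 1 by linear_combination -hdet, ← mul_assoc,
        IsUnit.val_inv_mul, one_mul]
  · have hS : ∑ a ∈ Finset.univ.filter (fun a : R => ¬ IsUnit a), ∑ _b : Rˣ, ∑ d : R, F a d =
        ∑ x ∈ (Finset.univ.filter (fun a : R => ¬ IsUnit a)) ×ˢ
          (Finset.univ : Finset (Rˣ × R)), F x.1 x.2.2 := by
      rw [Finset.sum_product]
      refine Finset.sum_congr rfl fun a _ => ?_
      rw [← Finset.univ_product_univ, Finset.sum_product]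
    rw [hS]
    refine Finset.sum_bij' (fun γ hγ => (γ.1 0 0, (hb γ (Finset.mem_filter.mp hγ).2).unit, γ.1 1 1))
      (fun x _ => slMk x.1 x.2.1 (↑x.2.1⁻¹ * (x.1 * x.2.2 - 1)) x.2.2 (by
        rw [← mul_assoc, Units.mul_inv]; ring)) ?_ ?_ ?_ ?_ ?_
    · intro γ hγ
      simpa using hγ
    · intro x hx
      simpa using hx
    · intro γ hγ
      have hu := hb γ (Finset.mem_filter.mp hγ).2
      have hdet := γ.2
      rw [Matrix.det_fin_two] at hdet
      refine sl_ext rfl rfl ?_ rfl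
      simp only [slMk_one_zero]
      rw [show γ.1 0 0 * γ.1 1 1 - 1 = γ.1 0 1 * γ.1 1 0 by linear_combination hdet, ← mul_assoc,
        IsUnit.val_inv_mul, one_mul]
    · rintro ⟨a, b, c⟩ _
      ext <;> simp
    · intro γ hγ
      rfl

end Smith

section Local

variable {p K q : ℕ}

lemma isUnit_intCast_iff [hp : Fact p.Prime] (hq : q = p ^ (K + 1)) (a : ℤ) :
    IsUnit (a : ZMod q) ↔ ¬ (p : ℤ) ∣ a := by
  rw [ZMod.coe_int_isUnit_iff_isCoprime, hq, Nat.cast_pow,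
    IsCoprime.pow_left_iff (Nat.succ_pos K),
    ← (Nat.prime_iff_prime_int.mp hp.out).coprime_iff_not_dvd]

lemma isNilpotent_of_not_isUnit [hp : Fact p.Prime] (hq : q = p ^ (K + 1)) (a : ZMod q)
    (ha : ¬ IsUnit a) : IsNilpotent a := by
  obtain ⟨m, rfl⟩ := ZMod.intCast_surjective a
  rw [isUnit_intCast_iff hq, not_not] at ha
  refine ⟨K + 1, ?_⟩
  rw [← Int.cast_pow, ZMod.intCast_zmod_eq_zero_iff_dvd, hq, Nat.cast_pow]
  exact pow_dvd_pow_of_dvd ha _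

lemma isUnit_add_of_not_isUnit [hp : Fact p.Prime] (hq : q = p ^ (K + 1)) {a b : ZMod q}
    (ha : ¬ IsUnit a) (hb : IsUnit b) : IsUnit (a + b) :=
  (isNilpotent_of_not_isUnit hq a ha).isUnit_add_right_of_commute hb (Commute.all _ _)

lemma isNormalizable_zmod [hp : Fact p.Prime] (hq : q = p ^ (K + 1)) {A B C D : ℤ}
    (hgcd : Int.gcd A (Int.gcd B (Int.gcd C D)) = 1) :
    IsNormalizable (A : ZMod q) (B : ZMod q) (C : ZMod q) (D : ZMod q) := by
  apply isNormalizable_of_exists_isUnit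
  simp only [isUnit_intCast_iff hq]
  by_contra! h
  have h1 := Int.dvd_coe_gcd h.1 (Int.dvd_coe_gcd h.2.1 (Int.dvd_coe_gcd h.2.2.1 h.2.2.2))
  rw [hgcd] at h1
  have h2 : p ∣ 1 := by exact_mod_cast h1
  exact hp.out.one_lt.ne' (Nat.dvd_one.mp h2)

lemma card_mul_eq_zero_le [NeZero q] {n : ℕ} (hn : 0 < n) :
    (Finset.univ.filter fun y : ZMod q => (n : ZMod q) * y = 0).card ≤ n := by
  have := IsAddCyclic.card_nsmul_eq_zero_le (α := ZMod q) hn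
  simpa [nsmul_eq_mul] using this

lemma card_intCast_mul_eq_zero_le [NeZero q] {d : ℤ} (hd : d ≠ 0) :
    (Finset.univ.filter fun y : ZMod q => (d : ZMod q) * y = 0).card ≤ d.natAbs := by
  refine le_trans (Finset.card_le_card ?_) (card_mul_eq_zero_le (q := q) (Int.natAbs_pos.mpr hd))
  intro y
  simp only [Finset.mem_filter, Finset.mem_univ, true_and]
  intro h
  rcases Int.natAbs_eq d with h1 | h1
  · rw [h1] at h
    simpa using h
  · rw [h1] at h
    simpa using h

/-- The sum of Ramanujan sums to which the sum over `SL₂(ℤ/qℤ)` reduces. -/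
noncomputable def quadSum (q : ℕ) [NeZero q] (Δ x : ZMod q) : ℂ :=
  ∑ a : (ZMod q)ˣ, ramanujanSum q ((a : ZMod q) ^ 2 - x * a + Δ)

lemma sum_Lform_eq [hp : Fact p.Prime] (hq : q = p ^ (K + 1)) [NeZero q] {A B C D : ℤ}
    (hgcd : Int.gcd A (Int.gcd B (Int.gcd C D)) = 1)
    (hΔ : ((A * D - B * C : ℤ) : ZMod q) ≠ 0) (x : ZMod q) :
    ∑ γ : SpecialLinearGroup (Fin 2) (ZMod q), ramanujanSum q (Lform A B C D γ - x) =
      (q : ℂ) * ((Finset.univ.filter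
        fun y : ZMod q => ((A * D - B * C : ℤ) : ZMod q) * y = 0).card : ℂ) *
        quadSum q ((A * D - B * C : ℤ) : ZMod q) x := by
  classical
  have h1 := (isNormalizable_zmod (q := q) hq hgcd).sum_eq (fun y => ramanujanSum q (y - x))
  have h2 : ∀ γ, linForm (A : ZMod q) B C D γ = Lform A B C D γ := fun γ => rfl
  simp only [h2] at h1
  rw [h1, show (A : ZMod q) * D - B * C = ((A * D - B * C : ℤ) : ZMod q) by push_cast; rfl]
  generalize ((A * D - B * C : ℤ) : ZMod q) = Δ at *
  rw [sum_sl_two (isNilpotent_of_not_isUnit hq) (fun a d => ramanujanSum q (a + Δ * d - x))]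
  rw [Finset.sum_eq_zero (s := Finset.univ.filter _), add_zero, quadSum, Finset.mul_sum]
  · refine Finset.sum_congr rfl fun a _ => ?_
    have h3 : ∀ b : ZMod q, ∑ c : ZMod q,
        ramanujanSum q ((a : ZMod q) + Δ * (↑a⁻¹ * (1 + b * c)) - x) =
        if Δ * b = 0 then q * ramanujanSum q ((a : ZMod q) ^ 2 - x * a + Δ) else 0 := by
      intro b
      have h4 : ∀ c : ZMod q, (a : ZMod q) + Δ * (↑a⁻¹ * (1 + b * c)) - x =
          (↑a⁻¹ * ((a : ZMod q) ^ 2 - x * a + Δ)) + (↑a⁻¹ * (Δ * b)) * c := by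
        intro c
        have h5 : (a : ZMod q) * ↑a⁻¹ = 1 := Units.mul_inv a
        linear_combination (-(a : ZMod q) + x) * h5
      simp_rw [h4]
      rw [sum_ramanujanSum_add_mul, ramanujanSum_unit_mul]
      simp only [Units.mul_right_eq_zero]
    simp_rw [h3]
    rw [← Finset.sum_filter, Finset.sum_const, nsmul_eq_mul]
    ring
  · intro a _
    refine Finset.sum_eq_zero fun b _ => ?_
    have h4 : ∀ d : ZMod q, a + Δ * d - x = (a - x) + Δ * d := fun d => by ring
    simp_rw [h4]
    rw [sum_ramanujanSum_add_mul, if_neg hΔ]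

lemma card_sl [hp : Fact p.Prime] (hq : q = p ^ (K + 1)) [NeZero q] :
    Fintype.card (SpecialLinearGroup (Fin 2) (ZMod q)) =
      q.totient * q ^ 2 + (q - q.totient) * (q.totient * q) := by
  classical
  have h := sum_sl_two (isNilpotent_of_not_isUnit (q := q) hq) (fun _ _ => (1 : ℕ))
  have h2 : (Finset.univ.filter (fun a : ZMod q => ¬ IsUnit a)).card = q - q.totient := by
    have h3 : (Finset.univ.filter (fun a : ZMod q => IsUnit a)).card = q.totient := by
      rw [← ZMod.card_units_eq_totient, ← Finset.card_univ]
      symm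
      refine Finset.card_bij (fun u _ => (u : ZMod q)) (by simp) (fun a _ b _ h => Units.ext h) ?_
      intro b hb
      obtain ⟨u, rfl⟩ := (Finset.mem_filter.mp hb).2
      exact ⟨u, Finset.mem_univ _, rfl⟩
    have h4 := Finset.card_filter_add_card_filter_not (s := (Finset.univ : Finset (ZMod q)))
      (fun a : ZMod q => IsUnit a)
    rw [Finset.card_univ, ZMod.card, h3] at h4
    omega
  simp only [Finset.sum_const, Finset.card_univ, smul_eq_mul, mul_one, ZMod.card,
    ZMod.card_units_eq_totient, h2] at h
  rw [h]
  ring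

end Local

section Roots

variable {p K q : ℕ}

lemma pow_dvd_or_pow_dvd (hp : p.Prime) {j m u v : ℕ} (hm : 2 * m ≤ j + 1)
    (h : p ^ j ∣ u * v) : p ^ m ∣ u ∨ p ^ m ∣ v := by
  obtain ⟨d₁, d₂, h₁, h₂, h₃⟩ := exists_dvd_and_dvd_of_dvd_mul h
  obtain ⟨i₁, _, rfl⟩ := (Nat.dvd_prime_pow hp).mp (Dvd.intro _ h₃.symm)
  obtain ⟨i₂, _, rfl⟩ := (Nat.dvd_prime_pow hp).mp (Dvd.intro_left _ h₃.symm)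
  rw [← pow_add] at h₃
  have h₄ := Nat.pow_right_injective hp.two_le h₃
  by_cases h₅ : m ≤ i₁
  · exact Or.inl ((pow_dvd_pow p h₅).trans h₁)
  · exact Or.inr ((pow_dvd_pow p (by omega)).trans h₂)

lemma pow_mul_eq_zero_iff [hp : Fact p.Prime] (hq : q = p ^ (K + 1)) {j : ℕ} (hj : j ≤ K + 1)
    (m : ℤ) : ((p ^ (K + 1 - j) : ℕ) : ZMod q) * (m : ZMod q) = 0 ↔ p ^ j ∣ m.natAbs := by
  have h1 : ((p ^ (K + 1 - j) : ℕ) : ZMod q) * (m : ZMod q) =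
      (((p ^ (K + 1 - j) : ℕ) * m : ℤ) : ZMod q) := by push_cast; rfl
  rw [h1, ZMod.intCast_zmod_eq_zero_iff_dvd, ← Int.natCast_dvd, hq,
    show p ^ (K + 1) = p ^ (K + 1 - j) * p ^ j by rw [← pow_add]; congr 1; omega, Nat.cast_mul]
  exact mul_dvd_mul_iff_left (by exact_mod_cast (pow_pos hp.out.pos _).ne')

/-- A quadratic congruence modulo `p ^ j` has few solutions modulo `p ^ k`. -/
lemma card_quad_roots_le [hp : Fact p.Prime] (hq : q = p ^ (K + 1)) [NeZero q] {j : ℕ}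
    (hj : j ≤ K + 1) (Δ x : ZMod q) :
    (Finset.univ.filter fun a : ZMod q =>
      ((p ^ (K + 1 - j) : ℕ) : ZMod q) * (a ^ 2 - x * a + Δ) = 0).card ≤
      2 * p ^ (K + 1 - (j + 1) / 2) := by
  classical
  set S := Finset.univ.filter fun a : ZMod q =>
      ((p ^ (K + 1 - j) : ℕ) : ZMod q) * (a ^ 2 - x * a + Δ) = 0 with hS
  rcases S.eq_empty_or_nonempty with h | ⟨a₀, ha₀⟩
  · rw [h]; simp
  set m := (j + 1) / 2 with hm
  have hcount : ∀ c : ZMod q, (Finset.univ.filter fun a : ZMod q =>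
      ((p ^ (K + 1 - m) : ℕ) : ZMod q) * (a - c) = 0).card ≤ p ^ (K + 1 - m) := by
    intro c
    refine le_trans (le_of_eq ?_) (card_mul_eq_zero_le (q := q) (pow_pos hp.out.pos (K + 1 - m)))
    refine Finset.card_bij' (fun a _ => a - c) (fun a _ => a + c) ?_ ?_ ?_ ?_ <;> simp
  have hsub : S ⊆ (Finset.univ.filter fun a : ZMod q =>
      ((p ^ (K + 1 - m) : ℕ) : ZMod q) * (a - a₀) = 0) ∪ (Finset.univ.filter fun a : ZMod q =>
      ((p ^ (K + 1 - m) : ℕ) : ZMod q) * (a - (x - a₀)) = 0) := by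
    intro a ha
    rw [hS, Finset.mem_filter] at ha ha₀
    have h1 : ((p ^ (K + 1 - j) : ℕ) : ZMod q) * ((a - a₀) * (a - (x - a₀))) = 0 := by
      linear_combination ha.2 - ha₀.2
    simp only [Finset.mem_union, Finset.mem_filter, Finset.mem_univ, true_and]
    generalize a - a₀ = u at *
    generalize a - (x - a₀) = v at *
    obtain ⟨u, rfl⟩ := ZMod.intCast_surjective u
    obtain ⟨v, rfl⟩ := ZMod.intCast_surjective v
    rw [← Int.cast_mul, pow_mul_eq_zero_iff hq hj, Int.natAbs_mul] at h1
    rw [pow_mul_eq_zero_iff hq (by omega), pow_mul_eq_zero_iff hq (by omega)]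
    exact pow_dvd_or_pow_dvd hp.out (by omega) h1
  calc S.card ≤ _ := Finset.card_le_card hsub
    _ ≤ _ := Finset.card_union_le _ _
    _ ≤ p ^ (K + 1 - m) + p ^ (K + 1 - m) := add_le_add (hcount _) (hcount _)
    _ = 2 * p ^ (K + 1 - m) := by ring

lemma ramanujanSum_of_eq_prime_pow [hp : Fact p.Prime] (hq : q = p ^ (K + 1)) [NeZero q]
    (x : ZMod q) : ramanujanSum q x =
      (if x = 0 then (q : ℂ) else 0) - (if (p : ZMod q) * x = 0 then (p : ℂ) ^ K else 0) := by
  subst hq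
  rw [ramanujanSum_prime_pow, Nat.cast_pow]

lemma norm_ramanujanSum_le_ite [hp : Fact p.Prime] (hq : q = p ^ (K + 1)) [NeZero q]
    (x : ZMod q) : ‖ramanujanSum q x‖ ≤
      (if x = 0 then (q : ℝ) else 0) + (if (p : ZMod q) * x = 0 then (p : ℝ) ^ K else 0) := by
  rw [ramanujanSum_of_eq_prime_pow hq]
  refine (norm_sub_le _ _).trans (add_le_add ?_ ?_) <;> split_ifs <;> simp

lemma card_units_filter_le [NeZero q] (P : ZMod q → Prop) [DecidablePred P] :
    (Finset.univ.filter fun a : (ZMod q)ˣ => P a).card ≤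
      (Finset.univ.filter fun a : ZMod q => P a).card := by
  refine Finset.card_le_card_of_injOn (fun a => (a : ZMod q)) ?_ ?_
  · intro a ha
    simpa using ha
  · intro a _ b _ h
    exact Units.ext h

lemma norm_quadSum_le_sum [hp : Fact p.Prime] (hq : q = p ^ (K + 1)) [NeZero q]
    (Δ x : ZMod q) : ‖quadSum q Δ x‖ ≤
      ∑ a : (ZMod q)ˣ, ((if (a : ZMod q) ^ 2 - x * a + Δ = 0 then (q : ℝ) else 0) +
        (if (p : ZMod q) * ((a : ZMod q) ^ 2 - x * a + Δ) = 0 then (p : ℝ) ^ K else 0)) :=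
  (norm_sum_le _ _).trans (Finset.sum_le_sum fun _ _ => norm_ramanujanSum_le_ite hq _)

lemma norm_quadSum_mul_le [hp : Fact p.Prime] (hq : q = p ^ (K + 1)) [NeZero q]
    (Δ x : ZMod q) : ‖quadSum q Δ x‖ * (p : ℝ) ^ ((K + 2) / 2) ≤ 4 * (q : ℝ) ^ 2 := by
  have hp1 : (1 : ℝ) ≤ p := by exact_mod_cast hp.out.one_lt.le
  have h0 := norm_quadSum_le_sum hq Δ x
  rw [Finset.sum_add_distrib, ← Finset.sum_filter, ← Finset.sum_filter, Finset.sum_const,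
    Finset.sum_const, nsmul_eq_mul, nsmul_eq_mul] at h0
  have h1 := (card_units_filter_le (q := q) (fun a => a ^ 2 - x * a + Δ = 0)).trans
    (by simpa using card_quad_roots_le hq (le_refl (K + 1)) Δ x)
  have h2 := (card_units_filter_le (q := q)
    (fun a => (p : ZMod q) * (a ^ 2 - x * a + Δ) = 0)).trans
    (by simpa using card_quad_roots_le hq (Nat.le_succ K) Δ x)
  have h1' : ((Finset.univ.filter fun a : (ZMod q)ˣ =>
      (a : ZMod q) ^ 2 - x * a + Δ = 0).card : ℝ) ≤ 2 * (p : ℝ) ^ (K + 1 - (K + 1 + 1) / 2) := by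
    exact_mod_cast h1
  have h2' : ((Finset.univ.filter fun a : (ZMod q)ˣ =>
      (p : ZMod q) * ((a : ZMod q) ^ 2 - x * a + Δ) = 0).card : ℝ) ≤
      2 * (p : ℝ) ^ (K + 1 - (K + 1) / 2) := by
    exact_mod_cast h2
  have hqr : (q : ℝ) = (p : ℝ) ^ (K + 1) := by rw [hq, Nat.cast_pow]
  have e1 : (p : ℝ) ^ (K + 1 - (K + 1 + 1) / 2) * (p : ℝ) ^ ((K + 2) / 2) = q := by
    rw [hqr, ← pow_add]; congr 1; omega
  have e2 : (p : ℝ) ^ (K + 1 - (K + 1) / 2) * (p : ℝ) ^ K * (p : ℝ) ^ ((K + 2) / 2) ≤ q ^ 2 := by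
    rw [hqr, ← pow_mul, ← pow_add, ← pow_add]
    exact pow_le_pow_right₀ hp1 (by omega)
  have hpk : (0 : ℝ) ≤ (p : ℝ) ^ K := by positivity
  have hpk2 : (0 : ℝ) ≤ (p : ℝ) ^ ((K + 2) / 2) := by positivity
  have hq0 : (0 : ℝ) ≤ q := by positivity
  calc _ ≤ (2 * (p : ℝ) ^ (K + 1 - (K + 1 + 1) / 2) * q +
        2 * (p : ℝ) ^ (K + 1 - (K + 1) / 2) * p ^ K) * (p : ℝ) ^ ((K + 2) / 2) := by
        refine mul_le_mul_of_nonneg_right (h0.trans ?_) hpk2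
        exact add_le_add (mul_le_mul_of_nonneg_right h1' hq0)
          (mul_le_mul_of_nonneg_right h2' hpk)
    _ = 2 * q * ((p : ℝ) ^ (K + 1 - (K + 1 + 1) / 2) * (p : ℝ) ^ ((K + 2) / 2)) +
        2 * ((p : ℝ) ^ (K + 1 - (K + 1) / 2) * (p : ℝ) ^ K * (p : ℝ) ^ ((K + 2) / 2)) := by ring
    _ ≤ 2 * q * q + 2 * q ^ 2 := by rw [e1]; linarith
    _ = 4 * (q : ℝ) ^ 2 := by ring

lemma sum_norm_quadSum_le [hp : Fact p.Prime] (hq : q = p ^ (K + 1)) [NeZero q]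
    (Δ : ZMod q) : ∑ x : ZMod q, ‖quadSum q Δ x‖ ≤ 2 * (q : ℝ) ^ 2 := by
  refine (Finset.sum_le_sum fun x _ => norm_quadSum_le_sum hq Δ x).trans ?_
  rw [Finset.sum_comm]
  have hqr : (q : ℝ) = (p : ℝ) ^ (K + 1) := by rw [hq, Nat.cast_pow]
  have key : ∀ (a : (ZMod q)ˣ) (G : ZMod q → ℝ),
      ∑ x : ZMod q, G ((a : ZMod q) ^ 2 - x * a + Δ) = ∑ y, G y := by
    intro a G
    refine Fintype.sum_bijective (fun x : ZMod q => (a : ZMod q) ^ 2 - x * a + Δ) ?_ _ _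
      (fun _ => rfl)
    refine (Finite.injective_iff_bijective).mp ?_
    intro x y h
    have h1 : x * (a : ZMod q) = y * a := by linear_combination -h
    exact a.isUnit.mul_right_cancel h1
  have h1 : ∀ a : (ZMod q)ˣ, ∑ x : ZMod q,
      ((if (a : ZMod q) ^ 2 - x * a + Δ = 0 then (q : ℝ) else 0) +
        (if (p : ZMod q) * ((a : ZMod q) ^ 2 - x * a + Δ) = 0 then (p : ℝ) ^ K else 0)) ≤
        2 * q := by
    intro a
    rw [key a (fun y => (if y = 0 then (q : ℝ) else 0) +
      (if (p : ZMod q) * y = 0 then (p : ℝ) ^ K else 0)), Finset.sum_add_distrib,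
      ← Finset.sum_filter, ← Finset.sum_filter, Finset.sum_const, Finset.sum_const,
      nsmul_eq_mul, nsmul_eq_mul]
    have h2 : ((Finset.univ.filter fun y : ZMod q => (p : ZMod q) * y = 0).card : ℝ) ≤ p := by
      exact_mod_cast card_mul_eq_zero_le (q := q) hp.out.pos
    have h3 : (Finset.univ.filter fun y : ZMod q => y = 0).card = 1 := by
      rw [Finset.card_eq_one]; exact ⟨0, by ext; simp⟩
    rw [h3]
    have h4 : ((Finset.univ.filter fun y : ZMod q => (p : ZMod q) * y = 0).card : ℝ) * p ^ K ≤
      p * p ^ K := mul_le_mul_of_nonneg_right h2 (by positivity)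
    have h5 : (p : ℝ) * p ^ K = q := by rw [hqr]; ring
    rw [h5] at h4
    push_cast
    linarith
  calc _ ≤ ∑ _a : (ZMod q)ˣ, 2 * (q : ℝ) := Finset.sum_le_sum fun a _ => h1 a
    _ = (q.totient : ℝ) * (2 * q) := by
      rw [Finset.sum_const, Finset.card_univ, ZMod.card_units_eq_totient, nsmul_eq_mul]
    _ ≤ q * (2 * q) := by
      refine mul_le_mul_of_nonneg_right ?_ (by positivity)
      exact_mod_cast Nat.totient_le q
    _ = 2 * (q : ℝ) ^ 2 := by ring

lemma card_sl_ge [hp : Fact p.Prime] (hq : q = p ^ (K + 1)) [NeZero q] :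
    (q : ℝ) ^ 3 ≤ 2 * (Fintype.card (SpecialLinearGroup (Fin 2) (ZMod q)) : ℝ) := by
  have h1 : q ≤ 2 * q.totient := by
    rw [hq, Nat.totient_prime_pow_succ hp.out, pow_succ]
    have := hp.out.two_le
    calc p ^ K * p ≤ p ^ K * (2 * (p - 1)) := Nat.mul_le_mul_left _ (by omega)
      _ = _ := by ring
  have h2 : q ^ 3 ≤ 2 * Fintype.card (SpecialLinearGroup (Fin 2) (ZMod q)) := by
    rw [card_sl hq]
    calc q ^ 3 = q * q ^ 2 := by ring
      _ ≤ 2 * q.totient * q ^ 2 := Nat.mul_le_mul_right _ h1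
      _ = 2 * (q.totient * q ^ 2) := by ring
      _ ≤ _ := Nat.mul_le_mul_left _ (Nat.le_add_right _ _)
  exact_mod_cast h2

end Roots

section LocalBounds

variable {p K q : ℕ}

lemma norm_cterm_le [NeZero q] (A B C D : ℤ) (x : ZMod q) : ‖cterm A B C D q x‖ ≤ q := by
  have hG : (0 : ℝ) < Fintype.card (SpecialLinearGroup (Fin 2) (ZMod q)) := by
    exact_mod_cast Fintype.card_pos
  rw [cterm, norm_mul, norm_inv, Complex.norm_natCast, inv_mul_le_iff₀ hG]
  refine (norm_sum_le _ _).trans ((Finset.sum_le_sum fun γ _ => norm_ramanujanSum_le _).trans ?_)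
  rw [Finset.sum_const, Finset.card_univ, nsmul_eq_mul]

lemma norm_cterm_mul_le [hp : Fact p.Prime] (hq : q = p ^ (K + 1)) [NeZero q] {A B C D : ℤ}
    (hgcd : Int.gcd A (Int.gcd B (Int.gcd C D)) = 1)
    (hΔ : ((A * D - B * C : ℤ) : ZMod q) ≠ 0) (x : ZMod q) :
    ‖cterm A B C D q x‖ * (q : ℝ) ^ 2 ≤
      2 * |((A * D - B * C : ℤ) : ℝ)| * ‖quadSum q ((A * D - B * C : ℤ) : ZMod q) x‖ := by
  have hG : (0 : ℝ) < Fintype.card (SpecialLinearGroup (Fin 2) (ZMod q)) := by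
    exact_mod_cast Fintype.card_pos
  have hq0 : (0 : ℝ) < q := by exact_mod_cast Nat.pos_of_ne_zero (NeZero.ne q)
  have hΔ0 : (A * D - B * C : ℤ) ≠ 0 := by
    rintro h; rw [h] at hΔ; simp at hΔ
  rw [cterm, sum_Lform_eq hq hgcd hΔ, norm_mul, norm_inv, Complex.norm_natCast, norm_mul, norm_mul,
    Complex.norm_natCast, Complex.norm_natCast]
  have hc := card_intCast_mul_eq_zero_le (q := q) hΔ0
  have hc' : ((Finset.univ.filter
      fun y : ZMod q => ((A * D - B * C : ℤ) : ZMod q) * y = 0).card : ℝ) ≤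
      |((A * D - B * C : ℤ) : ℝ)| := by
    refine (Nat.cast_le.mpr hc).trans (le_of_eq ?_)
    rw [Nat.cast_natAbs, Int.cast_abs]
  have hcard := card_sl_ge (q := q) hq
  set T := ‖quadSum q ((A * D - B * C : ℤ) : ZMod q) x‖
  have hT : 0 ≤ T := norm_nonneg _
  set c := ((Finset.univ.filter
      fun y : ZMod q => ((A * D - B * C : ℤ) : ZMod q) * y = 0).card : ℝ)
  set G := (Fintype.card (SpecialLinearGroup (Fin 2) (ZMod q)) : ℝ)
  rw [mul_assoc, inv_mul_le_iff₀ hG]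
  calc q * c * T * q ^ 2 = q ^ 3 * (c * T) := by ring
    _ ≤ 2 * G * (|((A * D - B * C : ℤ) : ℝ)| * T) := by gcongr
    _ = _ := by ring

/-- The constant in the local bounds. -/
noncomputable def localC (A B C D : ℤ) : ℝ := 8 * ((A * D - B * C : ℤ) : ℝ) ^ 2

lemma abs_le_sq_intCast (d : ℤ) : |(d : ℝ)| ≤ (d : ℝ) ^ 2 := by
  rw [← Int.cast_abs, ← Int.cast_pow, ← sq_abs]
  exact_mod_cast Int.le_self_sq |d|

lemma localC_pos {A B C D : ℤ} (hΔ0 : A * D - B * C ≠ 0) : 0 < localC A B C D := by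
  have : ((A * D - B * C : ℤ) : ℝ) ≠ 0 := by exact_mod_cast hΔ0
  rw [localC]; positivity

lemma cast_le_abs_of_eq_zero {d : ℤ} (hd : d ≠ 0) (h : (d : ZMod q) = 0) : (q : ℝ) ≤ |(d : ℝ)| := by
  rw [ZMod.intCast_zmod_eq_zero_iff_dvd] at h
  rw [← Int.cast_abs]
  exact_mod_cast Int.le_of_dvd (abs_pos.mpr hd) ((dvd_abs _ _).mpr h)

lemma norm_cterm_prime_pow_le [hp : Fact p.Prime] (hq : q = p ^ (K + 1)) [NeZero q]
    {A B C D : ℤ} (hgcd : Int.gcd A (Int.gcd B (Int.gcd C D)) = 1) (hΔ0 : A * D - B * C ≠ 0)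
    (x : ZMod q) :
    ‖cterm A B C D q x‖ * (p : ℝ) ^ ((K + 2) / 2) ≤ localC A B C D := by
  have hp1 : (1 : ℝ) ≤ p := by exact_mod_cast hp.out.one_lt.le
  have hq0 : (0 : ℝ) < q := by exact_mod_cast Nat.pos_of_ne_zero (NeZero.ne q)
  have hsq := abs_le_sq_intCast (A * D - B * C)
  by_cases hΔ : ((A * D - B * C : ℤ) : ZMod q) = 0
  · have h1 := cast_le_abs_of_eq_zero hΔ0 hΔ
    have h2 := norm_cterm_le A B C D x
    have h3 : (p : ℝ) ^ ((K + 2) / 2) ≤ q := by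
      rw [hq, Nat.cast_pow]; exact pow_le_pow_right₀ hp1 (by omega)
    calc _ ≤ |((A * D - B * C : ℤ) : ℝ)| * |((A * D - B * C : ℤ) : ℝ)| :=
          mul_le_mul (h2.trans h1) (h3.trans h1) (by positivity) (by positivity)
      _ = ((A * D - B * C : ℤ) : ℝ) ^ 2 := abs_mul_abs_self _ |>.trans (sq _).symm
      _ ≤ _ := by rw [localC]; nlinarith [sq_nonneg ((A * D - B * C : ℤ) : ℝ)]
  · have h1 := norm_cterm_mul_le hq hgcd hΔ x
    have h2 := norm_quadSum_mul_le hq ((A * D - B * C : ℤ) : ZMod q) x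
    set T := ‖quadSum q ((A * D - B * C : ℤ) : ZMod q) x‖
    have hq2 : (0 : ℝ) < (q : ℝ) ^ 2 := by positivity
    have h3 : ‖cterm A B C D q x‖ * (p : ℝ) ^ ((K + 2) / 2) * (q : ℝ) ^ 2 ≤
        8 * |((A * D - B * C : ℤ) : ℝ)| * (q : ℝ) ^ 2 := by
      calc _ = (‖cterm A B C D q x‖ * (q : ℝ) ^ 2) * (p : ℝ) ^ ((K + 2) / 2) := by ring
        _ ≤ (2 * |((A * D - B * C : ℤ) : ℝ)| * T) * (p : ℝ) ^ ((K + 2) / 2) := by gcongr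
        _ = 2 * |((A * D - B * C : ℤ) : ℝ)| * (T * (p : ℝ) ^ ((K + 2) / 2)) := by ring
        _ ≤ 2 * |((A * D - B * C : ℤ) : ℝ)| * (4 * (q : ℝ) ^ 2) := by gcongr
        _ = _ := by ring
    refine (le_of_mul_le_mul_right h3 hq2).trans ?_
    rw [localC]; linarith

lemma sum_norm_cterm_prime_pow_le [hp : Fact p.Prime] (hq : q = p ^ (K + 1)) [NeZero q]
    {A B C D : ℤ} (hgcd : Int.gcd A (Int.gcd B (Int.gcd C D)) = 1) (hΔ0 : A * D - B * C ≠ 0) :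
    ∑ x : ZMod q, ‖cterm A B C D q x‖ ≤ localC A B C D := by
  have hq0 : (0 : ℝ) < q := by exact_mod_cast Nat.pos_of_ne_zero (NeZero.ne q)
  have hsq := abs_le_sq_intCast (A * D - B * C)
  by_cases hΔ : ((A * D - B * C : ℤ) : ZMod q) = 0
  · have h1 := cast_le_abs_of_eq_zero hΔ0 hΔ
    calc _ ≤ ∑ _x : ZMod q, (q : ℝ) := Finset.sum_le_sum fun x _ => norm_cterm_le A B C D x
      _ = q * q := by rw [Finset.sum_const, Finset.card_univ, ZMod.card, nsmul_eq_mul]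
      _ ≤ |((A * D - B * C : ℤ) : ℝ)| * |((A * D - B * C : ℤ) : ℝ)| := by gcongr
      _ = ((A * D - B * C : ℤ) : ℝ) ^ 2 := abs_mul_abs_self _ |>.trans (sq _).symm
      _ ≤ _ := by rw [localC]; nlinarith [sq_nonneg ((A * D - B * C : ℤ) : ℝ)]
  · have hq2 : (0 : ℝ) < (q : ℝ) ^ 2 := by positivity
    have h3 : (∑ x : ZMod q, ‖cterm A B C D q x‖) * (q : ℝ) ^ 2 ≤
        4 * |((A * D - B * C : ℤ) : ℝ)| * (q : ℝ) ^ 2 := by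
      rw [Finset.sum_mul]
      refine (Finset.sum_le_sum fun x _ => norm_cterm_mul_le hq hgcd hΔ x).trans ?_
      rw [← Finset.mul_sum]
      have := sum_norm_quadSum_le hq ((A * D - B * C : ℤ) : ZMod q)
      calc _ ≤ 2 * |((A * D - B * C : ℤ) : ℝ)| * (2 * (q : ℝ) ^ 2) := by gcongr
        _ = _ := by ring
    refine (le_of_mul_le_mul_right h3 hq2).trans ?_
    rw [localC]; nlinarith [abs_nonneg ((A * D - B * C : ℤ) : ℝ)]

lemma meanSq_prime_pow_le [hp : Fact p.Prime] (hq : q = p ^ (K + 1))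
    {A B C D : ℤ} (hgcd : Int.gcd A (Int.gcd B (Int.gcd C D)) = 1) (hΔ0 : A * D - B * C ≠ 0) :
    meanSq A B C D q ≤ localC A B C D ^ 2 / ((q : ℝ) * (p : ℝ) ^ ((K + 2) / 2)) := by
  have : NeZero q := ⟨by rw [hq]; exact pow_ne_zero _ hp.out.ne_zero⟩
  have hp0 : (0 : ℝ) < p := by exact_mod_cast hp.out.pos
  have hq0 : (0 : ℝ) < q := by exact_mod_cast Nat.pos_of_ne_zero (NeZero.ne q)
  rw [meanSq_eq, le_div_iff₀ (by positivity)]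
  have hC := localC_pos hΔ0
  calc _ = ∑ x : ZMod q, ‖cterm A B C D q x‖ * (‖cterm A B C D q x‖ *
        (p : ℝ) ^ ((K + 2) / 2)) := by
        rw [show ∀ a b c : ℝ, a⁻¹ * b * (a * c) = (a⁻¹ * a) * (b * c) by intros; ring,
          inv_mul_cancel₀ hq0.ne', one_mul, Finset.sum_mul]
        exact Finset.sum_congr rfl fun x _ => by ring
    _ ≤ ∑ x : ZMod q, ‖cterm A B C D q x‖ * localC A B C D :=
        Finset.sum_le_sum fun x _ => mul_le_mul_of_nonneg_left
          (norm_cterm_prime_pow_le hq hgcd hΔ0 x) (norm_nonneg _)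
    _ ≤ localC A B C D * localC A B C D := by
        rw [← Finset.sum_mul]
        exact mul_le_mul_of_nonneg_right (sum_norm_cterm_prime_pow_le hq hgcd hΔ0) hC.le
    _ = _ := (sq _).symm

end LocalBounds

section GoodPrimes

variable {p K q : ℕ}

lemma ramanujanSum_of_isUnit [hp : Fact p.Prime] (hq : q = p ^ (K + 1)) (hK : 1 ≤ K) [NeZero q]
    {x : ZMod q} (hx : IsUnit x) : ramanujanSum q x = 0 := by
  have h2 : (p : ZMod q) ≠ 0 := by
    rw [Ne, ZMod.natCast_eq_zero_iff, hq]
    intro h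
    have := Nat.le_of_dvd hp.out.pos h
    have h3 : p ^ 1 < p ^ (K + 1) := Nat.pow_lt_pow_right hp.out.one_lt (by omega)
    rw [pow_one] at h3
    omega
  have : Nontrivial (ZMod q) := ⟨_, _, h2⟩
  rw [ramanujanSum_of_eq_prime_pow hq, if_neg hx.ne_zero, if_neg, sub_zero]
  rw [hx.mul_left_eq_zero]
  exact h2

lemma quadSum_eq_zero [hp : Fact p.Prime] (hq : q = p ^ (K + 1)) (hK : 1 ≤ K) [NeZero q]
    {Δ x : ZMod q} (hΔ : IsUnit Δ) (hD : IsUnit (x ^ 2 - 4 * Δ)) : quadSum q Δ x = 0 := by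
  classical
  have hq0 : (q : ℂ) ≠ 0 := by exact_mod_cast NeZero.ne q
  have hT : quadSum q Δ x = ∑ a : ZMod q, ramanujanSum q (a ^ 2 - x * a + Δ) := by
    rw [quadSum, ← Finset.sum_filter_add_sum_filter_not Finset.univ (fun a : ZMod q => IsUnit a),
      Finset.sum_eq_zero (s := Finset.univ.filter fun a : ZMod q => ¬ IsUnit a), add_zero]
    · refine Finset.sum_bij (fun u _ => (u : ZMod q)) (by simp) (fun a _ b _ h => Units.ext h) ?_
        (fun _ _ => rfl)
      intro b hb
      obtain ⟨u, rfl⟩ := (Finset.mem_filter.mp hb).2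
      exact ⟨u, Finset.mem_univ _, rfl⟩
    · intro a ha
      refine ramanujanSum_of_isUnit hq hK (isUnit_add_of_not_isUnit hq ?_ hΔ)
      intro h
      rw [show a ^ 2 - x * a = a * (a - x) by ring] at h
      exact (Finset.mem_filter.mp ha).2 (isUnit_of_mul_isUnit_left h)
  have hP2 : ((p : ZMod q) ^ K) ^ 2 = 0 := by
    rw [← pow_mul, ← Nat.cast_pow, ZMod.natCast_eq_zero_iff, hq]
    exact pow_dvd_pow p (by omega)
  have hshift : ∀ t : ZMod q, quadSum q Δ x =
      ∑ a : ZMod q, ramanujanSum q ((a ^ 2 - x * a + Δ) + (p : ZMod q) ^ K * (2 * a - x) * t) := by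
    intro t
    rw [hT, ← Equiv.sum_comp (Equiv.addRight ((p : ZMod q) ^ K * t))]
    refine Finset.sum_congr rfl fun a _ => ?_
    congr 1
    simp only [Equiv.coe_addRight]
    linear_combination t ^ 2 * hP2
  have h2 : (q : ℂ) * quadSum q Δ x = 0 := by
    calc (q : ℂ) * quadSum q Δ x = ∑ _t : ZMod q, quadSum q Δ x := by
          rw [Finset.sum_const, Finset.card_univ, ZMod.card, nsmul_eq_mul]
      _ = ∑ t : ZMod q, ∑ a : ZMod q, ramanujanSum q ((a ^ 2 - x * a + Δ) +
            (p : ZMod q) ^ K * (2 * a - x) * t) := Finset.sum_congr rfl fun t _ => hshift t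
      _ = ∑ a : ZMod q, ∑ t : ZMod q, ramanujanSum q ((a ^ 2 - x * a + Δ) +
            (p : ZMod q) ^ K * (2 * a - x) * t) := Finset.sum_comm
      _ = 0 := by
        refine Finset.sum_eq_zero fun a _ => ?_
        rw [sum_ramanujanSum_add_mul]
        split_ifs with h
        · rw [ramanujanSum_of_isUnit hq hK, mul_zero]
          have hnu : ¬ IsUnit (2 * a - x) := by
            intro hu
            rw [hu.mul_left_eq_zero, ← Nat.cast_pow, ZMod.natCast_eq_zero_iff, hq] at h
            have h1 := Nat.le_of_dvd (pow_pos hp.out.pos _) h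
            have h3 : p ^ K < p ^ (K + 1) := Nat.pow_lt_pow_right hp.out.one_lt (by omega)
            omega
          have h4 : IsUnit (4 * (a ^ 2 - x * a + Δ)) := by
            rw [show 4 * (a ^ 2 - x * a + Δ) = (2 * a - x) ^ 2 + -(x ^ 2 - 4 * Δ) by ring]
            refine isUnit_add_of_not_isUnit hq ?_ hD.neg
            intro h5
            rw [sq] at h5
            exact hnu (isUnit_of_mul_isUnit_left h5)
          exact isUnit_of_mul_isUnit_right h4
        · rfl
  exact (mul_eq_zero.mp h2).resolve_left hq0

lemma cterm_eq_zero [hp : Fact p.Prime] (hq : q = p ^ (K + 1)) (hK : 1 ≤ K) [NeZero q]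
    {A B C D : ℤ} (hgcd : Int.gcd A (Int.gcd B (Int.gcd C D)) = 1) {n : ℤ}
    (hΔ : ¬ (p : ℤ) ∣ A * D - B * C) (hD : ¬ (p : ℤ) ∣ n ^ 2 - 4 * (A * D - B * C)) :
    cterm A B C D q (n : ZMod q) = 0 := by
  have h1 := (isUnit_intCast_iff (q := q) hq _).mpr hΔ
  have h2 := (isUnit_intCast_iff (q := q) hq _).mpr hD
  have : Nontrivial (ZMod q) := by
    refine ZMod.nontrivial_iff.mpr ?_
    rw [hq]
    exact (Nat.one_lt_pow (Nat.succ_ne_zero K) hp.out.one_lt).ne'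
  rw [cterm, sum_Lform_eq hq hgcd h1.ne_zero, quadSum_eq_zero hq hK h1, mul_zero, mul_zero]
  convert h2 using 1
  push_cast
  ring

lemma cterm_prime [hp : Fact p.Prime] (hp2 : p ≠ 2) {A B C D : ℤ}
    (hgcd : Int.gcd A (Int.gcd B (Int.gcd C D)) = 1) (n : ℤ)
    (hΔ : ¬ (p : ℤ) ∣ A * D - B * C) :
    cterm A B C D p (n : ZMod p) =
      (p * (legendreSym p (n ^ 2 - 4 * (A * D - B * C)) : ℂ) + 1) / ((p : ℂ) ^ 2 - 1) := by
  classical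
  have hq : p = p ^ (0 + 1) := by ring
  have hp1 : (1 : ℝ) < p := by exact_mod_cast hp.out.one_lt
  have hΔ1 := (isUnit_intCast_iff (q := p) hq _).mpr hΔ
  set Δ := A * D - B * C with hΔdef
  have hcard : ((Finset.univ.filter fun y : ZMod p => (Δ : ZMod p) * y = 0).card : ℂ) = 1 := by
    have : (Finset.univ.filter fun y : ZMod p => (Δ : ZMod p) * y = 0) = {0} := by
      ext y
      simp [hΔ1.ne_zero]
    rw [this]; simp
  have hG : (Fintype.card (SpecialLinearGroup (Fin 2) (ZMod p)) : ℂ) = p * ((p : ℂ) ^ 2 - 1) := by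
    rw [card_sl hq, Nat.totient_prime hp.out]
    have : p - (p - 1) = 1 := by have := hp.out.one_lt; omega
    rw [this]
    push_cast [Nat.cast_sub hp.out.one_lt.le]
    ring
  have hroots : ((Finset.univ.filter fun a : (ZMod p)ˣ =>
      (a : ZMod p) ^ 2 - n * a + Δ = 0).card : ℤ) = legendreSym p (n ^ 2 - 4 * Δ) + 1 := by
    rw [← legendreSym.card_sqrts p hp2]
    refine congrArg (Nat.cast : ℕ → ℤ) ?_
    have h2 : (2 : ZMod p) ≠ 0 := by
      have := (isUnit_intCast_iff (q := p) hq 2).mpr (by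
        intro h
        have h3 : p ∣ 2 := by exact_mod_cast h
        exact hp2 ((Nat.prime_dvd_prime_iff_eq hp.out Nat.prime_two).mp h3))
      exact_mod_cast this.ne_zero
    refine Finset.card_bij (fun a _ => 2 * (a : ZMod p) - n) ?_ ?_ ?_
    · intro a ha
      rw [Finset.mem_filter] at ha
      simp only [Set.mem_toFinset, Set.mem_ofPred_eq]
      push_cast
      linear_combination 4 * ha.2
    · intro a _ b _ h
      apply Units.ext
      have h3 : 2 * (a : ZMod p) = 2 * b := by linear_combination h
      exact mul_left_cancel₀ h2 h3
    · intro b hb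
      simp only [Set.mem_toFinset, Set.mem_ofPred_eq] at hb
      push_cast at hb
      have h4 : (2 : ZMod p) * 2⁻¹ = 1 := mul_inv_cancel₀ h2
      have h5 : ((b + n) * 2⁻¹ : ZMod p) ^ 2 - n * ((b + n) * 2⁻¹) + Δ = 0 := by
        have : (2 : ZMod p) ^ 2 * (((b + n) * 2⁻¹ : ZMod p) ^ 2 - n * ((b + n) * 2⁻¹) + Δ) = 0 := by
          linear_combination hb + ((b + n) ^ 2 * (2 * 2⁻¹ + 1) - 2 * n * (b + n)) * h4
        exact (mul_eq_zero.mp this).resolve_left (pow_ne_zero 2 h2)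
      have h6 : (b + n) * 2⁻¹ ≠ (0 : ZMod p) := by
        intro h0
        rw [h0] at h5
        exact hΔ1.ne_zero (by linear_combination h5)
      refine ⟨Units.mk0 _ h6, by simpa using h5, ?_⟩
      simp only [Units.val_mk0]
      linear_combination (b + n) * h4
  have hT : quadSum p (Δ : ZMod p) (n : ZMod p) =
      p * (legendreSym p (n ^ 2 - 4 * Δ) : ℂ) + 1 := by
    rw [quadSum]
    simp_rw [ramanujanSum_of_eq_prime_pow (q := p) hq]
    have hc : ((Finset.univ.filter fun a : (ZMod p)ˣ =>
      (a : ZMod p) ^ 2 - n * a + Δ = 0).card : ℂ) = (legendreSym p (n ^ 2 - 4 * Δ) : ℂ) + 1 := by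
      exact_mod_cast congrArg (Int.cast : ℤ → ℂ) hroots
    simp only [CharP.cast_eq_zero, zero_mul, if_true, pow_zero, Finset.sum_sub_distrib,
      ← Finset.sum_filter, Finset.sum_const, nsmul_eq_mul, hc, Finset.card_univ,
      ZMod.card_units_eq_totient, Nat.totient_prime hp.out, Nat.cast_sub hp.out.one_lt.le]
    push_cast
    ring
  rw [cterm, sum_Lform_eq hq hgcd hΔ1.ne_zero, ← hΔdef, hcard, hG, hT]
  have hp0 : (p : ℂ) ≠ 0 := by exact_mod_cast hp.out.ne_zero
  have hp3 : ((p : ℂ) ^ 2 - 1) ≠ 0 := by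
    have : ((p : ℝ) ^ 2 - 1) ≠ 0 := by nlinarith
    exact_mod_cast this
  field_simp

end GoodPrimes

section Multiplicative

/-- A nonnegative multiplicative function whose Euler product is bounded is summable. -/
lemma summable_of_multiplicative {f : ℕ → ℝ} (h0 : ∀ n, 0 ≤ f n) (hf0 : f 0 = 0) (hf1 : f 1 = 1)
    (hmul : ∀ {m n : ℕ}, m.Coprime n → f (m * n) = f m * f n) {u : ℕ → ℝ}
    (hsum : ∀ {p : ℕ}, p.Prime → Summable fun k => f (p ^ k))
    (hu : ∀ {p : ℕ}, p.Prime → ∑' k, f (p ^ k) ≤ 1 + u p) {U : ℝ}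
    (hU : ∀ s : Finset ℕ, (∀ p ∈ s, p.Prime) → ∏ p ∈ s, (1 + u p) ≤ U) :
    Summable f ∧ ∑' n, f n ≤ U := by
  have key : ∀ t : Finset ℕ, ∑ n ∈ t, f n ≤ U := by
    intro t
    set s := Finset.range (t.sup id + 1) with hs
    obtain ⟨h1, h2⟩ := EulerProduct.summable_and_hasSum_factoredNumbers_prod_filter_prime_tsum
      (f := f) hf1 hmul (fun hp => by simpa [abs_of_nonneg (h0 _)] using hsum hp) s
    have h3 : Summable ((Nat.factoredNumbers s).indicator f) :=
      summable_subtype_iff_indicator.mp h2.summable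
    have h4 : ∑ n ∈ t, f n = ∑ n ∈ t, (Nat.factoredNumbers s).indicator f n := by
      refine Finset.sum_congr rfl fun n hn => ?_
      by_cases hn0 : n = 0
      · subst hn0
        by_cases h : (0 : ℕ) ∈ Nat.factoredNumbers s <;> simp [h, hf0]
      · rw [Set.indicator_of_mem]
        refine Nat.mem_factoredNumbers.mpr ⟨hn0, fun p hp => ?_⟩
        rw [hs, Finset.mem_range]
        have h5 : p ≤ n := Nat.le_of_mem_primeFactorsList hp
        have h6 : n ≤ t.sup id := Finset.le_sup (f := id) hn
        omega
    rw [h4]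
    calc _ ≤ ∑' n, (Nat.factoredNumbers s).indicator f n :=
          h3.sum_le_tsum _ fun n _ => Set.indicator_nonneg (fun n _ => h0 n) n
      _ = ∏ p ∈ s with p.Prime, ∑' k, f (p ^ k) := by rw [← tsum_subtype]; exact h2.tsum_eq
      _ ≤ ∏ p ∈ s with p.Prime, (1 + u p) :=
          Finset.prod_le_prod (fun p _ => tsum_nonneg fun _ => h0 _)
            fun p hp => hu (Finset.mem_filter.mp hp).2
      _ ≤ U := hU _ fun p hp => (Finset.mem_filter.mp hp).2
  exact ⟨summable_of_sum_le h0 key, Real.tsum_le_of_sum_le h0 key⟩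

lemma prod_one_add_le_exp {u : ℕ → ℝ} (hu0 : ∀ n, 0 ≤ u n) (hu : Summable u) (s : Finset ℕ) :
    ∏ p ∈ s, (1 + u p) ≤ Real.exp (∑' n, u n) := by
  calc ∏ p ∈ s, (1 + u p) ≤ ∏ p ∈ s, Real.exp (u p) :=
        Finset.prod_le_prod (fun p _ => by linarith [hu0 p])
          fun p _ => by linarith [Real.add_one_le_exp (u p)]
    _ = Real.exp (∑ p ∈ s, u p) := (Real.exp_sum _ _).symm
    _ ≤ _ := Real.exp_le_exp.mpr (hu.sum_le_tsum _ fun p _ => hu0 p)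

/-- A multiplicative function that is small on prime powers is `O(n ^ ε)`. -/
lemma multiplicative_le_rpow {f : ℕ → ℝ} (h0 : ∀ n, 0 ≤ f n) (hf1 : f 1 = 1)
    (hmul : ∀ m n : ℕ, m.Coprime n → f (m * n) = f m * f n) {ε c : ℝ} (hc : 1 ≤ c) {P : ℕ}
    (h1 : ∀ p k : ℕ, p.Prime → f (p ^ k) ≤ c * ((p : ℝ) ^ ε) ^ k)
    (h2 : ∀ p k : ℕ, p.Prime → P ≤ p → f (p ^ k) ≤ ((p : ℝ) ^ ε) ^ k) {n : ℕ} (hn : n ≠ 0) :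
    f n ≤ c ^ P * (n : ℝ) ^ ε := by
  have e1 : (n : ℝ) ^ ε = ∏ p ∈ n.primeFactors, ((p : ℝ) ^ ε) ^ n.factorization p := by
    conv_lhs => rw [← Nat.prod_factorization_pow_eq_self hn]
    rw [Finsupp.prod, Nat.support_factorization, Nat.cast_prod,
      ← Real.finsetProd_rpow _ _ fun p _ => by positivity]
    refine Finset.prod_congr rfl fun p _ => ?_
    rw [Nat.cast_pow, ← Real.rpow_natCast, ← Real.rpow_mul (by positivity), mul_comm,
      Real.rpow_mul (by positivity), Real.rpow_natCast]
  rw [Nat.multiplicative_factorization f hmul hf1 hn, Finsupp.prod, Nat.support_factorization, e1]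
  calc _ ≤ ∏ p ∈ n.primeFactors, ((if p < P then c else 1) *
        ((p : ℝ) ^ ε) ^ n.factorization p) := by
        refine Finset.prod_le_prod (fun p _ => h0 _) fun p hp => ?_
        split_ifs with h
        · exact h1 _ _ (Nat.prime_of_mem_primeFactors hp)
        · rw [one_mul]
          exact h2 _ _ (Nat.prime_of_mem_primeFactors hp) (not_lt.mp h)
    _ = (∏ p ∈ n.primeFactors, (if p < P then c else 1)) *
        ∏ p ∈ n.primeFactors, ((p : ℝ) ^ ε) ^ n.factorization p := Finset.prod_mul_distrib
    _ ≤ _ := by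
        refine mul_le_mul_of_nonneg_right ?_ (Finset.prod_nonneg fun p _ => by positivity)
        rw [← Finset.prod_filter, Finset.prod_const]
        refine pow_le_pow_right₀ hc ?_
        calc _ ≤ (Finset.range P).card := Finset.card_le_card fun p hp => by
              simpa using (Finset.mem_filter.mp hp).2
          _ = P := Finset.card_range P

lemma pow_card_primeFactors_le_rpow {K ε : ℝ} (hK : 1 ≤ K) (hε : 0 < ε) :
    ∃ c : ℝ, 1 ≤ c ∧ ∀ n : ℕ, n ≠ 0 → K ^ n.primeFactors.card ≤ c * (n : ℝ) ^ ε := by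
  set P := ⌈K ^ (1 / ε)⌉₊ with hP
  refine ⟨K ^ P, one_le_pow₀ hK, fun n hn => ?_⟩
  have hK0 : 0 < K := by linarith
  have h1 : ∀ p k : ℕ, p.Prime → K ^ (p ^ k).primeFactors.card ≤ K * ((p : ℝ) ^ ε) ^ k := by
    intro p k hp
    have hp1 : (1 : ℝ) ≤ (p : ℝ) ^ ε := Real.one_le_rpow (by exact_mod_cast hp.one_lt.le) hε.le
    rcases Nat.eq_zero_or_pos k with rfl | hk
    · simpa using hK
    · rw [Nat.primeFactors_prime_pow hk.ne' hp, Finset.card_singleton, pow_one]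
      exact le_mul_of_one_le_right hK0.le (one_le_pow₀ hp1)
  have h2 : ∀ p k : ℕ, p.Prime → P ≤ p → K ^ (p ^ k).primeFactors.card ≤ ((p : ℝ) ^ ε) ^ k := by
    intro p k hp hPp
    rcases Nat.eq_zero_or_pos k with rfl | hk
    · simp
    · rw [Nat.primeFactors_prime_pow hk.ne' hp, Finset.card_singleton, pow_one]
      have hp1 : (1 : ℝ) ≤ (p : ℝ) ^ ε := Real.one_le_rpow (by exact_mod_cast hp.one_lt.le) hε.le
      have h3 : K ≤ (p : ℝ) ^ ε := by
        have h4 : K ^ (1 / ε) ≤ p := (Nat.le_ceil _).trans (by exact_mod_cast hPp)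
        calc K = (K ^ (1 / ε)) ^ ε := by
              rw [← Real.rpow_mul hK0.le, one_div_mul_cancel hε.ne', Real.rpow_one]
          _ ≤ _ := Real.rpow_le_rpow (by positivity) h4 hε.le
      exact h3.trans (le_self_pow₀ hp1 hk.ne')
  refine multiplicative_le_rpow (f := fun n => K ^ n.primeFactors.card) (fun n => by positivity)
    (by simp) ?_ hK h1 h2 hn
  intro m n hmn
  rw [hmn.primeFactors_mul, Finset.card_union_of_disjoint hmn.disjoint_primeFactors, pow_add]

lemma card_divisors_le_rpow {ε : ℝ} (hε : 0 < ε) :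
    ∃ c : ℝ, 1 ≤ c ∧ ∀ n : ℕ, n ≠ 0 → (n.divisors.card : ℝ) ≤ c * (n : ℝ) ^ ε := by
  set P := ⌈(2 : ℝ) ^ (1 / ε)⌉₊ with hP
  have hl : 0 < ε * Real.log 2 := mul_pos hε (Real.log_pos one_lt_two)
  set c := max 1 (1 / (ε * Real.log 2)) with hc
  have hc1 : 1 ≤ c := le_max_left _ _
  refine ⟨c ^ P, one_le_pow₀ hc1, fun n hn => ?_⟩
  have h1 : ∀ p k : ℕ, p.Prime → ((p ^ k).divisors.card : ℝ) ≤ c * ((p : ℝ) ^ ε) ^ k := by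
    intro p k hp
    rw [Nat.divisors_prime_pow hp, Finset.card_map, Finset.card_range]
    have h3 : 1 + k * (ε * Real.log 2) ≤ ((p : ℝ) ^ ε) ^ k := by
      calc 1 + k * (ε * Real.log 2) ≤ Real.exp (k * (ε * Real.log 2)) := by
            linarith [Real.add_one_le_exp (k * (ε * Real.log 2))]
        _ = ((2 : ℝ) ^ ε) ^ k := by
            rw [Real.exp_nat_mul, Real.rpow_def_of_pos two_pos, mul_comm ε]
        _ ≤ _ := by
            gcongr
            exact_mod_cast hp.two_le
    have h4 : 1 ≤ c * (ε * Real.log 2) := by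
      rw [← div_le_iff₀ hl]; exact le_max_right _ _
    push_cast
    calc (k : ℝ) + 1 ≤ c * (1 + k * (ε * Real.log 2)) := by
          have : (k : ℝ) * 1 ≤ k * (c * (ε * Real.log 2)) := by gcongr
          linarith
      _ ≤ _ := by gcongr
  have h2 : ∀ p k : ℕ, p.Prime → P ≤ p → ((p ^ k).divisors.card : ℝ) ≤ ((p : ℝ) ^ ε) ^ k := by
    intro p k hp hPp
    rw [Nat.divisors_prime_pow hp, Finset.card_map, Finset.card_range]
    have h3 : 2 ≤ (p : ℝ) ^ ε := by
      have h4 : (2 : ℝ) ^ (1 / ε) ≤ p := (Nat.le_ceil _).trans (by exact_mod_cast hPp)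
      calc (2 : ℝ) = ((2 : ℝ) ^ (1 / ε)) ^ ε := by
            rw [← Real.rpow_mul two_pos.le, one_div_mul_cancel hε.ne', Real.rpow_one]
        _ ≤ _ := Real.rpow_le_rpow (by positivity) h4 hε.le
    calc ((k + 1 : ℕ) : ℝ) ≤ (2 : ℝ) ^ k := by exact_mod_cast Nat.lt_two_pow_self
      _ ≤ _ := by gcongr
  refine multiplicative_le_rpow (f := fun n => (n.divisors.card : ℝ)) (fun n => by positivity)
    (by simp) ?_ hc1 h1 h2 hn
  intro m n hmn
  rw [hmn.card_divisors_mul, Nat.cast_mul]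

end Multiplicative

section LargeSieve

/-- The additive character `x ↦ e(x)` on the reals. -/
noncomputable def realE (x : ℝ) : ℂ := Complex.exp (2 * Real.pi * Complex.I * x)

lemma norm_realE (x : ℝ) : ‖realE x‖ = 1 := by
  rw [realE, show 2 * (Real.pi : ℂ) * Complex.I * x = ((2 * Real.pi * x : ℝ) : ℂ) * Complex.I by
    push_cast; ring]
  exact Complex.norm_exp_ofReal_mul_I _

lemma realE_add (x y : ℝ) : realE (x + y) = realE x * realE y := by
  rw [realE, realE, realE, ← Complex.exp_add]
  congr 1
  push_cast
  ring

lemma realE_nat_mul (n : ℕ) (x : ℝ) : realE (x * n) = realE x ^ n := by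
  rw [realE, realE, ← Complex.exp_nat_mul]
  congr 1
  push_cast
  ring

lemma realE_conj (x : ℝ) : (starRingEnd ℂ) (realE x) = realE (-x) := by
  rw [realE, realE, ← Complex.exp_conj]
  congr 1
  rw [map_mul, map_mul, map_mul, Complex.conj_I, Complex.conj_ofReal, Complex.conj_ofReal,
    Complex.conj_ofNat]
  push_cast
  ring

lemma realE_intCast (m : ℤ) : realE m = 1 := by
  rw [realE, Complex.exp_eq_one_iff]
  exact ⟨m, by push_cast; ring⟩

lemma four_mul_abs_le_norm_realE_sub_one {y : ℝ} (hy : |y| ≤ 1 / 2) :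
    4 * |y| ≤ ‖realE y - 1‖ := by
  have h1 : realE y - 1 = realE (y / 2) * (realE (y / 2) - realE (-(y / 2))) := by
    rw [mul_sub, ← realE_add, ← realE_add, add_halves, add_neg_cancel]
    congr 1
    rw [realE]; simp
  have h2 : realE (y / 2) - realE (-(y / 2)) = 2 * Complex.I * Complex.sin ((Real.pi * y : ℝ)) := by
    rw [Complex.sin, realE, realE]
    have e1 : 2 * (Real.pi : ℂ) * Complex.I * ((y / 2 : ℝ) : ℂ) =
        ((Real.pi * y : ℝ) : ℂ) * Complex.I := by push_cast; ring
    have e2 : 2 * (Real.pi : ℂ) * Complex.I * ((-(y / 2) : ℝ) : ℂ) =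
        -((Real.pi * y : ℝ) : ℂ) * Complex.I := by push_cast; ring
    rw [e1, e2]
    linear_combination (Complex.exp (((Real.pi * y : ℝ) : ℂ) * Complex.I) -
      Complex.exp (-((Real.pi * y : ℝ) : ℂ) * Complex.I)) * Complex.I_sq
  rw [h1, norm_mul, norm_realE, one_mul, h2, ← Complex.ofReal_sin, norm_mul, norm_mul,
    Complex.norm_I, Complex.norm_real, Real.norm_eq_abs]
  simp only [Complex.norm_ofNat, mul_one]
  have h3 : |Real.sin (Real.pi * y)| = Real.sin (Real.pi * |y|) := by
    rw [← abs_of_nonneg (Real.sin_nonneg_of_nonneg_of_le_pi (x := Real.pi * |y|)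
      (by positivity) (by nlinarith [Real.pi_pos]))]
    rcases abs_cases y with ⟨h, _⟩ | ⟨h, _⟩ <;> rw [h]
    rw [mul_neg, Real.sin_neg, abs_neg]
  have h4 := Real.mul_le_sin (x := Real.pi * |y|) (by positivity) (by nlinarith [Real.pi_pos])
  rw [h3]
  have h5 : 2 / Real.pi * (Real.pi * |y|) = 2 * |y| := by
    field_simp
  linarith

lemma norm_sum_realE_le (β : ℝ) (N : ℕ) (h : β - round β ≠ 0) :
    ‖∑ n ∈ Finset.Icc 1 N, realE (β * n)‖ ≤ 1 / (2 * |β - round β|) := by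
  set y := β - round β with hy
  have hy1 : |y| ≤ 1 / 2 := abs_sub_round β
  have hy0 : 0 < |y| := abs_pos.mpr h
  have h1 : realE β = realE y := by
    rw [show β = y + (round β : ℤ) by rw [hy]; ring, realE_add, realE_intCast, mul_one]
  have h2 := four_mul_abs_le_norm_realE_sub_one hy1
  have h3 : realE y ≠ 1 := by
    intro h3
    rw [h3, sub_self, norm_zero] at h2
    linarith
  have h4 : ∑ n ∈ Finset.Icc 1 N, realE (β * n) =
      realE y * ((realE y ^ N - 1) / (realE y - 1)) := by
    rw [← geom_sum_eq h3, Finset.mul_sum, ← Finset.Ico_add_one_right_eq_Icc,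
      Finset.sum_Ico_eq_sum_range]
    refine Finset.sum_congr (by simp) fun n _ => ?_
    rw [realE_nat_mul, h1, add_comm 1 n, pow_succ, mul_comm]
  rw [h4, norm_mul, norm_realE, one_mul, norm_div]
  have h5 : ‖realE y ^ N - 1‖ ≤ 2 := by
    refine (norm_sub_le _ _).trans ?_
    rw [norm_pow, norm_realE, one_pow, norm_one]
    norm_num
  calc _ ≤ 2 / (4 * |y|) := div_le_div₀ (by norm_num) h5 (by positivity) h2
    _ = _ := by field_simp; norm_num

/-- Schur's test for a Hermitian-type kernel. -/
lemma sum_sum_mul_le_of_row_sum_le {ι : Type*} (s : Finset ι) (a : ι → ℝ)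
    (k : ι → ι → ℝ) (hk : ∀ i j, k i j = k j i) (hk0 : ∀ i j, 0 ≤ k i j) {B : ℝ}
    (hB : ∀ i ∈ s, ∑ j ∈ s, k i j ≤ B) :
    ∑ i ∈ s, ∑ j ∈ s, a i * a j * k i j ≤ B * ∑ i ∈ s, a i ^ 2 := by
  have h1 : ∑ i ∈ s, ∑ j ∈ s, a i * a j * k i j ≤
      ∑ i ∈ s, ∑ j ∈ s, (a i ^ 2 / 2 * k i j + a j ^ 2 / 2 * k i j) := by
    refine Finset.sum_le_sum fun i _ => Finset.sum_le_sum fun j _ => ?_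
    have := mul_nonneg (sq_nonneg (a i - a j)) (hk0 i j)
    nlinarith
  have h2 : ∑ i ∈ s, ∑ j ∈ s, a j ^ 2 / 2 * k i j = ∑ i ∈ s, ∑ j ∈ s, a i ^ 2 / 2 * k i j := by
    rw [Finset.sum_comm]
    simp_rw [hk]
  refine h1.trans ?_
  simp_rw [Finset.sum_add_distrib]
  rw [h2, ← two_mul, Finset.mul_sum, Finset.mul_sum]
  refine Finset.sum_le_sum fun i hi => ?_
  rw [← Finset.mul_sum]
  have := mul_le_mul_of_nonneg_left (hB i hi) (sq_nonneg (a i))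
  linarith

lemma sum_kernel_le {ι : Type*} [DecidableEq ι] (s : Finset ι) (α : ι → ℝ) {M : ℕ} (hM : 1 ≤ M)
    (hα : ∀ i ∈ s, ∀ j ∈ s, i ≠ j → ∀ m : ℤ, 1 ≤ M * |α i - α j - m|) (N : ℕ) {i : ι} (hi : i ∈ s) :
    ∑ j ∈ s, ‖∑ n ∈ Finset.Icc 1 N, realE ((α i - α j) * n)‖ ≤
      N + 2 * M * (1 + Real.log M) := by
  have hM0 : (0 : ℝ) < M := by exact_mod_cast hM
  rw [← Finset.add_sum_erase s _ hi]
  have hdiag : ‖∑ n ∈ Finset.Icc 1 N, realE ((α i - α i) * n)‖ ≤ N := by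
    refine (norm_sum_le _ _).trans ?_
    simp [norm_realE]
  refine add_le_add hdiag ?_
  set y : ι → ℝ := fun j => (α i - α j) - round (α i - α j) with hy
  set f : ι → ℤ := fun j => ⌊M * y j⌋ with hf
  have hy1 : ∀ j ∈ s.erase i, 1 ≤ M * |y j| := by
    intro j hj
    exact hα i hi j (Finset.mem_of_mem_erase hj) (Finset.ne_of_mem_erase hj).symm _
  have hinj : Set.InjOn f (s.erase i : Finset ι) := by
    intro j hj k hk hjk
    by_contra hne
    have h1 := hα k (Finset.mem_of_mem_erase hk) j (Finset.mem_of_mem_erase hj) (Ne.symm hne)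
      (round (α i - α j) - round (α i - α k))
    have h2 : α k - α j - ((round (α i - α j) - round (α i - α k) : ℤ) : ℝ) = y j - y k := by
      rw [hy]; push_cast; ring
    rw [h2] at h1
    have h3 := Int.abs_sub_lt_one_of_floor_eq_floor hjk
    rw [← mul_sub, abs_mul, abs_of_pos hM0] at h3
    linarith
  have hbound : ∀ j ∈ s.erase i, ‖∑ n ∈ Finset.Icc 1 N, realE ((α i - α j) * n)‖ ≤
      M / ((f j).natAbs : ℝ) ∧ f j ≠ 0 ∧ (f j).natAbs ≤ M := by
    intro j hj
    have h1 := hy1 j hj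
    have hyp : 0 < |y j| := by
      by_contra h
      have : |y j| = 0 := le_antisymm (not_lt.mp h) (abs_nonneg _)
      rw [this] at h1; simp at h1; linarith
    have hy2 : |y j| ≤ 1 / 2 := abs_sub_round _
    have hfl := Int.floor_le (M * y j)
    have hlt := Int.lt_floor_add_one (M * y j)
    have key : f j ≠ 0 ∧ ((f j).natAbs : ℝ) ≤ 2 * (M * |y j|) ∧ ((f j).natAbs : ℝ) < M + 1 := by
      rcases abs_cases (y j) with ⟨h, h0⟩ | ⟨h, h0⟩
      · rw [h] at h1 ⊢
        have hf1 : 1 ≤ f j := Int.le_floor.mpr (by exact_mod_cast h1)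
        have e : ((f j).natAbs : ℝ) = (f j : ℝ) := by
          rw [Nat.cast_natAbs, abs_of_nonneg (by omega)]
        refine ⟨by omega, ?_, ?_⟩ <;> rw [e]
        · linarith
        · rw [h] at hy2
          nlinarith
      · rw [h] at h1 ⊢
        have hf1 : f j ≤ -1 := by
          have : f j < 0 := Int.floor_lt.mpr (by push_cast; linarith)
          omega
        have e : ((f j).natAbs : ℝ) = -(f j : ℝ) := by
          rw [Nat.cast_natAbs, abs_of_neg (by omega)]; push_cast; rfl
        refine ⟨by omega, ?_, ?_⟩ <;> rw [e]
        · linarith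
        · rw [h] at hy2
          nlinarith
    refine ⟨?_, key.1, ?_⟩
    · refine (norm_sum_realE_le _ N (abs_pos.mp hyp)).trans ?_
      have hfpos : (0 : ℝ) < (f j).natAbs := by
        exact_mod_cast Int.natAbs_pos.mpr key.1
      rw [div_le_div_iff₀ (by positivity) hfpos]
      linarith [key.2.1]
    · have : (f j).natAbs < M + 1 := by exact_mod_cast key.2.2
      omega
  set T : Finset ℤ := (Finset.Icc (-(M : ℤ)) M).erase 0 with hT
  calc _ ≤ ∑ j ∈ s.erase i, M / ((f j).natAbs : ℝ) := Finset.sum_le_sum fun j hj => (hbound j hj).1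
    _ = ∑ m ∈ (s.erase i).image f, (M : ℝ) / (m.natAbs : ℝ) :=
        (Finset.sum_image (f := fun m : ℤ => (M : ℝ) / (m.natAbs : ℝ)) hinj).symm
    _ ≤ ∑ m ∈ T, (M : ℝ) / (m.natAbs : ℝ) := by
        refine Finset.sum_le_sum_of_subset_of_nonneg ?_ fun _ _ _ => by positivity
        intro m hm
        obtain ⟨j, hj, rfl⟩ := Finset.mem_image.mp hm
        rw [hT, Finset.mem_erase, Finset.mem_Icc]
        have := (hbound j hj).2
        omega
    _ ≤ ∑ m ∈ Finset.Icc 1 M, ((M : ℝ) / m + M / m) := by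
        have hsub : T ⊆ (Finset.Icc 1 M).biUnion fun m : ℕ => {(m : ℤ), -(m : ℤ)} := by
          intro m hm
          rw [hT, Finset.mem_erase, Finset.mem_Icc] at hm
          rw [Finset.mem_biUnion]
          refine ⟨m.natAbs, by rw [Finset.mem_Icc]; omega, ?_⟩
          simp only [Finset.mem_insert, Finset.mem_singleton]
          omega
        refine (Finset.sum_le_sum_of_subset_of_nonneg hsub fun _ _ _ => by positivity).trans ?_
        rw [Finset.sum_biUnion]
        swap
        · intro a ha b hb hab
          rw [Function.onFun, Finset.disjoint_left]
          intro x hx hx'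
          simp only [Finset.mem_insert, Finset.mem_singleton] at hx hx'
          omega
        refine Finset.sum_le_sum fun m hm => ?_
        rw [Finset.mem_Icc] at hm
        rw [Finset.sum_pair (by omega)]
        simp
    _ = 2 * M * (harmonic M : ℝ) := by
        rw [harmonic_eq_sum_Icc]
        push_cast
        rw [Finset.mul_sum]
        exact Finset.sum_congr rfl fun m _ => by rw [div_eq_mul_inv]; ring
    _ ≤ _ := by
        have := harmonic_le_one_add_log M
        gcongr

/-- The large sieve inequality (with a logarithmic loss). -/
lemma large_sieve {ι : Type*} [DecidableEq ι] (s : Finset ι) (α : ι → ℝ) (c : ι → ℂ) {M : ℕ}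
    (hM : 1 ≤ M)
    (hα : ∀ i ∈ s, ∀ j ∈ s, i ≠ j → ∀ m : ℤ, 1 ≤ M * |α i - α j - m|) (N : ℕ) :
    ∑ n ∈ Finset.Icc 1 N, ‖∑ i ∈ s, c i * realE (α i * n)‖ ^ 2 ≤
      (N + 2 * M * (1 + Real.log M)) * ∑ i ∈ s, ‖c i‖ ^ 2 := by
  have h1 : ((∑ n ∈ Finset.Icc 1 N, ‖∑ i ∈ s, c i * realE (α i * n)‖ ^ 2 : ℝ) : ℂ) =
      ∑ i ∈ s, ∑ j ∈ s, c i * (starRingEnd ℂ) (c j) *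
        ∑ n ∈ Finset.Icc 1 N, realE ((α i - α j) * n) := by
    push_cast
    simp_rw [← Complex.mul_conj', map_sum, map_mul, realE_conj, Finset.sum_mul_sum]
    rw [Finset.sum_comm]
    refine Finset.sum_congr rfl fun i _ => ?_
    rw [Finset.sum_comm]
    refine Finset.sum_congr rfl fun j _ => ?_
    rw [Finset.mul_sum]
    refine Finset.sum_congr rfl fun n _ => ?_
    rw [sub_mul, sub_eq_add_neg, realE_add]
    ring
  have h2 : ∑ n ∈ Finset.Icc 1 N, ‖∑ i ∈ s, c i * realE (α i * n)‖ ^ 2 ≤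
      ∑ i ∈ s, ∑ j ∈ s, ‖c i‖ * ‖c j‖ *
        ‖∑ n ∈ Finset.Icc 1 N, realE ((α i - α j) * n)‖ := by
    rw [← Complex.norm_of_nonneg (r := ∑ n ∈ Finset.Icc 1 N, ‖∑ i ∈ s, c i * realE (α i * n)‖ ^ 2)
      (Finset.sum_nonneg fun _ _ => by positivity), h1]
    refine (norm_sum_le _ _).trans (Finset.sum_le_sum fun i _ => (norm_sum_le _ _).trans
      (Finset.sum_le_sum fun j _ => ?_))
    rw [norm_mul, norm_mul, RCLike.norm_conj]
  refine h2.trans (sum_sum_mul_le_of_row_sum_le s (fun i => ‖c i‖)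
    (fun i j => ‖∑ n ∈ Finset.Icc 1 N, realE ((α i - α j) * n)‖) ?_ (fun _ _ => norm_nonneg _)
    fun i hi => sum_kernel_le s α hM hα N hi)
  intro i j
  rw [← RCLike.norm_conj, map_sum]
  congr 1
  refine Finset.sum_congr rfl fun n _ => ?_
  rw [realE_conj]
  congr 1
  ring

end LargeSieve

section Fourier

/-- The residues coprime to `q`. -/
def coprimeRes (q : ℕ) : Finset ℕ := (Finset.range q).filter fun r => Nat.Coprime r q

/-- The Fourier coefficients of the singular series term (`0` when `q = 0`). -/
noncomputable def fourierCoeff (A B C D : ℤ) (q r : ℕ) : ℂ :=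
  if h : q = 0 then 0 else
    haveI : NeZero q := ⟨h⟩
    (Fintype.card (SpecialLinearGroup (Fin 2) (ZMod q)) : ℂ)⁻¹ *
      ∑ γ : SpecialLinearGroup (Fin 2) (ZMod q), ZMod.stdAddChar ((r : ZMod q) * Lform A B C D γ)

lemma cterm_eq_sum_fourierCoeff (A B C D : ℤ) (q : ℕ) [NeZero q] (x : ZMod q) :
    cterm A B C D q x =
      ∑ r ∈ coprimeRes q, fourierCoeff A B C D q r * ZMod.stdAddChar (-((r : ZMod q) * x)) := by
  have h : ∀ y : ZMod q, ramanujanSum q y =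
      ∑ r ∈ coprimeRes q, ZMod.stdAddChar ((r : ZMod q) * y) := by
    intro y
    unfold ramanujanSum coprimeRes
    refine Finset.sum_congr rfl fun r _ => ?_
    rw [← stdAddChar_natCast]
    simp
  simp only [cterm, fourierCoeff, dif_neg (NeZero.ne q), h]
  rw [Finset.sum_comm, Finset.mul_sum]
  refine Finset.sum_congr rfl fun r _ => ?_
  rw [mul_assoc, Finset.sum_mul]
  congr 1
  refine Finset.sum_congr rfl fun γ _ => ?_
  rw [← AddChar.map_add_eq_mul]
  congr 1
  ring

lemma meanSq_eq_sum_fourierCoeff (A B C D : ℤ) (q : ℕ) :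
    meanSq A B C D q = ∑ r ∈ coprimeRes q, ‖fourierCoeff A B C D q r‖ ^ 2 := by
  rcases Nat.eq_zero_or_pos q with rfl | hq
  · simp [meanSq, coprimeRes]
  have : NeZero q := ⟨hq.ne'⟩
  have hq0 : (q : ℂ) ≠ 0 := by exact_mod_cast hq.ne'
  rw [meanSq_eq]
  apply Complex.ofReal_injective
  push_cast
  simp_rw [cterm_eq_sum_fourierCoeff, ← Complex.mul_conj', map_sum, map_mul, Finset.sum_mul_sum]
  rw [Finset.sum_comm, Finset.mul_sum]
  refine Finset.sum_congr rfl fun r hr => ?_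
  rw [Finset.sum_comm]
  have h1 : ∀ r' ∈ coprimeRes q, ∑ x : ZMod q,
      fourierCoeff A B C D q r * ZMod.stdAddChar (-((r : ZMod q) * x)) *
        ((starRingEnd ℂ) (fourierCoeff A B C D q r') *
          (starRingEnd ℂ) (ZMod.stdAddChar (-((r' : ZMod q) * x)))) =
      if r = r' then q * (fourierCoeff A B C D q r *
        (starRingEnd ℂ) (fourierCoeff A B C D q r')) else 0 := by
    intro r' hr'
    have h2 : ∀ x : ZMod q, fourierCoeff A B C D q r * ZMod.stdAddChar (-((r : ZMod q) * x)) *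
        ((starRingEnd ℂ) (fourierCoeff A B C D q r') *
          (starRingEnd ℂ) (ZMod.stdAddChar (-((r' : ZMod q) * x)))) =
        (fourierCoeff A B C D q r * (starRingEnd ℂ) (fourierCoeff A B C D q r')) *
          ZMod.stdAddChar (((r' : ZMod q) - (r : ZMod q)) * x) := by
      intro x
      rw [← AddChar.map_neg_eq_conj, show ((r' : ZMod q) - (r : ZMod q)) * x =
        -((r : ZMod q) * x) + -(-((r' : ZMod q) * x)) by ring, AddChar.map_add_eq_mul]
      ring
    simp_rw [h2]
    rw [← Finset.mul_sum, sum_stdAddChar_mul]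
    have h3 : ((r' : ZMod q) - (r : ZMod q) = 0) ↔ r = r' := by
      rw [sub_eq_zero]
      constructor
      · intro h
        rw [ZMod.natCast_eq_natCast_iff'] at h
        rw [coprimeRes, Finset.mem_filter, Finset.mem_range] at hr hr'
        rw [Nat.mod_eq_of_lt hr.1, Nat.mod_eq_of_lt hr'.1] at h
        exact h.symm
      · rintro rfl; rfl
    simp only [h3]
    split_ifs
    · ring
    · ring
  rw [Finset.sum_congr rfl h1, Finset.sum_ite_eq, if_pos hr, ← mul_assoc, inv_mul_cancel₀ hq0,
    one_mul]

lemma singSeriesTerm_eq_sum_realE (A B C D : ℤ) (q : ℕ) (hq : q ≠ 0) (n : ℕ) :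
    (singSeriesTerm A B C D q n : ℂ) =
      ∑ r ∈ coprimeRes q, fourierCoeff A B C D q r * realE (-(r / q : ℝ) * n) := by
  have : NeZero q := ⟨hq⟩
  rw [singSeriesTerm_eq_cterm, cterm_eq_sum_fourierCoeff]
  refine Finset.sum_congr rfl fun r _ => ?_
  congr 1
  have h := ZMod.stdAddChar_coe (N := q) (-((r : ℤ) * n))
  push_cast at h ⊢
  rw [h, realE]
  congr 1
  push_cast
  ring

lemma fraction_spacing {q q' r r' Y : ℕ} (hq : 0 < q) (hq' : 0 < q') (hqY : q ≤ Y) (hqY' : q' ≤ Y)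
    (hr : r ∈ coprimeRes q) (hr' : r' ∈ coprimeRes q') (hne : (q, r) ≠ (q', r')) (m : ℤ) :
    1 ≤ ((Y ^ 2 : ℕ) : ℝ) * |-(r / q : ℝ) - -(r' / q' : ℝ) - m| := by
  rw [coprimeRes, Finset.mem_filter, Finset.mem_range] at hr hr'
  have hq0 : (0 : ℝ) < q := by exact_mod_cast hq
  have hq0' : (0 : ℝ) < q' := by exact_mod_cast hq'
  set z : ℤ := r' * q - r * q' - m * (q * q') with hz
  have hz0 : z ≠ 0 := by
    intro h
    have h1 : (r' : ℤ) * q = q' * (r + m * q) := by rw [hz] at h; linarith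
    have h2 : (q' : ℤ) ∣ q := by
      have : IsCoprime (q' : ℤ) (r' : ℤ) := (Nat.isCoprime_iff_coprime.mpr hr'.2).symm
      exact this.dvd_of_dvd_mul_left (Dvd.intro _ h1.symm)
    have h1' : (r : ℤ) * q' = q * (r' - m * q') := by linarith
    have h3 : (q : ℤ) ∣ q' := by
      have : IsCoprime (q : ℤ) (r : ℤ) := (Nat.isCoprime_iff_coprime.mpr hr.2).symm
      exact this.dvd_of_dvd_mul_left (Dvd.intro _ h1'.symm)
    have hqq : q = q' := Nat.dvd_antisymm (by exact_mod_cast h3) (by exact_mod_cast h2)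
    subst hqq
    have hqz : (q : ℤ) ≠ 0 := by exact_mod_cast hq.ne'
    have h4 : (r' : ℤ) = r + m * q := by
      have : (q : ℤ) * r' = q * (r + m * q) := by linarith
      exact mul_left_cancel₀ hqz this
    have h5 : r' = r := by
      have h6 : (r' : ℤ) % q = r % q := by rw [h4]; simp
      have h7 : r' % q = r % q := by exact_mod_cast h6
      rwa [Nat.mod_eq_of_lt hr.1, Nat.mod_eq_of_lt hr'.1] at h7
    exact hne (by rw [h5])
  have e : -(r / q : ℝ) - -(r' / q' : ℝ) - m = (z : ℝ) / (q * q') := by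
    rw [hz]; push_cast; field_simp; ring
  rw [e, abs_div, abs_of_pos (mul_pos hq0 hq0'), ← mul_div_assoc, le_div_iff₀ (mul_pos hq0 hq0'),
    one_mul]
  have h1 : (1 : ℝ) ≤ |(z : ℝ)| := by
    rw [← Int.cast_abs]; exact_mod_cast Int.one_le_abs hz0
  have h2 : (q : ℝ) * q' ≤ Y * Y := by
    have a1 : (q : ℝ) ≤ Y := by exact_mod_cast hqY
    have a2 : (q' : ℝ) ≤ Y := by exact_mod_cast hqY'
    gcongr
  push_cast
  nlinarith

/-- The mean square over `n ≤ N` of a block of the singular series. -/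
lemma sum_sq_block_le (A B C D : ℤ) {X Y : ℕ} (hY : 1 ≤ Y) (N : ℕ) :
    ∑ n ∈ Finset.Icc 1 N, (∑ q ∈ Finset.Ioc X Y, singSeriesTerm A B C D q (n : ℤ)) ^ 2 ≤
      (N + 2 * (Y : ℝ) ^ 2 * (1 + 2 * Real.log Y)) * ∑ q ∈ Finset.Ioc X Y, meanSq A B C D q := by
  have h1 := large_sieve ((Finset.Ioc X Y).sigma fun q => coprimeRes q)
    (fun i => -(i.2 / i.1 : ℝ)) (fun i => fourierCoeff A B C D i.1 i.2) (M := Y ^ 2)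
    (Nat.one_le_pow _ _ hY) ?_ N
  · rw [Finset.sum_sigma] at h1
    simp_rw [← meanSq_eq_sum_fourierCoeff] at h1
    push_cast at h1
    rw [Real.log_pow] at h1
    push_cast at h1
    refine le_trans (le_of_eq ?_) h1
    refine Finset.sum_congr rfl fun n _ => ?_
    rw [Finset.sum_sigma]
    have h2 : ((∑ q ∈ Finset.Ioc X Y, singSeriesTerm A B C D q (n : ℤ) : ℝ) : ℂ) =
        ∑ q ∈ Finset.Ioc X Y, ∑ r ∈ coprimeRes q,
          fourierCoeff A B C D q r * realE (-(r / q : ℝ) * n) := by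
      push_cast
      refine Finset.sum_congr rfl fun q hq => ?_
      rw [Finset.mem_Ioc] at hq
      exact singSeriesTerm_eq_sum_realE A B C D q (by omega) n
    rw [← sq_abs, ← Real.norm_eq_abs, ← Complex.norm_real, h2]
  · rintro ⟨q, r⟩ hi ⟨q', r'⟩ hj hne m
    rw [Finset.mem_sigma, Finset.mem_Ioc] at hi hj
    have h1 : X < q := hi.1.1
    have h2 : X < q' := hj.1.1
    exact fraction_spacing (by omega) (by omega) hi.1.2 hj.1.2 hi.2 hj.2
      (by rintro h; apply hne; simp only [Prod.mk.injEq] at h; rw [h.1, h.2]) m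

end Fourier

section MeanSqTail

lemma summable_meanSq_mul_rpow {A B C D : ℤ}
    (hgcd : Int.gcd A (Int.gcd B (Int.gcd C D)) = 1) (hΔ0 : A * D - B * C ≠ 0)
    {δ : ℝ} (hδ : 0 < δ) :
    Summable fun q : ℕ => meanSq A B C D q * (q : ℝ) ^ (1 - δ) := by
  set f : ℕ → ℝ := fun q => meanSq A B C D q * (q : ℝ) ^ (1 - δ) with hf
  set ρ : ℝ := (2 : ℝ) ^ (-δ) with hρ
  have hρ0 : 0 < ρ := by positivity
  have hρ1 : ρ < 1 := Real.rpow_lt_one_of_one_lt_of_neg one_lt_two (by linarith)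
  set c := localC A B C D ^ 2 with hc
  set u : ℕ → ℝ := fun p => c * (1 - ρ)⁻¹ * (p : ℝ) ^ (-1 - δ) with hu
  have hu0 : ∀ n, 0 ≤ u n := fun n => by
    have : 0 < 1 - ρ := by linarith
    positivity
  have hterm : ∀ {p : ℕ}, p.Prime → ∀ K : ℕ,
      f (p ^ (K + 1)) ≤ c * (p : ℝ) ^ (-1 - δ) * ρ ^ K := by
    intro p hp K
    have : Fact p.Prime := ⟨hp⟩
    have hp0 : (0 : ℝ) < p := by exact_mod_cast hp.pos
    have hp1 : (1 : ℝ) ≤ p := by exact_mod_cast hp.one_lt.le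
    have hp2 : (2 : ℝ) ≤ p := by exact_mod_cast hp.two_le
    have h1 := meanSq_prime_pow_le (q := p ^ (K + 1)) rfl hgcd hΔ0
    have hq0 : (0 : ℝ) < ((p ^ (K + 1) : ℕ) : ℝ) := by
      exact_mod_cast pow_pos hp.pos _
    have h2 : (p : ℝ) ≤ (p : ℝ) ^ ((K + 2) / 2) := le_self_pow₀ hp1 (by omega)
    have h3 : ((p ^ (K + 1) : ℕ) : ℝ) ^ (-δ) ≤ (p : ℝ) ^ (-δ) * ρ ^ K := by
      rw [Nat.cast_pow, ← Real.rpow_natCast, ← Real.rpow_mul hp0.le, mul_comm,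
        Real.rpow_mul hp0.le, Real.rpow_natCast, pow_succ, mul_comm]
      refine mul_le_mul_of_nonneg_left ?_ (by positivity)
      refine pow_le_pow_left₀ (by positivity) ?_ _
      exact Real.rpow_le_rpow_of_nonpos two_pos hp2 (by linarith)
    calc f (p ^ (K + 1)) ≤ c / (((p ^ (K + 1) : ℕ) : ℝ) * (p : ℝ) ^ ((K + 2) / 2)) *
          ((p ^ (K + 1) : ℕ) : ℝ) ^ (1 - δ) :=
          mul_le_mul_of_nonneg_right h1 (by positivity)
      _ = c * ((p : ℝ) ^ ((K + 2) / 2))⁻¹ * ((p ^ (K + 1) : ℕ) : ℝ) ^ (-δ) := by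
          rw [sub_eq_add_neg, Real.rpow_add hq0, Real.rpow_one]
          field_simp
      _ ≤ c * (p : ℝ)⁻¹ * ((p : ℝ) ^ (-δ) * ρ ^ K) := by gcongr
      _ = _ := by
          rw [sub_eq_add_neg, Real.rpow_add hp0, Real.rpow_neg_one]; ring
  have hf0' : ∀ n, 0 ≤ f n := fun n => mul_nonneg (meanSq_nonneg _ _ _ _ _) (by positivity)
  have hf1 : f 1 = 1 := by simp [hf, meanSq_one]
  have hsum1 : ∀ {p : ℕ}, p.Prime → Summable fun K => f (p ^ (K + 1)) := fun hp =>
    Summable.of_nonneg_of_le (fun _ => hf0' _) (hterm hp)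
      ((summable_geometric_of_lt_one hρ0.le hρ1).mul_left _)
  have hsum : ∀ {p : ℕ}, p.Prime → Summable fun k => f (p ^ k) := fun hp =>
    (summable_nat_add_iff 1).mp (hsum1 hp)
  refine (summable_of_multiplicative (f := f) (u := u) hf0' (by simp [hf, meanSq]) hf1 ?_ hsum ?_
    (fun s _ => prod_one_add_le_exp hu0 ?_ s)).1
  · intro m n hmn
    simp only [hf]
    rw [meanSq_mul A B C D hmn, Nat.cast_mul, Real.mul_rpow (by positivity) (by positivity)]
    ring
  · intro p hp
    rw [(hsum hp).tsum_eq_zero_add, pow_zero, hf1]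
    refine add_le_add le_rfl ?_
    refine ((hsum1 hp).tsum_le_tsum (hterm hp)
      ((summable_geometric_of_lt_one hρ0.le hρ1).mul_left _)).trans (le_of_eq ?_)
    rw [tsum_mul_left, tsum_geometric_of_lt_one hρ0.le hρ1, hu]
    ring
  · exact (Real.summable_nat_rpow.mpr (by linarith)).mul_left _

lemma sum_meanSq_Ioc_le {A B C D : ℤ}
    (hgcd : Int.gcd A (Int.gcd B (Int.gcd C D)) = 1) (hΔ0 : A * D - B * C ≠ 0)
    {δ : ℝ} (hδ : 0 < δ) (hδ1 : δ < 1) :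
    ∃ W : ℝ, 0 < W ∧ ∀ X Y : ℕ, 1 ≤ X →
      ∑ q ∈ Finset.Ioc X Y, meanSq A B C D q ≤ W * (X : ℝ) ^ (-(1 - δ)) := by
  have hs := summable_meanSq_mul_rpow hgcd hΔ0 hδ
  have hnn : ∀ q : ℕ, 0 ≤ meanSq A B C D q * (q : ℝ) ^ (1 - δ) := fun q =>
    mul_nonneg (meanSq_nonneg _ _ _ _ _) (by positivity)
  refine ⟨∑' q : ℕ, meanSq A B C D q * (q : ℝ) ^ (1 - δ) + 1,
    add_pos_of_nonneg_of_pos (tsum_nonneg hnn) one_pos, fun X Y hX => ?_⟩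
  have hX0 : (0 : ℝ) < X := by exact_mod_cast hX
  have h1 : ∀ q ∈ Finset.Ioc X Y, meanSq A B C D q ≤
      meanSq A B C D q * (q : ℝ) ^ (1 - δ) * (X : ℝ) ^ (-(1 - δ)) := by
    intro q hq
    rw [Finset.mem_Ioc] at hq
    rw [mul_assoc]
    refine le_mul_of_one_le_right (meanSq_nonneg _ _ _ _ _) ?_
    rw [Real.rpow_neg hX0.le, ← div_eq_mul_inv, one_le_div (by positivity)]
    exact Real.rpow_le_rpow hX0.le (by exact_mod_cast hq.1.le) (by linarith)
  refine (Finset.sum_le_sum h1).trans ?_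
  rw [← Finset.sum_mul]
  refine mul_le_mul_of_nonneg_right ?_ (by positivity)
  linarith [hs.sum_le_tsum (Finset.Ioc X Y) fun q _ => hnn q]

end MeanSqTail

section MediumRange

lemma one_add_log_le_rpow {ε x : ℝ} (hε : 0 < ε) (hx : 1 ≤ x) :
    1 + 2 * Real.log x ≤ (1 + 2 / ε) * x ^ ε := by
  have h1 := Real.log_le_rpow_div (by linarith : 0 ≤ x) hε
  have h2 : 1 ≤ x ^ ε := Real.one_le_rpow hx hε.le
  calc 1 + 2 * Real.log x ≤ x ^ ε + 2 * (x ^ ε / ε) := by linarith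
    _ = _ := by ring

lemma natLog_two_add_one_le {Q : ℕ} (hQ : 1 ≤ Q) :
    ((Nat.log 2 Q + 1 : ℕ) : ℝ) ≤ 1 + 2 * Real.log Q := by
  have h1 : ((2 ^ Nat.log 2 Q : ℕ) : ℝ) ≤ Q := by
    exact_mod_cast Nat.pow_log_le_self 2 (by omega)
  have h2 := Real.log_le_log (by positivity) h1
  rw [Nat.cast_pow, Real.log_pow] at h2
  have h3 : (1 / 2 : ℝ) ≤ Real.log 2 := by linarith [Real.log_two_gt_d9]
  have h4 : (Nat.log 2 Q : ℝ) * (1 / 2) ≤ Nat.log 2 Q * Real.log 2 := by gcongr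
  push_cast at h2 ⊢
  linarith

lemma sum_Ioc_eq_sum_dyadic (f : ℕ → ℝ) {Q₀ Q₁ : ℕ} (h0 : 1 ≤ Q₀) (h : Q₀ ≤ Q₁) :
    ∑ q ∈ Finset.Ioc Q₀ Q₁, f q = ∑ i ∈ Finset.range (Nat.log 2 Q₁ + 1),
      ∑ q ∈ Finset.Ioc (min (2 ^ i * Q₀) Q₁) (min (2 ^ (i + 1) * Q₀) Q₁), f q := by
  have key : ∀ k : ℕ, ∑ q ∈ Finset.Ioc Q₀ (min (2 ^ k * Q₀) Q₁), f q =
      ∑ i ∈ Finset.range k,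
        ∑ q ∈ Finset.Ioc (min (2 ^ i * Q₀) Q₁) (min (2 ^ (i + 1) * Q₀) Q₁), f q := by
    intro k
    induction k with
    | zero => simp [h]
    | succ k ih =>
      have h1 : Q₀ ≤ 2 ^ k * Q₀ := Nat.le_mul_of_pos_left _ (by positivity)
      have h2 : 2 ^ (k + 1) * Q₀ = 2 * (2 ^ k * Q₀) := by ring
      rw [Finset.sum_range_succ, ← ih, Finset.sum_Ioc_consecutive]
      · exact le_min h1 h
      · exact min_le_min_right _ (by omega)
  rw [← key, min_eq_right]
  have h3 : Q₁ < 2 ^ (Nat.log 2 Q₁ + 1) := Nat.lt_pow_succ_log_self one_lt_two _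
  nlinarith

lemma sum_sq_Ioc_le {A B C D : ℤ}
    (hgcd : Int.gcd A (Int.gcd B (Int.gcd C D)) = 1) (hΔ0 : A * D - B * C ≠ 0)
    {ε : ℝ} (hε : 0 < ε) (hε1 : ε < 1) :
    ∃ K : ℝ, 0 < K ∧ ∀ Q₀ Q₁ N : ℕ, 1 ≤ Q₀ → Q₀ ≤ Q₁ →
      ∑ n ∈ Finset.Icc 1 N, (∑ q ∈ Finset.Ioc Q₀ Q₁, singSeriesTerm A B C D q (n : ℤ)) ^ 2 ≤
        K * (Q₁ : ℝ) ^ ε * (N * (Q₀ : ℝ) ^ (-(1 - ε)) + (Q₁ : ℝ) ^ (1 + ε)) := by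
  obtain ⟨W, hW, hV⟩ := sum_meanSq_Ioc_le hgcd hΔ0 hε hε1
  refine ⟨(1 + 2 / (ε / 3)) ^ 3 * (8 * W), by positivity, fun Q₀ Q₁ N h0 h => ?_⟩
  have hQ1 : (1 : ℝ) ≤ Q₁ := by exact_mod_cast h0.trans h
  have hQ0 : (1 : ℝ) ≤ Q₀ := by exact_mod_cast h0
  set l : ℝ := 1 + 2 * Real.log Q₁ with hl
  have hl1 : 1 ≤ l := by linarith [Real.log_nonneg hQ1]
  set J := Nat.log 2 Q₁ + 1 with hJ
  have hJl : (J : ℝ) ≤ l := natLog_two_add_one_le (h0.trans h)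
  have hblock : ∀ i ∈ Finset.range J, ∑ n ∈ Finset.Icc 1 N,
      (∑ q ∈ Finset.Ioc (min (2 ^ i * Q₀) Q₁) (min (2 ^ (i + 1) * Q₀) Q₁),
        singSeriesTerm A B C D q (n : ℤ)) ^ 2 ≤
      l * (8 * W) * (N * (Q₀ : ℝ) ^ (-(1 - ε)) + (Q₁ : ℝ) ^ (1 + ε)) := by
    intro i _
    have hQi : Q₀ ≤ 2 ^ i * Q₀ := Nat.le_mul_of_pos_left _ (by positivity)
    have h2 : 2 ^ (i + 1) * Q₀ = 2 * (2 ^ i * Q₀) := by ring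
    set X := min (2 ^ i * Q₀) Q₁ with hX
    set Y := min (2 ^ (i + 1) * Q₀) Q₁ with hY
    have hX0 : Q₀ ≤ X := le_min hQi h
    have hY2 : Y ≤ 2 * X := by omega
    have hY1 : Y ≤ Q₁ := min_le_right _ _
    have hX1 : X ≤ Q₁ := min_le_right _ _
    have hYp : 1 ≤ Y := by omega
    have hXr : (1 : ℝ) ≤ X := by exact_mod_cast h0.trans hX0
    have hYr : (1 : ℝ) ≤ Y := by exact_mod_cast hYp
    have hlY : 1 + 2 * Real.log Y ≤ l := by
      have : Real.log Y ≤ Real.log Q₁ :=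
        Real.log_le_log (by linarith) (by exact_mod_cast hY1)
      linarith
    have hlY0 : 0 ≤ 1 + 2 * Real.log Y := by linarith [Real.log_nonneg hYr]
    have hY2r : (Y : ℝ) ≤ 2 * X := by exact_mod_cast hY2
    have e1 : (X : ℝ) ^ (-(1 - ε)) ≤ (Q₀ : ℝ) ^ (-(1 - ε)) :=
      Real.rpow_le_rpow_of_nonpos (by linarith) (by exact_mod_cast hX0) (by linarith)
    have e2 : (X : ℝ) ^ 2 * (X : ℝ) ^ (-(1 - ε)) ≤ (Q₁ : ℝ) ^ (1 + ε) := by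
      rw [← Real.rpow_natCast (X : ℝ) 2, ← Real.rpow_add (by linarith)]
      push_cast
      rw [show (2 : ℝ) + -(1 - ε) = 1 + ε by ring]
      exact Real.rpow_le_rpow (by linarith) (by exact_mod_cast hX1) (by linarith)
    have hXp : 0 ≤ (X : ℝ) ^ (-(1 - ε)) := by positivity
    calc _ ≤ (N + 2 * (Y : ℝ) ^ 2 * (1 + 2 * Real.log Y)) *
          ∑ q ∈ Finset.Ioc X Y, meanSq A B C D q := sum_sq_block_le A B C D hYp N
      _ ≤ (N + 2 * (2 * X : ℝ) ^ 2 * l) * (W * (X : ℝ) ^ (-(1 - ε))) := by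
          refine mul_le_mul (by gcongr) (hV X Y (h0.trans hX0))
            (Finset.sum_nonneg fun q _ => meanSq_nonneg _ _ _ _ _) (by positivity)
      _ = W * (N * (X : ℝ) ^ (-(1 - ε))) +
          8 * W * l * ((X : ℝ) ^ 2 * (X : ℝ) ^ (-(1 - ε))) := by ring
      _ ≤ l * (8 * W) * (N * (Q₀ : ℝ) ^ (-(1 - ε))) + 8 * W * l * (Q₁ : ℝ) ^ (1 + ε) := by
          refine add_le_add ?_ (by gcongr)
          have : W ≤ l * (8 * W) := by nlinarith
          gcongr
      _ = _ := by ring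
  have hpm : ∀ n ∈ Finset.Icc 1 N,
      (∑ q ∈ Finset.Ioc Q₀ Q₁, singSeriesTerm A B C D q (n : ℤ)) ^ 2 ≤
      J * ∑ i ∈ Finset.range J,
        (∑ q ∈ Finset.Ioc (min (2 ^ i * Q₀) Q₁) (min (2 ^ (i + 1) * Q₀) Q₁),
          singSeriesTerm A B C D q (n : ℤ)) ^ 2 := by
    intro n _
    rw [sum_Ioc_eq_sum_dyadic _ h0 h]
    simpa using sq_sum_le_card_mul_sum_sq (s := Finset.range J)
      (f := fun i => ∑ q ∈ Finset.Ioc (min (2 ^ i * Q₀) Q₁) (min (2 ^ (i + 1) * Q₀) Q₁),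
        singSeriesTerm A B C D q (n : ℤ))
  refine (Finset.sum_le_sum hpm).trans ?_
  rw [← Finset.mul_sum, Finset.sum_comm]
  have hl3 : l ^ 3 ≤ (1 + 2 / (ε / 3)) ^ 3 * (Q₁ : ℝ) ^ ε := by
    have h1 := one_add_log_le_rpow (x := (Q₁ : ℝ)) (by positivity : 0 < ε / 3) hQ1
    calc l ^ 3 ≤ ((1 + 2 / (ε / 3)) * (Q₁ : ℝ) ^ (ε / 3)) ^ 3 :=
          pow_le_pow_left₀ (by linarith) h1 3
      _ = _ := by
          rw [mul_pow, ← Real.rpow_natCast ((Q₁ : ℝ) ^ (ε / 3)) 3,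
            ← Real.rpow_mul (by linarith)]
          congr 2
          push_cast
          ring
  set E := (N * (Q₀ : ℝ) ^ (-(1 - ε)) + (Q₁ : ℝ) ^ (1 + ε)) with hE
  have hE0 : 0 ≤ E := by positivity
  have hs := Finset.sum_le_sum hblock
  rw [Finset.sum_const, Finset.card_range, nsmul_eq_mul] at hs
  calc _ ≤ (J : ℝ) * (J * (l * (8 * W) * E)) := by gcongr
    _ ≤ l * (l * (l * (8 * W) * E)) := by gcongr
    _ = l ^ 3 * (8 * W) * E := by ring
    _ ≤ (1 + 2 / (ε / 3)) ^ 3 * (Q₁ : ℝ) ^ ε * (8 * W) * E := by gcongr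
    _ = _ := by ring

end MediumRange

open NumberTheorySymbols

section QuadraticCharacter

lemma jacobiSym_neg_one_of_mod_eight {b : ℕ} :
    (b % 8 = 1 → J(-1 | b) = 1) ∧ (b % 8 = 3 → J(-1 | b) = -1) ∧ (b % 8 = 7 → J(-1 | b) = -1) := by
  refine ⟨fun h => ?_, fun h => ?_, fun h => ?_⟩ <;>
  · rw [jacobiSym.at_neg_one (Nat.odd_iff.mpr (by omega)), ZMod.χ₄_nat_eq_if_mod_four]
    rw [if_neg (by omega)]
    first | rw [if_pos (by omega)] | rw [if_neg (by omega)]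

lemma jacobiSym_two_of_mod_eight {b : ℕ} :
    (b % 8 = 1 → J(2 | b) = 1) ∧ (b % 8 = 3 → J(2 | b) = -1) ∧ (b % 8 = 7 → J(2 | b) = 1) := by
  refine ⟨fun h => ?_, fun h => ?_, fun h => ?_⟩ <;>
  · rw [jacobiSym.at_two (Nat.odd_iff.mpr (by omega)), ZMod.χ₈_nat_eq_if_mod_eight]
    rw [if_neg (by omega)]
    first | rw [if_pos (by omega)] | rw [if_neg (by omega)]

lemma exists_eq_sq_mul_unit_mul_squarefree {E : ℤ} (hE : E ≠ 0) :
    ∃ (s : ℕ) (c : ℤ) (m : ℕ), s ≠ 0 ∧ (c = 1 ∨ c = -1 ∨ c = 2 ∨ c = -2) ∧ Odd m ∧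
      Squarefree m ∧ E = (s : ℤ) ^ 2 * c * m := by
  obtain ⟨d, s, hsd, hd⟩ := Nat.sq_mul_squarefree E.natAbs
  have hE' : E.natAbs ≠ 0 := by simpa using hE
  have hs : s ≠ 0 := by rintro rfl; simp at hsd; omega
  have hsgn : E = (s : ℤ) ^ 2 * (Int.sign E * d) := by
    have h1 := Int.sign_mul_natAbs E
    rw [← hsd] at h1
    push_cast at h1
    linarith
  have hsg : Int.sign E = 1 ∨ Int.sign E = -1 := by
    rcases lt_or_gt_of_ne hE with h | h
    · right; exact Int.sign_eq_neg_one_of_neg h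
    · left; exact Int.sign_eq_one_of_pos h
  rcases Nat.even_or_odd d with he | ho
  · obtain ⟨m, hm⟩ := he
    have hm' : d = 2 * m := by omega
    refine ⟨s, 2 * Int.sign E, m, hs, ?_, ?_, ?_, ?_⟩
    · rcases hsg with h | h <;> simp [h]
    · rw [← Nat.not_even_iff_odd]
      rintro ⟨k, hk⟩
      have := hd 2 ⟨k, by omega⟩
      simp at this
    · exact hd.squarefree_of_dvd ⟨2, by omega⟩
    · refine hsgn.trans ?_
      rw [hm']; push_cast; ring
  · refine ⟨s, Int.sign E, d, hs, ?_, ho, hd, ?_⟩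
    · rcases hsg with h | h <;> simp [h]
    · rw [mul_assoc]; exact hsgn

lemma exists_jacobiSym_eq_neg_one {E : ℤ} (hE : ¬ IsSquare E) :
    ∃ b : ℕ, Odd b ∧ J(E | b) = -1 := by
  have hE0 : E ≠ 0 := by rintro rfl; exact hE ⟨0, by simp⟩
  obtain ⟨s, c, m, hs, hc, hm, hsq, rfl⟩ := exists_eq_sq_mul_unit_mul_squarefree hE0
  by_cases hm1 : m = 1
  · subst hm1
    obtain ⟨j, s', hs', rfl⟩ := Nat.exists_eq_pow_mul_and_not_dvd hs 2 (by norm_num)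
    have hodd : Nat.Coprime 2 s' := (Nat.Prime.coprime_iff_not_dvd Nat.prime_two).mpr hs'
    have hcop : Nat.Coprime 8 s' := Nat.Coprime.pow_left 3 hodd
    have main : ∀ r, r % 2 = 1 → r < 8 → (∀ b : ℕ, b % 8 = r → J(c | b) = -1) →
        ∃ b : ℕ, Odd b ∧ J((((2 ^ j * s' : ℕ) : ℤ)) ^ 2 * c * ((1 : ℕ) : ℤ) | b) = -1 := by
      intro r hr hr8 hJ
      obtain ⟨b, hb1, hb2⟩ := Nat.chineseRemainder hcop r 1
      have hb8 : b % 8 = r := by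
        have : b % 8 = r % 8 := hb1
        omega
      have hbo : Odd b := Nat.odd_iff.mpr (by omega)
      have hbs : Nat.Coprime s' b := by
        have h1 : Nat.gcd b s' = Nat.gcd 1 s' := Nat.ModEq.gcd_eq hb2
        rw [Nat.Coprime, Nat.gcd_comm, h1, Nat.gcd_one_left]
      have hb2' : Nat.Coprime (2 ^ j * s') b :=
        Nat.Coprime.mul_left (Nat.Coprime.pow_left j (Nat.coprime_two_left.mpr hbo)) hbs
      refine ⟨b, hbo, ?_⟩
      rw [jacobiSym.mul_left, jacobiSym.mul_left, Nat.cast_one, jacobiSym.one_left, mul_one,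
        jacobiSym.sq_one' (by exact_mod_cast hb2'), one_mul, hJ b hb8]
    rcases hc with rfl | rfl | rfl | rfl
    · exact absurd ⟨((2 ^ j * s' : ℕ) : ℤ), by push_cast; ring⟩ hE
    · exact main 3 rfl (by norm_num) fun b hb => jacobiSym_neg_one_of_mod_eight.2.1 hb
    · exact main 3 rfl (by norm_num) fun b hb => jacobiSym_two_of_mod_eight.2.1 hb
    · refine main 7 rfl (by norm_num) fun b hb => ?_
      rw [show (-2 : ℤ) = -1 * 2 by norm_num, jacobiSym.mul_left,
        jacobiSym_neg_one_of_mod_eight.2.2 hb, jacobiSym_two_of_mod_eight.2.2 hb, mul_one]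
  · obtain ⟨p, hp, t, rfl⟩ := Nat.exists_prime_and_dvd hm1
    have : Fact p.Prime := ⟨hp⟩
    have hpo : Odd p := Nat.Odd.of_mul_left hm
    have hto : Odd t := Nat.Odd.of_mul_right hm
    have hp2 : p ≠ 2 := by rintro rfl; exact absurd hpo (by decide)
    have hpt : ¬ p ∣ t := by
      intro h
      exact hp.one_lt.ne' (Nat.isUnit_iff.mp (hsq p (mul_dvd_mul_left p h)))
    obtain ⟨j, s', hs', rfl⟩ := Nat.exists_eq_pow_mul_and_not_dvd hs p hp.ne_one
    have hcop : Nat.Coprime (8 * (t * s')) p := by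
      refine Nat.Coprime.mul_left ?_ (Nat.Coprime.mul_left ?_ ?_)
      · exact Nat.Coprime.pow_left 3 (Nat.coprime_two_left.mpr hpo)
      · exact ((Nat.Prime.coprime_iff_not_dvd hp).mpr hpt).symm
      · exact ((Nat.Prime.coprime_iff_not_dvd hp).mpr hs').symm
    obtain ⟨x, hx⟩ := quadraticChar_exists_neg_one (F := ZMod p) (by rwa [ZMod.ringChar_zmod_n])
    obtain ⟨b, hb1, hb2⟩ := Nat.chineseRemainder hcop 1 x.val
    have hb8 : b % 8 = 1 := (Nat.ModEq.of_mul_right _ hb1 : b ≡ 1 [MOD 8])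
    have hbts : b ≡ 1 [MOD t * s'] := Nat.ModEq.of_mul_left _ hb1
    have hbt : b ≡ 1 [MOD t] := Nat.ModEq.of_mul_right _ hbts
    have hbs : b ≡ 1 [MOD s'] := Nat.ModEq.of_mul_left _ hbts
    have hbo : Odd b := Nat.odd_iff.mpr (by omega)
    have hJp : J((b : ℤ) | p) = -1 := by
      rw [← jacobiSym.legendreSym.to_jacobiSym, legendreSym]
      rw [← hx]
      congr 1
      rw [Int.cast_natCast, (ZMod.natCast_eq_natCast_iff b x.val p).mpr hb2, ZMod.natCast_val,
        ZMod.cast_id]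
    have hbp : Nat.Coprime p b := by
      rw [Nat.Prime.coprime_iff_not_dvd hp]
      intro h
      have : J((b : ℤ) | p) = 0 := by
        rw [jacobiSym.eq_zero_iff]
        refine ⟨hp.ne_zero, ?_⟩
        rw [Int.gcd_natCast_natCast, Nat.gcd_eq_right h]
        exact hp.ne_one
      rw [hJp] at this
      norm_num at this
    have hbs' : Nat.Coprime s' b := by
      have h1 : Nat.gcd b s' = Nat.gcd 1 s' := Nat.ModEq.gcd_eq hbs
      rw [Nat.Coprime, Nat.gcd_comm, h1, Nat.gcd_one_left]
    have hcb : J(c | b) = 1 := by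
      rcases hc with rfl | rfl | rfl | rfl
      · exact jacobiSym.one_left b
      · exact jacobiSym_neg_one_of_mod_eight.1 hb8
      · exact jacobiSym_two_of_mod_eight.1 hb8
      · rw [show (-2 : ℤ) = -1 * 2 by norm_num, jacobiSym.mul_left,
          jacobiSym_neg_one_of_mod_eight.1 hb8, jacobiSym_two_of_mod_eight.1 hb8, mul_one]
    have hJt : J((b : ℤ) | t) = 1 := by
      rw [jacobiSym.mod_left' (a₂ := 1), jacobiSym.one_left]
      exact_mod_cast hbt
    have : NeZero p := ⟨hp.ne_zero⟩
    have : NeZero t := ⟨by rintro rfl; exact absurd hto (by decide)⟩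
    refine ⟨b, hbo, ?_⟩
    rw [jacobiSym.mul_left, jacobiSym.mul_left,
      jacobiSym.sq_one' (by exact_mod_cast Nat.Coprime.mul_left (Nat.Coprime.pow_left j hbp) hbs'),
      hcb, one_mul, one_mul,
      jacobiSym.quadratic_reciprocity_one_mod_four' hm (by omega), jacobiSym.mul_right, hJp, hJt,
      mul_one]

/-- The Kronecker-type character `q ↦ (E/q)`, set to zero at even `q`. -/
noncomputable def quadChar (E : ℤ) (q : ℕ) : ℝ := if Even q then 0 else (J(E | q) : ℝ)

lemma quadChar_of_odd (E : ℤ) {q : ℕ} (hq : Odd q) : quadChar E q = J(E | q) := by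
  rw [quadChar, if_neg (Nat.not_even_iff_odd.mpr hq)]

lemma quadChar_of_even (E : ℤ) {q : ℕ} (hq : Even q) : quadChar E q = 0 := if_pos hq

@[simp] lemma quadChar_zero_right (E : ℤ) : quadChar E 0 = 0 := quadChar_of_even E (by decide)

@[simp] lemma quadChar_one_right (E : ℤ) : quadChar E 1 = 1 := by
  rw [quadChar_of_odd E (by decide), jacobiSym.one_right, Int.cast_one]

lemma quadChar_mul_right (E : ℤ) (a b : ℕ) :
    quadChar E (a * b) = quadChar E a * quadChar E b := by
  rcases Nat.even_or_odd a with ha | ha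
  · rw [quadChar_of_even E ha, quadChar_of_even E (ha.mul_right b), zero_mul]
  rcases Nat.even_or_odd b with hb | hb
  · rw [quadChar_of_even E hb, quadChar_of_even E (hb.mul_left a), mul_zero]
  have : NeZero a := ⟨ha.pos.ne'⟩
  have : NeZero b := ⟨hb.pos.ne'⟩
  rw [quadChar_of_odd E ha, quadChar_of_odd E hb, quadChar_of_odd E (ha.mul hb),
    jacobiSym.mul_right, Int.cast_mul]

lemma quadChar_mul_left (E F : ℤ) (q : ℕ) :
    quadChar (E * F) q = quadChar E q * quadChar F q := by
  rcases Nat.even_or_odd q with hq | hq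
  · simp [quadChar_of_even _ hq]
  · rw [quadChar_of_odd _ hq, quadChar_of_odd _ hq, quadChar_of_odd _ hq, jacobiSym.mul_left,
      Int.cast_mul]

lemma abs_quadChar_le_one (E : ℤ) (q : ℕ) : |quadChar E q| ≤ 1 := by
  rw [quadChar]
  split_ifs
  · simp
  · rcases jacobiSym.trichotomy E q with h | h | h <;> simp [h]

lemma quadChar_mod (E : ℤ) (q : ℕ) : quadChar E (q % (4 * E.natAbs)) = quadChar E q := by
  have hpar : (q % (4 * E.natAbs)) % 2 = q % 2 := Nat.mod_mod_of_dvd _ ⟨2 * E.natAbs, by ring⟩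
  rcases Nat.even_or_odd q with hq | hq
  · rw [quadChar_of_even E hq, quadChar_of_even E (by rw [Nat.even_iff] at hq ⊢; omega)]
  · rw [quadChar_of_odd E hq, quadChar_of_odd E (by rw [Nat.odd_iff] at hq ⊢; omega),
      ← jacobiSym.mod_right E hq]

lemma sum_quadChar_period {E : ℤ} (hE : ¬ IsSquare E) :
    ∑ a ∈ Finset.range (4 * E.natAbs), quadChar E a = 0 := by
  have hE0 : E ≠ 0 := by rintro rfl; exact hE ⟨0, by simp⟩
  set m := 4 * E.natAbs with hm
  have hm0 : m ≠ 0 := by have := Int.natAbs_ne_zero.mpr hE0; omega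
  have : NeZero m := ⟨hm0⟩
  obtain ⟨b, hbo, hb⟩ := exists_jacobiSym_eq_neg_one hE
  have hb' : quadChar E b = -1 := by rw [quadChar_of_odd E hbo, hb]; norm_num
  have hcop : Nat.Coprime b m := by
    have h1 : E.gcd b = 1 := by
      by_contra h
      have : J(E | b) = 0 := jacobiSym.eq_zero_iff.mpr ⟨hbo.pos.ne', h⟩
      rw [this] at hb
      norm_num at hb
    have h2 : Nat.Coprime b E.natAbs := by
      rw [Nat.coprime_comm]
      simpa [Int.gcd] using h1
    exact Nat.Coprime.mul_right
      (Nat.Coprime.pow_right 2 (Nat.coprime_two_right.mpr hbo)) h2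
  have e : ∀ f : ℕ → ℝ, ∑ a ∈ Finset.range m, f a = ∑ x : ZMod m, f x.val := by
    intro f
    symm
    refine Finset.sum_bij (fun (x : ZMod m) _ => x.val) ?_ ?_ ?_ ?_
    · intro x _; exact Finset.mem_range.mpr (ZMod.val_lt x)
    · intro x _ y _ h; exact ZMod.val_injective m h
    · intro a ha
      exact ⟨(a : ZMod m), Finset.mem_univ _,
        by rw [ZMod.val_natCast, Nat.mod_eq_of_lt (Finset.mem_range.mp ha)]⟩
    · intro x _; rfl
  set u := ZMod.unitOfCoprime b hcop with hu
  have h1 : ∑ x : ZMod m, quadChar E x.val = ∑ x : ZMod m, quadChar E ((u : ZMod m) * x).val :=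
    (Equiv.sum_comp (Units.mulLeft u) fun x : ZMod m => quadChar E x.val).symm
  have h2 : ∀ x : ZMod m, quadChar E ((u : ZMod m) * x).val = -quadChar E x.val := by
    intro x
    rw [hu, ZMod.coe_unitOfCoprime, ZMod.val_mul, ZMod.val_natCast, Nat.mod_mul_mod,
      quadChar_mod E (b * x.val), quadChar_mul_right, hb', neg_one_mul]
  rw [e]
  simp_rw [h2] at h1
  rw [Finset.sum_neg_distrib] at h1
  linarith

lemma abs_sum_range_quadChar_le {E : ℤ} (hE : ¬ IsSquare E) (x : ℕ) :
    |∑ a ∈ Finset.range x, quadChar E a| ≤ 4 * |(E : ℝ)| := by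
  have hE0 : E ≠ 0 := by rintro rfl; exact hE ⟨0, by simp⟩
  set m := 4 * E.natAbs with hm
  have hm0 : 0 < m := by have := Int.natAbs_ne_zero.mpr hE0; omega
  have hmr : (m : ℝ) = 4 * |(E : ℝ)| := by
    rw [hm]; push_cast; rw [Nat.cast_natAbs, Int.cast_abs]
  have hper : ∀ k r : ℕ, quadChar E (m * k + r) = quadChar E r := by
    intro k r
    rw [← quadChar_mod E (m * k + r), ← quadChar_mod E r, ← hm, Nat.mul_add_mod]
  have hblock : ∀ k : ℕ, ∑ a ∈ Finset.range (m * k), quadChar E a = 0 := by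
    intro k
    induction k with
    | zero => simp
    | succ k ih =>
      rw [Nat.mul_succ, Finset.sum_range_add, ih, zero_add]
      simp_rw [hper]
      exact sum_quadChar_period hE
  rw [← Nat.div_add_mod x m, Finset.sum_range_add, hblock, zero_add]
  simp_rw [hper]
  refine (Finset.abs_sum_le_sum_abs _ _).trans ?_
  refine (Finset.sum_le_sum fun a _ => abs_quadChar_le_one E a).trans ?_
  rw [Finset.sum_const, Finset.card_range, nsmul_one, ← hmr]
  exact_mod_cast (Nat.mod_lt x hm0).le

end QuadraticCharacter

section QuadraticTail

lemma abs_sum_range_mul_le_of_antitone {f g : ℕ → ℝ} {M : ℝ}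
    (hM : ∀ n, |∑ i ∈ Finset.range n, f i| ≤ M) (hg : Antitone g) (hg0 : ∀ n, 0 ≤ g n) (n : ℕ) :
    |∑ i ∈ Finset.range n, f i * g i| ≤ M * g 0 := by
  have hM0 : 0 ≤ M := (abs_nonneg _).trans (hM 0)
  cases n with
  | zero => simpa using mul_nonneg hM0 (hg0 0)
  | succ n =>
    have h1 : ∑ i ∈ Finset.range (n + 1), f i * g i =
        (∑ i ∈ Finset.range (n + 1), f i) * g n +
          ∑ i ∈ Finset.range n, (∑ j ∈ Finset.range (i + 1), f j) * (g i - g (i + 1)) := by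
      induction n with
      | zero => simp
      | succ n ih =>
        rw [Finset.sum_range_succ, ih, Finset.sum_range_succ _ (n + 1),
          Finset.sum_range_succ (fun i => (∑ j ∈ Finset.range (i + 1), f j) * (g i - g (i + 1))) n]
        ring
    have h2 : |∑ i ∈ Finset.range n, (∑ j ∈ Finset.range (i + 1), f j) * (g i - g (i + 1))| ≤
        ∑ i ∈ Finset.range n, M * (g i - g (i + 1)) := by
      refine (Finset.abs_sum_le_sum_abs _ _).trans (Finset.sum_le_sum fun i _ => ?_)
      have : 0 ≤ g i - g (i + 1) := sub_nonneg.mpr (hg (Nat.le_succ i))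
      rw [abs_mul, abs_of_nonneg this]
      exact mul_le_mul_of_nonneg_right (hM _) this
    rw [← Finset.mul_sum, Finset.sum_range_sub'] at h2
    rw [h1]
    refine (abs_add_le _ _).trans ?_
    rw [abs_mul, abs_of_nonneg (hg0 n)]
    have := mul_le_mul_of_nonneg_right (hM (n + 1)) (hg0 n)
    linarith

lemma abs_sum_Ioc_quadChar_div_le {E : ℤ} (hE : ¬ IsSquare E) {x y : ℕ} (hxy : x ≤ y) :
    |∑ a ∈ Finset.Ioc x y, quadChar E a / a| ≤ 8 * |(E : ℝ)| / (x + 1) := by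
  have e : ∀ h : ℕ → ℝ, ∀ y, x ≤ y →
      ∑ a ∈ Finset.Ioc x y, h a = ∑ i ∈ Finset.range (y - x), h (x + 1 + i) := by
    intro h y hy
    rw [← Finset.Ico_add_one_add_one_eq_Ioc, Finset.sum_Ico_eq_sum_range]
    congr 2
    omega
  rw [e _ y hxy]
  have h := abs_sum_range_mul_le_of_antitone (f := fun i => quadChar E (x + 1 + i))
    (g := fun i : ℕ => (((x + 1 + i : ℕ) : ℝ))⁻¹) (M := 8 * |(E : ℝ)|) ?_ ?_ ?_ (y - x)
  · simpa [div_eq_mul_inv] using h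
  · intro n
    have h1 := Finset.sum_range_add (fun a => quadChar E a) (x + 1) n
    have h2 := abs_sum_range_quadChar_le hE (x + 1 + n)
    have h3 := abs_sum_range_quadChar_le hE (x + 1)
    have h4 : ∑ i ∈ Finset.range n, quadChar E (x + 1 + i) =
        ∑ a ∈ Finset.range (x + 1 + n), quadChar E a -
          ∑ a ∈ Finset.range (x + 1), quadChar E a := by rw [h1]; ring
    rw [h4]
    refine (abs_sub _ _).trans ?_
    linarith
  · intro i j hij
    exact inv_anti₀ (by positivity) (by exact_mod_cast Nat.add_le_add_left hij _)
  · intro i; positivity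

lemma exists_tendsto_sum_quadChar_div {E : ℤ} (hE : ¬ IsSquare E) :
    ∃ l : ℝ, Filter.Tendsto (fun x : ℕ => ∑ a ∈ Finset.Ioc 0 x, quadChar E a / a)
      Filter.atTop (nhds l) := by
  refine cauchySeq_tendsto_of_complete (Metric.cauchySeq_iff'.mpr fun ε hε => ?_)
  obtain ⟨k, hk⟩ := exists_nat_gt (8 * |(E : ℝ)| / ε)
  refine ⟨k, fun n hn => ?_⟩
  rw [Real.dist_eq, ← Finset.sum_Ioc_consecutive _ (Nat.zero_le k) hn, add_sub_cancel_left]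
  refine (abs_sum_Ioc_quadChar_div_le hE hn).trans_lt ?_
  rw [div_lt_iff₀ hε] at hk
  rw [div_lt_iff₀ (by positivity)]
  nlinarith

/-- The value `L(1, (E/·))`, with the Euler factor at `2` removed. -/
noncomputable def quadLim (E : ℤ) : ℝ :=
  Filter.atTop.limUnder fun x : ℕ => ∑ a ∈ Finset.Ioc 0 x, quadChar E a / a

lemma tendsto_quadLim {E : ℤ} (hE : ¬ IsSquare E) :
    Filter.Tendsto (fun x : ℕ => ∑ a ∈ Finset.Ioc 0 x, quadChar E a / a)
      Filter.atTop (nhds (quadLim E)) :=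
  tendsto_nhds_limUnder (exists_tendsto_sum_quadChar_div hE)

/-- The tail `Σ_{a > x} (E/a)/a`. -/
noncomputable def quadTail (E : ℤ) (x : ℕ) : ℝ :=
  quadLim E - ∑ a ∈ Finset.Ioc 0 x, quadChar E a / a

lemma quadTail_zero (E : ℤ) : quadTail E 0 = quadLim E := by simp [quadTail]

lemma quadTail_eq_add (E : ℤ) {x y : ℕ} (hxy : x ≤ y) :
    quadTail E x = ∑ a ∈ Finset.Ioc x y, quadChar E a / a + quadTail E y := by
  rw [quadTail, quadTail, ← Finset.sum_Ioc_consecutive _ (Nat.zero_le x) hxy]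
  ring

lemma abs_quadTail_le {E : ℤ} (hE : ¬ IsSquare E) (x : ℕ) :
    |quadTail E x| ≤ 8 * |(E : ℝ)| / (x + 1) := by
  have h1 : Filter.Tendsto (fun y : ℕ => |∑ a ∈ Finset.Ioc 0 y, quadChar E a / a -
      ∑ a ∈ Finset.Ioc 0 x, quadChar E a / a|) Filter.atTop (nhds |quadTail E x|) :=
    ((tendsto_quadLim hE).sub_const _).abs
  refine le_of_tendsto h1 (Filter.eventually_atTop.mpr ⟨x, fun y hy => ?_⟩)
  rw [← Finset.sum_Ioc_consecutive _ (Nat.zero_le x) hy, add_sub_cancel_left]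
  exact abs_sum_Ioc_quadChar_div_le hE hy

lemma abs_quadTail_le_log {E : ℤ} (hE : ¬ IsSquare E) (x : ℕ) :
    |quadTail E x| ≤ 9 + Real.log |(E : ℝ)| := by
  have hE0 : E ≠ 0 := by rintro rfl; exact hE ⟨0, by simp⟩
  have hE1 : (1 : ℝ) ≤ |(E : ℝ)| := by
    rw [← Int.cast_abs]; exact_mod_cast Int.one_le_abs hE0
  have hcast : ((E.natAbs : ℕ) : ℝ) = |(E : ℝ)| := by rw [Nat.cast_natAbs, Int.cast_abs]
  have hlog := Real.log_nonneg hE1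
  rcases le_total x E.natAbs with h | h
  · rw [quadTail_eq_add E h]
    refine (abs_add_le _ _).trans ?_
    have h1 : |∑ a ∈ Finset.Ioc x E.natAbs, quadChar E a / a| ≤ 1 + Real.log |(E : ℝ)| := by
      have h2 := harmonic_le_one_add_log E.natAbs
      rw [hcast] at h2
      refine le_trans ?_ h2
      rw [harmonic_eq_sum_Icc]
      push_cast
      refine (Finset.abs_sum_le_sum_abs _ _).trans ?_
      refine (Finset.sum_le_sum (g := fun a : ℕ => (a : ℝ)⁻¹) fun a _ => ?_).trans
        (Finset.sum_le_sum_of_subset_of_nonneg ?_ fun _ _ _ => by positivity)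
      · rw [abs_div, Nat.abs_cast, div_eq_mul_inv]
        exact mul_le_of_le_one_left (by positivity) (abs_quadChar_le_one E a)
      · intro a ha
        rw [Finset.mem_Ioc] at ha
        rw [Finset.mem_Icc]
        omega
    have h3 := abs_quadTail_le hE E.natAbs
    rw [hcast] at h3
    have h4 : 8 * |(E : ℝ)| / (|(E : ℝ)| + 1) ≤ 8 := by
      rw [div_le_iff₀ (by positivity)]; linarith
    linarith
  · have h3 := abs_quadTail_le hE x
    have h5 : |(E : ℝ)| ≤ x := by rw [← hcast]; exact_mod_cast h
    have h4 : 8 * |(E : ℝ)| / ((x : ℝ) + 1) ≤ 8 := by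
      rw [div_le_iff₀ (by positivity)]; linarith
    linarith

end QuadraticTail

section DualSieve

lemma sum_sq_sum_le_of_gram {ι κ : Type*} (s : Finset ι) (t : Finset κ) (c : κ → ℝ)
    (v : ι → κ → ℝ) {R : ℝ} (hR0 : 0 ≤ R)
    (hR : ∀ i ∈ s, ∑ j ∈ s, |∑ m ∈ t, v i m * v j m| ≤ R) :
    ∑ i ∈ s, (∑ m ∈ t, c m * v i m) ^ 2 ≤ R * ∑ m ∈ t, c m ^ 2 := by
  set V : ι → ℝ := fun i => ∑ m ∈ t, c m * v i m with hV
  set S := ∑ i ∈ s, V i ^ 2 with hS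
  have hS0 : 0 ≤ S := Finset.sum_nonneg fun _ _ => sq_nonneg _
  have h1 : S = ∑ m ∈ t, c m * ∑ i ∈ s, V i * v i m := by
    rw [hS]
    simp_rw [Finset.mul_sum]
    rw [Finset.sum_comm]
    refine Finset.sum_congr rfl fun i _ => ?_
    rw [sq]
    nth_rewrite 2 [hV]
    rw [Finset.mul_sum]
    exact Finset.sum_congr rfl fun m _ => by ring
  have h2 : ∑ m ∈ t, (∑ i ∈ s, V i * v i m) ^ 2 ≤ R * S := by
    have h3 : ∑ m ∈ t, (∑ i ∈ s, V i * v i m) ^ 2 =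
        ∑ i ∈ s, ∑ j ∈ s, V i * V j * ∑ m ∈ t, v i m * v j m := by
      simp_rw [sq, Finset.sum_mul_sum, Finset.mul_sum]
      rw [Finset.sum_comm]
      refine Finset.sum_congr rfl fun i _ => ?_
      rw [Finset.sum_comm]
      exact Finset.sum_congr rfl fun j _ => Finset.sum_congr rfl fun m _ => by ring
    rw [h3]
    have h4 := sum_sum_mul_le_of_row_sum_le s (fun i => |V i|)
      (fun i j => |∑ m ∈ t, v i m * v j m|)
      (fun i j => by simp_rw [mul_comm]) (fun _ _ => abs_nonneg _) hR
    simp_rw [sq_abs] at h4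
    refine le_trans (Finset.sum_le_sum fun i _ => Finset.sum_le_sum fun j _ => ?_) h4
    rw [← abs_mul, ← abs_mul]
    exact le_abs_self _
  have h3 : S ^ 2 ≤ (∑ m ∈ t, c m ^ 2) * (R * S) := by
    nth_rewrite 1 [h1]
    exact (Finset.sum_mul_sq_le_sq_mul_sq _ _ _).trans
      (mul_le_mul_of_nonneg_left h2 (Finset.sum_nonneg fun _ _ => sq_nonneg _))
  rcases hS0.eq_or_lt with h | h
  · rw [← h]
    exact mul_nonneg hR0 (Finset.sum_nonneg fun _ _ => sq_nonneg _)
  · nlinarith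

end DualSieve

section PellCount

/-- Two positive solutions of `x² − dy² = k` that are congruent modulo `k` differ by a nontrivial
unit of norm one, so the larger is at least twice the smaller. -/
lemma two_mul_le_of_pell {d k x₁ y₁ x₂ y₂ : ℤ} (hk : k ≠ 0) (hd : 2 ≤ d)
    (h₁ : x₁ ^ 2 - d * y₁ ^ 2 = k) (h₂ : x₂ ^ 2 - d * y₂ ^ 2 = k)
    (hx : k ∣ x₂ - x₁) (hy : k ∣ y₂ - y₁) (hx₁ : 0 < x₁) (hlt : x₁ < x₂)
    (hy₁ : 0 ≤ y₁) (hy₂ : 0 ≤ y₂) : 2 * x₁ ≤ x₂ := by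
  obtain ⟨a, ha⟩ := hx
  obtain ⟨b, hb⟩ := hy
  obtain rfl : x₂ = x₁ + k * a := by linarith
  obtain rfl : y₂ = y₁ + k * b := by linarith
  set u : ℤ := 1 + a * x₁ - d * b * y₁ with hu
  set v : ℤ := x₁ * b - a * y₁ with hv
  have e1 : x₁ + k * a = u * x₁ + d * v * y₁ := by rw [hu, hv, ← h₁]; ring
  have e2 : y₁ + k * b = u * y₁ + v * x₁ := by rw [hu, hv, ← h₁]; ring
  have hnorm : u ^ 2 - d * v ^ 2 = 1 := by
    have h3 : (u ^ 2 - d * v ^ 2) * k = 1 * k := by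
      rw [one_mul]
      nth_rewrite 2 [← h₂]
      rw [e1, e2, ← h₁]
      ring
    exact mul_right_cancel₀ hk h3
  set x₂ := x₁ + k * a
  set y₂ := y₁ + k * b
  have hu0 : 0 < u := by
    by_contra hcon
    have hu1 : u ≤ -1 := by
      rcases (not_lt.mp hcon).eq_or_lt with h | h
      · rw [h] at hnorm; nlinarith [sq_nonneg v]
      · omega
    have a1 : -u * x₁ < d * v * y₁ := by linarith
    have a2 : -u * y₁ ≤ v * x₁ := by linarith
    have hpos : 0 < -u * x₁ := mul_pos (by linarith) hx₁
    have hy1p : 0 < y₁ := by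
      rcases hy₁.eq_or_lt with h | h
      · rw [← h] at a1; linarith
      · exact h
    have a3 : (-u * x₁) * (-u * y₁) < (d * v * y₁) * (v * x₁) :=
      mul_lt_mul a1 a2 (mul_pos (by linarith) hy1p) (by linarith)
    have a4 : 0 < (x₁ * y₁) * (d * v ^ 2 - u ^ 2) := by nlinarith
    nlinarith [mul_pos hx₁ hy1p]
  have hv0 : 0 < v := by
    by_contra hcon
    have hv1 := not_lt.mp hcon
    have a1 : d * (-v) * y₁ < (u - 1) * x₁ := by linarith
    have a2 : (-v) * x₁ ≤ u * y₁ := by linarith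
    have a3 : d * (-v) * ((-v) * x₁) ≤ d * (-v) * (u * y₁) :=
      mul_le_mul_of_nonneg_left a2 (mul_nonneg (by linarith) (by linarith))
    have a4 : u * (d * (-v) * y₁) < u * ((u - 1) * x₁) := mul_lt_mul_of_pos_left a1 hu0
    have a5 : 0 < x₁ * (u * (u - 1) - d * v ^ 2) := by nlinarith
    nlinarith [pos_of_mul_pos_right a5 hx₁.le]
  have hu2 : 2 ≤ u := by
    by_contra hcon
    have : u = 1 := by omega
    rw [this] at hnorm
    nlinarith [mul_pos hv0 hv0]
  nlinarith [mul_nonneg (mul_nonneg (by linarith : (0 : ℤ) ≤ d) hv0.le) hy₁]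

lemma card_pell_le {k d : ℤ} (hk : k ≠ 0) (hd : 2 ≤ d) (N : ℕ) (s : Finset ℕ)
    (hs : s ⊆ Finset.Icc 1 N) (h : ∀ x ∈ s, ∃ y : ℤ, 0 ≤ y ∧ (x : ℤ) ^ 2 - d * y ^ 2 = k) :
    s.card ≤ k.natAbs ^ 2 * (Nat.log 2 N + 1) := by
  have : NeZero k.natAbs := ⟨Int.natAbs_ne_zero.mpr hk⟩
  choose! y hy0 hy using h
  set φ : ℕ → ZMod k.natAbs × ZMod k.natAbs := fun x => ((x : ZMod k.natAbs), (y x : ZMod k.natAbs))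
  have hfib : ∀ c ∈ (Finset.univ : Finset (ZMod k.natAbs × ZMod k.natAbs)),
      (s.filter fun x => φ x = c).card ≤ Nat.log 2 N + 1 := by
    intro c _
    have hinj : Set.InjOn (Nat.log 2) (s.filter fun x => φ x = c : Finset ℕ) := by
      have key : ∀ x₁ ∈ s.filter (fun x => φ x = c), ∀ x₂ ∈ s.filter (fun x => φ x = c),
          x₁ < x₂ → Nat.log 2 x₁ < Nat.log 2 x₂ := by
        intro x₁ h₁ x₂ h₂ hlt
        rw [Finset.mem_filter] at h₁ h₂
        have hx1 : 1 ≤ x₁ := (Finset.mem_Icc.mp (hs h₁.1)).1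
        have hc : φ x₁ = φ x₂ := h₁.2.trans h₂.2.symm
        have hc1 : ((x₁ : ℤ) : ZMod k.natAbs) = ((x₂ : ℤ) : ZMod k.natAbs) := by
          simpa using (Prod.ext_iff.mp hc).1
        have hc2 : (y x₁ : ZMod k.natAbs) = (y x₂ : ZMod k.natAbs) := (Prod.ext_iff.mp hc).2
        rw [ZMod.intCast_eq_intCast_iff_dvd_sub, Int.natAbs_dvd] at hc1 hc2
        have h3 := two_mul_le_of_pell hk hd (hy x₁ h₁.1) (hy x₂ h₂.1) hc1 hc2
          (by exact_mod_cast hx1) (by exact_mod_cast hlt) (hy0 x₁ h₁.1) (hy0 x₂ h₂.1)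
        have h4 : 2 * x₁ ≤ x₂ := by exact_mod_cast h3
        calc Nat.log 2 x₁ < Nat.log 2 x₁ + 1 := Nat.lt_succ_self _
          _ = Nat.log 2 (x₁ * 2) := (Nat.log_mul_base one_lt_two (by omega)).symm
          _ ≤ _ := Nat.log_mono_right (by omega)
      intro x₁ h₁ x₂ h₂ heq
      rcases lt_trichotomy x₁ x₂ with hl | hl | hl
      · exact absurd heq (key x₁ h₁ x₂ h₂ hl).ne
      · exact hl
      · exact absurd heq (key x₂ h₂ x₁ h₁ hl).ne'
    rw [← Finset.card_image_of_injOn hinj, ← Finset.card_range (Nat.log 2 N + 1)]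
    refine Finset.card_le_card fun z hz => ?_
    obtain ⟨x, hx, rfl⟩ := Finset.mem_image.mp hz
    have hxN := (Finset.mem_Icc.mp (hs (Finset.mem_filter.mp hx).1)).2
    exact Finset.mem_range.mpr (Nat.lt_succ_of_le (Nat.log_mono_right hxN))
  refine (Finset.card_le_mul_card_image_of_maps_to (f := φ) (fun x _ => Finset.mem_univ _) _
    hfib).trans (le_of_eq ?_)
  rw [Finset.card_univ, Fintype.card_prod, ZMod.card]
  ring

lemma card_isSquare_mul_le {Δ : ℤ} (hΔ : Δ ≠ 0) (N : ℕ) {E : ℤ} (hE : ¬ IsSquare E) :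
    ((Finset.Icc 1 N).filter fun n : ℕ => IsSquare (E * ((n : ℤ) ^ 2 - 4 * Δ))).card ≤
      (4 * Δ).natAbs ^ 2 * (Nat.log 2 N + 1) := by
  have hE0 : E ≠ 0 := by rintro rfl; exact hE ⟨0, by simp⟩
  have hm : 1 ≤ (4 * Δ).natAbs := Nat.one_le_iff_ne_zero.mpr (Int.natAbs_ne_zero.mpr (by omega))
  rcases lt_or_gt_of_ne hE0 with hneg | hpos
  · calc _ ≤ (Finset.Icc 1 (4 * Δ).natAbs).card := by
          refine Finset.card_le_card fun n hn => ?_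
          rw [Finset.mem_filter, Finset.mem_Icc] at hn
          rw [Finset.mem_Icc]
          refine ⟨hn.1.1, ?_⟩
          have h1 : 0 ≤ E * ((n : ℤ) ^ 2 - 4 * Δ) := hn.2.nonneg
          have h2 : (n : ℤ) ^ 2 ≤ 4 * Δ := by nlinarith
          have h3 : (n : ℤ) ≤ (n : ℤ) ^ 2 := by
            have : (1 : ℤ) ≤ n := by exact_mod_cast hn.1.1
            nlinarith
          omega
      _ = (4 * Δ).natAbs := by simp
      _ ≤ _ := by nlinarith [Nat.zero_le (Nat.log 2 N)]
  · obtain ⟨d, s, hsd, hd⟩ := Nat.sq_mul_squarefree E.natAbs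
    have hEd : E = (s : ℤ) ^ 2 * d := by
      have : ((s ^ 2 * d : ℕ) : ℤ) = E := by rw [hsd]; omega
      rw [← this]; push_cast; rfl
    have hs0 : (s : ℤ) ≠ 0 := by
      intro h; apply hE0; rw [hEd, h]; ring
    have hd0 : d ≠ 0 := hd.ne_zero
    have hd1 : d ≠ 1 := by
      rintro rfl
      exact hE ⟨s, by rw [hEd]; push_cast; ring⟩
    refine card_pell_le (d := d) (by omega) (by omega) N _ (Finset.filter_subset _ _) ?_
    intro n hn
    obtain ⟨w, hw⟩ := (Finset.mem_filter.mp hn).2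
    have h1 : (s : ℤ) ∣ w := by
      rw [← Int.pow_dvd_pow_iff two_ne_zero]
      exact ⟨d * ((n : ℤ) ^ 2 - 4 * Δ), by rw [sq w, ← hw, hEd]; ring⟩
    obtain ⟨w', rfl⟩ := h1
    have h2 : (d : ℤ) * ((n : ℤ) ^ 2 - 4 * Δ) = w' ^ 2 := by
      have : (s : ℤ) ^ 2 * ((d : ℤ) * ((n : ℤ) ^ 2 - 4 * Δ)) = (s : ℤ) ^ 2 * w' ^ 2 := by
        rw [← mul_assoc, ← hEd, hw]; ring
      exact mul_left_cancel₀ (pow_ne_zero 2 hs0) this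
    have h3 : (d : ℤ) ∣ w' := by
      have hsf : Squarefree (d : ℤ) := Int.squarefree_natCast.mpr hd
      exact (hsf.dvd_pow_iff_dvd two_ne_zero).mp ⟨_, h2.symm⟩
    obtain ⟨w'', rfl⟩ := h3
    refine ⟨|w''|, abs_nonneg _, ?_⟩
    have hdz : (d : ℤ) ≠ 0 := by exact_mod_cast hd0
    have h4 : (n : ℤ) ^ 2 - 4 * Δ = d * w'' ^ 2 := by
      refine mul_left_cancel₀ hdz ?_
      rw [h2]; ring
    rw [sq_abs]
    linarith

end PellCount

section HighMoment

/-- The number of ways to write `m` as an ordered product of `k` elements of `I`. -/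
def prodCount (k : ℕ) (I : Finset ℕ) (m : ℕ) : ℕ :=
  ((Fintype.piFinset fun _ : Fin k => I).filter fun f => ∏ i, f i = m).card

lemma sum_pow_eq_sum_prodCount (φ : ℕ →* ℝ) (k : ℕ) (I t : Finset ℕ)
    (ht : ∀ f ∈ Fintype.piFinset fun _ : Fin k => I, ∏ i, f i ∈ t) :
    (∑ a ∈ I, φ a) ^ k = ∑ m ∈ t, prodCount k I m * φ m := by
  have h1 := Finset.prod_univ_sum (fun _ : Fin k => I) fun _ a => φ a
  rw [Finset.prod_const, Finset.card_univ, Fintype.card_fin] at h1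
  rw [h1, ← Finset.sum_fiberwise_of_maps_to ht]
  refine Finset.sum_congr rfl fun m _ => ?_
  rw [Finset.sum_congr rfl (g := fun _ => φ m), Finset.sum_const, nsmul_eq_mul, prodCount]
  intro f hf
  rw [← map_prod, (Finset.mem_filter.mp hf).2]

lemma prodCount_le (k : ℕ) (I : Finset ℕ) {m : ℕ} (hm : m ≠ 0) :
    prodCount k I m ≤ m.divisors.card ^ k := by
  have h1 : prodCount k I m ≤ (Fintype.piFinset fun _ : Fin k => m.divisors).card := by
    refine Finset.card_le_card fun f hf => ?_
    rw [Fintype.mem_piFinset]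
    intro i
    rw [Nat.mem_divisors]
    exact ⟨(Finset.mem_filter.mp hf).2 ▸ Finset.dvd_prod_of_mem f (Finset.mem_univ i), hm⟩
  simpa using h1

lemma prodCount_eq_zero {k X Y m : ℕ} (hk : k ≠ 0) (hm : m ≤ X ^ k) :
    prodCount k (Finset.Ioc X Y) m = 0 := by
  rw [prodCount, Finset.card_eq_zero, Finset.filter_eq_empty_iff]
  intro f hf h
  have h1 : X ^ k < ∏ i, f i := by
    have : NeZero k := ⟨hk⟩
    calc X ^ k = ∏ _i : Fin k, X := by simp
      _ < ∏ i, f i := by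
        rcases Nat.eq_zero_or_pos X with rfl | hX
        · simp only [Finset.prod_const, Finset.card_univ, Fintype.card_fin, zero_pow hk]
          exact Finset.prod_pos fun i _ =>
            (Finset.mem_Ioc.mp (Fintype.mem_piFinset.mp hf i)).1
        · exact Finset.prod_lt_prod_of_nonempty (fun _ _ => hX)
            (fun i _ => (Finset.mem_Ioc.mp (Fintype.mem_piFinset.mp hf i)).1)
            Finset.univ_nonempty
  omega

/-- `a ↦ (E/a)/a` as a monoid homomorphism. -/
noncomputable def quadHom (E : ℤ) : ℕ →* ℝ where
  toFun a := quadChar E a / a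
  map_one' := by simp
  map_mul' a b := by rw [quadChar_mul_right, Nat.cast_mul, mul_div_mul_comm]

/-- The discriminant `n² − 4Δ`. -/
def disc (Δ : ℤ) (n : ℕ) : ℤ := (n : ℤ) ^ 2 - 4 * Δ

lemma abs_disc_le (Δ : ℤ) {n N : ℕ} (hn : 1 ≤ n) (hN : n ≤ N) :
    |(disc Δ n : ℝ)| ≤ (1 + 4 * |(Δ : ℝ)|) * (N : ℝ) ^ 2 := by
  have h1 : (n : ℝ) ≤ N := by exact_mod_cast hN
  have h2 : (1 : ℝ) ≤ n := by exact_mod_cast hn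
  rw [disc]
  push_cast
  refine (abs_sub _ _).trans ?_
  rw [abs_of_nonneg (sq_nonneg (n : ℝ)), abs_mul, abs_of_pos (by norm_num : (0 : ℝ) < 4)]
  have h3 : (1 : ℝ) ≤ (N : ℝ) ^ 2 := one_le_pow₀ (h2.trans h1)
  have h4 : (n : ℝ) ^ 2 ≤ (N : ℝ) ^ 2 := by gcongr
  nlinarith [abs_nonneg (Δ : ℝ)]

/-- The `n ≤ N` with non-square discriminant. -/
def nonsquares (Δ : ℤ) (N : ℕ) : Finset ℕ := (Finset.Icc 1 N).filter fun n => ¬ IsSquare (disc Δ n)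

lemma mem_nonsquares {Δ : ℤ} {N n : ℕ} :
    n ∈ nonsquares Δ N ↔ (1 ≤ n ∧ n ≤ N) ∧ ¬ IsSquare (disc Δ n) := by
  rw [nonsquares, Finset.mem_filter, Finset.mem_Icc]

lemma sum_abs_gram_le {Δ : ℤ} (hΔ : Δ ≠ 0) {N n : ℕ} (hn : n ∈ nonsquares Δ N) (M : ℕ) :
    ∑ n' ∈ nonsquares Δ N,
      |∑ m ∈ Finset.Ioc 0 M, quadChar (disc Δ n) m * quadChar (disc Δ n') m| ≤
      M * ((4 * Δ).natAbs ^ 2 * (1 + 2 * Real.log N)) +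
        4 * (1 + 4 * |(Δ : ℝ)|) ^ 2 * (N : ℝ) ^ 5 := by
  obtain ⟨⟨hn1, hnN⟩, hnsq⟩ := mem_nonsquares.mp hn
  set Z := (1 + 4 * |(Δ : ℝ)|) * (N : ℝ) ^ 2 with hZ
  have hZ0 : 0 ≤ Z := by positivity
  have h1 : ∀ n' ∈ nonsquares Δ N,
      |∑ m ∈ Finset.Ioc 0 M, quadChar (disc Δ n) m * quadChar (disc Δ n') m| ≤
      (if IsSquare (disc Δ n * disc Δ n') then (M : ℝ) else 0) + 4 * Z ^ 2 := by
    intro n' hn'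
    obtain ⟨⟨hn1', hnN'⟩, hnsq'⟩ := mem_nonsquares.mp hn'
    simp_rw [← quadChar_mul_left]
    split_ifs with hsq
    · refine (Finset.abs_sum_le_sum_abs _ _).trans ?_
      refine (Finset.sum_le_sum fun a _ => abs_quadChar_le_one _ a).trans ?_
      rw [Finset.sum_const, nsmul_one, Nat.card_Ioc, Nat.sub_zero]
      have := sq_nonneg Z
      linarith
    · have h2 := abs_sum_range_quadChar_le hsq (M + 1)
      have h3 : ∑ m ∈ Finset.Ioc 0 M, quadChar (disc Δ n * disc Δ n') m =
          ∑ m ∈ Finset.range (M + 1), quadChar (disc Δ n * disc Δ n') m := by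
        rw [Finset.range_eq_Ico, ← Finset.Ico_add_one_add_one_eq_Ioc,
          Finset.sum_eq_sum_Ico_succ_bot (Nat.succ_pos M), quadChar_zero_right, zero_add, zero_add,
            Nat.succ_eq_add_one]
      rw [h3, zero_add]
      refine h2.trans ?_
      push_cast
      rw [abs_mul, sq]
      have a1 := abs_disc_le Δ hn1 hnN
      have a2 := abs_disc_le Δ hn1' hnN'
      gcongr
  refine (Finset.sum_le_sum h1).trans ?_
  rw [Finset.sum_add_distrib, Finset.sum_const, ← Finset.sum_filter, Finset.sum_const,
    nsmul_eq_mul, nsmul_eq_mul]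
  have hN1 : 1 ≤ N := hn1.trans hnN
  refine add_le_add ?_ ?_
  · rw [mul_comm]
    refine mul_le_mul_of_nonneg_left ?_ (by positivity)
    have h2 : ((nonsquares Δ N).filter fun n' => IsSquare (disc Δ n * disc Δ n')).card ≤
        (4 * Δ).natAbs ^ 2 * (Nat.log 2 N + 1) := by
      refine (Finset.card_le_card ?_).trans (card_isSquare_mul_le hΔ N hnsq)
      intro n' hn'
      rw [Finset.mem_filter] at hn' ⊢
      exact ⟨(Finset.mem_filter.mp hn'.1).1, hn'.2⟩
    have h3 := natLog_two_add_one_le hN1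
    calc _ ≤ (((4 * Δ).natAbs ^ 2 * (Nat.log 2 N + 1) : ℕ) : ℝ) := by exact_mod_cast h2
      _ = ((4 * Δ).natAbs : ℝ) ^ 2 * ((Nat.log 2 N + 1 : ℕ) : ℝ) := by push_cast; rfl
      _ ≤ _ := by gcongr
  · have h2 : (nonsquares Δ N).card ≤ N := by
      refine (Finset.card_filter_le _ _).trans ?_
      simp
    calc ((nonsquares Δ N).card : ℝ) * (4 * Z ^ 2) ≤ N * (4 * Z ^ 2) := by gcongr
      _ = _ := by rw [hZ]; ring

lemma sum_sq_prodCount_le {ε : ℝ} (hε : 0 < ε) :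
    ∃ K : ℝ, 0 < K ∧ ∀ X Y : ℕ, 1 ≤ X → Y ≤ 2 * X →
      ∑ m ∈ Finset.Ioc 0 (Y ^ 7), ((prodCount 7 (Finset.Ioc X Y) m : ℝ) / m) ^ 2 ≤
        K * (X : ℝ) ^ ε / (X : ℝ) ^ 7 := by
  set δ := ε / 98 with hδ
  obtain ⟨c, hc1, hc⟩ := card_divisors_le_rpow (by positivity : 0 < δ)
  refine ⟨128 * c ^ 14 * (2 : ℝ) ^ ε, by positivity, fun X Y hX hY => ?_⟩
  have hX0 : (0 : ℝ) < X := by exact_mod_cast hX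
  have hY2 : (Y : ℝ) ≤ 2 * X := by exact_mod_cast hY
  have hterm : ∀ m ∈ Finset.Ioc 0 (Y ^ 7),
      ((prodCount 7 (Finset.Ioc X Y) m : ℝ) / m) ^ 2 ≤
        c ^ 14 * (2 : ℝ) ^ ε * (X : ℝ) ^ ε / (X : ℝ) ^ 14 := by
    intro m hm
    rw [Finset.mem_Ioc] at hm
    have hm0 : (0 : ℝ) < m := by exact_mod_cast hm.1
    rcases le_or_gt m (X ^ 7) with hle | hgt
    · rw [prodCount_eq_zero (by norm_num) hle]
      simp only [Nat.cast_zero, zero_div, ne_eq, OfNat.ofNat_ne_zero, not_false_eq_true, zero_pow]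
      positivity
    · have hmX : (X : ℝ) ^ 7 ≤ m := by exact_mod_cast hgt.le
      have hmY : (m : ℝ) ≤ (2 * X) ^ 7 := by
        calc (m : ℝ) ≤ (Y : ℝ) ^ 7 := by exact_mod_cast hm.2
          _ ≤ _ := by gcongr
      have h1 : (prodCount 7 (Finset.Ioc X Y) m : ℝ) ≤ (c * (m : ℝ) ^ δ) ^ 7 := by
        calc (prodCount 7 (Finset.Ioc X Y) m : ℝ) ≤ (m.divisors.card : ℝ) ^ 7 := by
              exact_mod_cast prodCount_le 7 _ hm.1.ne'
          _ ≤ _ := by gcongr; exact hc m hm.1.ne'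
      have h2 : ((m : ℝ) ^ δ) ^ 14 ≤ (2 : ℝ) ^ ε * (X : ℝ) ^ ε := by
        calc ((m : ℝ) ^ δ) ^ 14 ≤ (((2 * X : ℝ) ^ 7) ^ δ) ^ 14 := by gcongr
          _ = (2 * X : ℝ) ^ ε := by
              rw [← Real.rpow_natCast (2 * X : ℝ) 7, ← Real.rpow_mul (by positivity),
                ← Real.rpow_natCast _ 14, ← Real.rpow_mul (by positivity), hδ]
              congr 1
              push_cast
              ring
          _ = _ := Real.mul_rpow (by norm_num) hX0.le
      rw [div_pow, div_le_div_iff₀ (by positivity) (by positivity)]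
      calc (prodCount 7 (Finset.Ioc X Y) m : ℝ) ^ 2 * (X : ℝ) ^ 14 ≤
            ((c * (m : ℝ) ^ δ) ^ 7) ^ 2 * ((X : ℝ) ^ 7) ^ 2 := by
            rw [← pow_mul (X : ℝ)]; gcongr
        _ ≤ ((c * (m : ℝ) ^ δ) ^ 7) ^ 2 * (m : ℝ) ^ 2 := by gcongr
        _ = c ^ 14 * ((m : ℝ) ^ δ) ^ 14 * (m : ℝ) ^ 2 := by ring
        _ ≤ c ^ 14 * ((2 : ℝ) ^ ε * (X : ℝ) ^ ε) * (m : ℝ) ^ 2 := by gcongr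
        _ = _ := by ring
  refine (Finset.sum_le_sum hterm).trans ?_
  rw [Finset.sum_const, nsmul_eq_mul, Nat.card_Ioc, Nat.sub_zero]
  have h1 : ((Y ^ 7 : ℕ) : ℝ) ≤ 128 * (X : ℝ) ^ 7 := by
    push_cast
    calc (Y : ℝ) ^ 7 ≤ (2 * X) ^ 7 := by gcongr
      _ = _ := by ring
  calc _ ≤ 128 * (X : ℝ) ^ 7 * (c ^ 14 * (2 : ℝ) ^ ε * (X : ℝ) ^ ε / (X : ℝ) ^ 14) := by gcongr
    _ = _ := by field_simp

lemma sum_block_pow_le {Δ : ℤ} (hΔ : Δ ≠ 0) {ε : ℝ} (hε : 0 < ε) :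
    ∃ K : ℝ, 0 < K ∧ ∀ N X Y : ℕ, 1 ≤ N → 1 ≤ X → Y ≤ 2 * X →
      ∑ n ∈ nonsquares Δ N, (∑ a ∈ Finset.Ioc X Y, quadChar (disc Δ n) a / a) ^ 14 ≤
        K * (X : ℝ) ^ ε * (1 + 2 * Real.log N + (N : ℝ) ^ 5 / (X : ℝ) ^ 7) := by
  obtain ⟨K, hK, hw⟩ := sum_sq_prodCount_le hε
  set R := ((4 * Δ).natAbs : ℝ) ^ 2 with hR
  set G := 4 * (1 + 4 * |(Δ : ℝ)|) ^ 2 with hG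
  refine ⟨K * (128 * R + G), by positivity, fun N X Y hN hX hY => ?_⟩
  have hX0 : (0 : ℝ) < X := by exact_mod_cast hX
  have hN1 : (1 : ℝ) ≤ N := by exact_mod_cast hN
  have hlog := Real.log_nonneg hN1
  have hY2 : (Y : ℝ) ≤ 2 * X := by exact_mod_cast hY
  have h1 := sum_sq_sum_le_of_gram (nonsquares Δ N) (Finset.Ioc 0 (Y ^ 7))
    (fun m => (prodCount 7 (Finset.Ioc X Y) m : ℝ) / m) (fun n m => quadChar (disc Δ n) m)
    (R := ((Y ^ 7 : ℕ) : ℝ) * (R * (1 + 2 * Real.log N)) + G * (N : ℝ) ^ 5) (by positivity)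
    fun n hn => sum_abs_gram_le hΔ hn _
  have h2 : ∀ n ∈ nonsquares Δ N, (∑ a ∈ Finset.Ioc X Y, quadChar (disc Δ n) a / a) ^ 14 =
      (∑ m ∈ Finset.Ioc 0 (Y ^ 7),
        (prodCount 7 (Finset.Ioc X Y) m : ℝ) / m * quadChar (disc Δ n) m) ^ 2 := by
    intro n _
    have h3 := sum_pow_eq_sum_prodCount (quadHom (disc Δ n)) 7 (Finset.Ioc X Y)
      (Finset.Ioc 0 (Y ^ 7)) ?_
    · rw [show (14 : ℕ) = 7 * 2 from rfl, pow_mul]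
      congr 1
      refine h3.trans (Finset.sum_congr rfl fun m _ => ?_)
      simp only [quadHom, MonoidHom.coe_mk, OneHom.coe_mk]
      ring
    · intro f hf
      rw [Fintype.mem_piFinset] at hf
      rw [Finset.mem_Ioc]
      refine ⟨Finset.prod_pos fun i _ => by have := (Finset.mem_Ioc.mp (hf i)).1; omega, ?_⟩
      calc ∏ i, f i ≤ ∏ _i : Fin 7, Y :=
            Finset.prod_le_prod' fun i _ => (Finset.mem_Ioc.mp (hf i)).2
        _ = Y ^ 7 := by simp
  rw [Finset.sum_congr rfl h2]
  refine h1.trans ?_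
  have h3 : ((Y ^ 7 : ℕ) : ℝ) ≤ 128 * (X : ℝ) ^ 7 := by
    push_cast
    calc (Y : ℝ) ^ 7 ≤ (2 * X) ^ 7 := by gcongr
      _ = _ := by ring
  have hl0 : 0 ≤ 1 + 2 * Real.log N := by linarith
  calc _ ≤ (128 * (X : ℝ) ^ 7 * (R * (1 + 2 * Real.log N)) + G * (N : ℝ) ^ 5) *
        (K * (X : ℝ) ^ ε / (X : ℝ) ^ 7) := by
        refine mul_le_mul ?_ (hw X Y hX hY) (Finset.sum_nonneg fun _ _ => sq_nonneg _)
          (by positivity)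
        gcongr
    _ = K * (X : ℝ) ^ ε * (128 * R * (1 + 2 * Real.log N) + G * ((N : ℝ) ^ 5 / (X : ℝ) ^ 7)) := by
        field_simp
    _ ≤ K * (X : ℝ) ^ ε * ((128 * R + G) * (1 + 2 * Real.log N) +
        (128 * R + G) * ((N : ℝ) ^ 5 / (X : ℝ) ^ 7)) := by
        have : 0 ≤ R := by positivity
        have : 0 ≤ G := by positivity
        gcongr <;> linarith
    _ = _ := by ring

end HighMoment

section TailMoment

/-- Dyadic decomposition of `quadTail E x` combined with the power mean inequality. -/
lemma quadTail_pow_le (E : ℤ) {x Q : ℕ} (hx : 1 ≤ x) (hxQ : x ≤ Q) :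
    quadTail E x ^ 14 ≤ (((Nat.log 2 Q + 1 : ℕ) : ℝ) + 1) ^ 13 *
      (∑ i ∈ Finset.range (Nat.log 2 Q + 1),
        (∑ a ∈ Finset.Ioc (min (2 ^ i * x) Q) (min (2 ^ (i + 1) * x) Q),
          quadChar E a / a) ^ 14 + quadTail E Q ^ 14) := by
  set P : ℕ → ℝ := fun i =>
    ∑ a ∈ Finset.Ioc (min (2 ^ i * x) Q) (min (2 ^ (i + 1) * x) Q), quadChar E a / a with hP
  generalize hJ : Nat.log 2 Q + 1 = J
  set g : ℕ → ℝ := fun i => if i < J then P i else quadTail E Q with hg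
  have e1 : ∀ φ : ℝ → ℝ, ∑ i ∈ Finset.range (J + 1), φ (g i) =
      ∑ i ∈ Finset.range J, φ (P i) + φ (quadTail E Q) := by
    intro φ
    rw [Finset.sum_range_succ]
    congr 1
    · exact Finset.sum_congr rfl fun i hi => by simp only [hg, if_pos (Finset.mem_range.mp hi)]
    · simp [hg]
  have e2 : quadTail E x = ∑ i ∈ Finset.range (J + 1), g i := by
    rw [quadTail_eq_add _ hxQ, sum_Ioc_eq_sum_dyadic _ hx hxQ, hJ]
    exact (e1 id).symm
  have e3 := pow_sum_div_card_le_sum_pow (s := Finset.range (J + 1)) (f := fun i => |g i|)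
    (fun i _ => abs_nonneg _) 13
  rw [Finset.card_range, div_le_iff₀ (by positivity)] at e3
  simp_rw [show (13 + 1 : ℕ) = 14 from rfl, Even.pow_abs (show Even 14 by decide)] at e3
  rw [← e1 fun t => t ^ 14, mul_comm]
  push_cast at e3
  refine le_trans ?_ e3
  rw [e2, ← Even.pow_abs (show Even 14 by decide)]
  gcongr
  exact Finset.abs_sum_le_sum_abs _ _

set_option maxHeartbeats 1000000 in
lemma sum_quadTail_pow_le {Δ : ℤ} (hΔ : Δ ≠ 0) {ε : ℝ} (hε : 0 < ε) :
    ∃ K : ℝ, 0 < K ∧ ∀ N x : ℕ, 1 ≤ N → 1 ≤ x → x ≤ N ^ 3 →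
      ∑ n ∈ nonsquares Δ N, quadTail (disc Δ n) x ^ 14 ≤
        K * (N : ℝ) ^ ε * (1 + (N : ℝ) ^ 5 / (x : ℝ) ^ 7) := by
  obtain ⟨K₀, hK₀, hb⟩ := sum_block_pow_le hΔ (by positivity : 0 < ε / 6)
  set c := (1 + 2 / (ε / 30)) ^ 15 with hc
  set G := (8 * (1 + 4 * |(Δ : ℝ)|)) ^ 14 with hG
  refine ⟨3 ^ 14 * c * (K₀ + G), by positivity, fun N x hN hx hxN => ?_⟩
  have hN1 : (1 : ℝ) ≤ N := by exact_mod_cast hN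
  have hN0 : (0 : ℝ) < N := by linarith
  have hx1 : (1 : ℝ) ≤ x := by exact_mod_cast hx
  set l := 1 + 2 * Real.log N with hl
  have hl1 : 1 ≤ l := by linarith [Real.log_nonneg hN1]
  set Q := N ^ 3 with hQ
  have hQ1 : 1 ≤ Q := Nat.one_le_pow _ _ hN
  set J := Nat.log 2 Q + 1 with hJ
  have hJl : (J : ℝ) + 1 ≤ 3 * l := by
    have h1 := natLog_two_add_one_le hQ1
    rw [hQ, Nat.cast_pow, Real.log_pow] at h1
    rw [hJ, hQ, hl]
    push_cast at h1 ⊢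
    linarith
  have hJ1 : (1 : ℝ) ≤ J := by rw [hJ]; push_cast; linarith [Nat.cast_nonneg (α := ℝ) (Nat.log 2 Q)]
  set F : ℝ := l * (1 + (N : ℝ) ^ 5 / (x : ℝ) ^ 7) with hF
  have hF1 : 1 ≤ F := by
    have : 0 ≤ (N : ℝ) ^ 5 / (x : ℝ) ^ 7 := by positivity
    nlinarith
  have hNe1 : 1 ≤ (N : ℝ) ^ (ε / 2) := Real.one_le_rpow hN1 (by positivity)
  set P : ℕ → ℕ → ℝ := fun i n =>
    ∑ a ∈ Finset.Ioc (min (2 ^ i * x) Q) (min (2 ^ (i + 1) * x) Q), quadChar (disc Δ n) a / a with hP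
  have hblock : ∀ i ∈ Finset.range J, ∑ n ∈ nonsquares Δ N, P i n ^ 14 ≤
      K₀ * (N : ℝ) ^ (ε / 2) * F := by
    intro i _
    have hQi : x ≤ 2 ^ i * x := Nat.le_mul_of_pos_left _ (by positivity)
    have h2 : 2 ^ (i + 1) * x = 2 * (2 ^ i * x) := by ring
    simp only [hP]
    set X := min (2 ^ i * x) Q with hX
    set Y := min (2 ^ (i + 1) * x) Q with hY
    have hX0 : x ≤ X := le_min hQi hxN
    have hY2 : Y ≤ 2 * X := by omega
    have hX1 : X ≤ Q := min_le_right _ _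
    have hXr : (x : ℝ) ≤ X := by exact_mod_cast hX0
    have hXQ : (X : ℝ) ≤ (N : ℝ) ^ 3 := by exact_mod_cast hX1
    refine (hb N X Y hN (hx.trans hX0) hY2).trans ?_
    have e1 : (X : ℝ) ^ (ε / 6) ≤ (N : ℝ) ^ (ε / 2) := by
      calc (X : ℝ) ^ (ε / 6) ≤ ((N : ℝ) ^ 3) ^ (ε / 6) :=
            Real.rpow_le_rpow (by positivity) hXQ (by positivity)
        _ = _ := by
            rw [← Real.rpow_natCast, ← Real.rpow_mul hN0.le]
            congr 1; push_cast; ring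
    have e2 : (N : ℝ) ^ 5 / (X : ℝ) ^ 7 ≤ (N : ℝ) ^ 5 / (x : ℝ) ^ 7 := by gcongr
    have e3 : 0 ≤ (N : ℝ) ^ 5 / (x : ℝ) ^ 7 := by positivity
    have e4 : 0 ≤ (N : ℝ) ^ 5 / (X : ℝ) ^ 7 := by positivity
    refine mul_le_mul (by gcongr) ?_ (by linarith) (by positivity)
    rw [hF]
    nlinarith
  have htail : ∑ n ∈ nonsquares Δ N, quadTail (disc Δ n) Q ^ 14 ≤ G * (N : ℝ) ^ (ε / 2) * F := by
    have h1 : ∀ n ∈ nonsquares Δ N, quadTail (disc Δ n) Q ^ 14 ≤ G * (N : ℝ)⁻¹ := by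
      intro n hn
      obtain ⟨⟨hn1, hnN⟩, hsq⟩ := mem_nonsquares.mp hn
      have h2 : |quadTail (disc Δ n) Q| ≤ 8 * (1 + 4 * |(Δ : ℝ)|) * (N : ℝ)⁻¹ := by
        refine (abs_quadTail_le hsq Q).trans ?_
        rw [div_le_iff₀ (by positivity), hQ]
        push_cast
        have h3 := abs_disc_le Δ hn1 hnN
        calc 8 * |(disc Δ n : ℝ)| ≤ 8 * ((1 + 4 * |(Δ : ℝ)|) * (N : ℝ) ^ 2) := by gcongr
          _ = 8 * (1 + 4 * |(Δ : ℝ)|) * (N : ℝ)⁻¹ * (N : ℝ) ^ 3 := by field_simp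
          _ ≤ _ := by gcongr; linarith
      calc quadTail (disc Δ n) Q ^ 14 = |quadTail (disc Δ n) Q| ^ 14 :=
            (Even.pow_abs (by decide) _).symm
        _ ≤ (8 * (1 + 4 * |(Δ : ℝ)|) * (N : ℝ)⁻¹) ^ 14 := by gcongr
        _ = G * (N : ℝ)⁻¹ ^ 14 := by rw [mul_pow]
        _ ≤ G * (N : ℝ)⁻¹ := by
            gcongr
            exact pow_le_of_le_one (by positivity) (inv_le_one_of_one_le₀ hN1) (by norm_num)
    refine (Finset.sum_le_sum h1).trans ?_
    rw [Finset.sum_const, nsmul_eq_mul]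
    have h2 : ((nonsquares Δ N).card : ℝ) ≤ N := by
      have : (nonsquares Δ N).card ≤ N := (Finset.card_filter_le _ _).trans (by simp)
      exact_mod_cast this
    calc _ ≤ (N : ℝ) * (G * (N : ℝ)⁻¹) := by gcongr
      _ = G := by field_simp
      _ ≤ G * (N : ℝ) ^ (ε / 2) * F := by
          rw [mul_assoc]
          exact le_mul_of_one_le_right (by positivity) (one_le_mul_of_one_le_of_one_le hNe1 hF1)
  have hpm : ∀ n ∈ nonsquares Δ N, quadTail (disc Δ n) x ^ 14 ≤
      ((J : ℝ) + 1) ^ 13 * (∑ i ∈ Finset.range J, P i n ^ 14 + quadTail (disc Δ n) Q ^ 14) :=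
    fun n _ => quadTail_pow_le (disc Δ n) hx hxN
  refine (Finset.sum_le_sum hpm).trans ?_
  rw [← Finset.mul_sum, Finset.sum_add_distrib, Finset.sum_comm]
  have hs := Finset.sum_le_sum hblock
  rw [Finset.sum_const, Finset.card_range, nsmul_eq_mul] at hs
  have hl15 : l ^ 15 ≤ c * (N : ℝ) ^ (ε / 2) := by
    have h1 := one_add_log_le_rpow (x := (N : ℝ)) (by positivity : 0 < ε / 30) hN1
    calc l ^ 15 ≤ ((1 + 2 / (ε / 30)) * (N : ℝ) ^ (ε / 30)) ^ 15 :=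
          pow_le_pow_left₀ (by linarith) h1 15
      _ = _ := by
          rw [mul_pow, ← Real.rpow_natCast ((N : ℝ) ^ (ε / 30)) 15, ← Real.rpow_mul hN0.le]
          congr 2
          push_cast
          ring
  set U := (N : ℝ) ^ (ε / 2) with hU
  have hUU : U * U = (N : ℝ) ^ ε := by
    rw [hU, ← Real.rpow_add hN0]; congr 1; ring
  calc _ ≤ ((J : ℝ) + 1) ^ 13 * (J * (K₀ * U * F) + G * U * F) := by gcongr
    _ ≤ ((J : ℝ) + 1) ^ 13 * (((J : ℝ) + 1) * (K₀ * U * F) + ((J : ℝ) + 1) * (G * U * F)) := by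
        have h1 : 0 ≤ K₀ * U * F := by positivity
        have h2 : 0 ≤ (J : ℝ) * (G * U * F) := by positivity
        refine mul_le_mul_of_nonneg_left ?_ (by positivity)
        rw [add_mul, add_mul, one_mul, one_mul]
        linarith
    _ = ((J : ℝ) + 1) ^ 14 * ((K₀ + G) * U * F) := by ring
    _ ≤ (3 * l) ^ 14 * ((K₀ + G) * U * F) := by gcongr
    _ = 3 ^ 14 * (K₀ + G) * U * (l ^ 15 * (1 + (N : ℝ) ^ 5 / (x : ℝ) ^ 7)) := by rw [hF]; ring
    _ ≤ 3 ^ 14 * (K₀ + G) * U * (c * U * (1 + (N : ℝ) ^ 5 / (x : ℝ) ^ 7)) := by gcongr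
    _ = 3 ^ 14 * c * (K₀ + G) * (U * U) * (1 + (N : ℝ) ^ 5 / (x : ℝ) ^ 7) := by ring
    _ = _ := by rw [hUU]

lemma card_quadTail_ge_le {Δ : ℤ} (hΔ : Δ ≠ 0) {ε : ℝ} (hε : 0 < ε) :
    ∃ K : ℝ, 0 < K ∧ ∀ N x : ℕ, 1 ≤ N → 1 ≤ x → x ≤ N ^ 3 → ∀ t : ℝ, 0 < t →
      (((nonsquares Δ N).filter fun n => t ≤ |quadTail (disc Δ n) x|).card : ℝ) ≤
        K * (N : ℝ) ^ ε * (1 + (N : ℝ) ^ 5 / (x : ℝ) ^ 7) / t ^ 14 := by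
  obtain ⟨K, hK, h⟩ := sum_quadTail_pow_le hΔ hε
  refine ⟨K, hK, fun N x hN hx hxN t ht => ?_⟩
  rw [le_div_iff₀ (by positivity), ← nsmul_eq_mul]
  refine le_trans ?_ (h N x hN hx hxN)
  refine (Finset.card_nsmul_le_sum _ (fun n => quadTail (disc Δ n) x ^ 14) _ fun n hn => ?_).trans
    (Finset.sum_le_sum_of_subset_of_nonneg (Finset.filter_subset _ _)
      fun _ _ _ => (by decide : Even 14).pow_nonneg _)
  rw [← Even.pow_abs (show Even 14 by decide) (quadTail (disc Δ n) x)]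
  have := (Finset.mem_filter.mp hn).2
  gcongr

end TailMoment

section Correction

open ArithmeticFunction (moebius)

/-- The arithmetic function `q ↦ (E | q) / q` (supported on odd `q`). -/
noncomputable def quadArith (E : ℤ) : ArithmeticFunction ℝ := ⟨fun q => quadChar E q / q, by simp⟩

/-- The singular series terms at `n` as an arithmetic function. -/
noncomputable def singArith (A B C D n : ℤ) : ArithmeticFunction ℝ :=
  ⟨fun q => singSeriesTerm A B C D q n, by simp [singSeriesTerm]⟩

/-- The Dirichlet quotient of the singular series terms at `n` by `quadArith (n² - 4Δ)`. -/
noncomputable def corrArith (A B C D n : ℤ) : ArithmeticFunction ℝ :=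
  singArith A B C D n *
    ((moebius : ArithmeticFunction ℝ).pmul (quadArith (n ^ 2 - 4 * (A * D - B * C))))

lemma quadArith_apply (E : ℤ) (q : ℕ) : quadArith E q = quadChar E q / q := rfl

lemma singArith_apply (A B C D n : ℤ) (q : ℕ) :
    singArith A B C D n q = singSeriesTerm A B C D q n := rfl

lemma quadArith_mul (E : ℤ) (a b : ℕ) : quadArith E (a * b) = quadArith E a * quadArith E b := by
  rcases Nat.eq_zero_or_pos a with rfl | ha
  · simp
  rcases Nat.eq_zero_or_pos b with rfl | hb
  · simp
  rw [quadArith_apply, quadArith_apply, quadArith_apply, quadChar_mul_right]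
  push_cast
  field_simp

lemma abs_quadArith_le (E : ℤ) (q : ℕ) : |quadArith E q| ≤ 1 / q := by
  rw [quadArith_apply, abs_div, Nat.abs_cast]
  gcongr
  exact abs_quadChar_le_one E q

lemma isMultiplicative_quadArith (E : ℤ) : (quadArith E).IsMultiplicative :=
  ⟨by simp [quadArith_apply], fun _ => quadArith_mul E _ _⟩

lemma isMultiplicative_singArith (A B C D n : ℤ) : (singArith A B C D n).IsMultiplicative :=
  ⟨singSeriesTerm_one A B C D n, fun h => singSeriesTerm_mul A B C D h n⟩

lemma isMultiplicative_corrArith (A B C D n : ℤ) : (corrArith A B C D n).IsMultiplicative :=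
  (isMultiplicative_singArith A B C D n).mul
    (ArithmeticFunction.isMultiplicative_moebius.intCast.pmul (isMultiplicative_quadArith _))

lemma moebius_pmul_quadArith_mul (E : ℤ) :
    (moebius : ArithmeticFunction ℝ).pmul (quadArith E) * quadArith E = 1 := by
  ext m
  have h : ((moebius : ArithmeticFunction ℝ).pmul (quadArith E) * quadArith E) m =
      ((moebius : ArithmeticFunction ℝ) * (ArithmeticFunction.zeta : ArithmeticFunction ℝ)) m *
        quadArith E m := by
    rw [ArithmeticFunction.mul_apply, ArithmeticFunction.mul_apply, Finset.sum_mul]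
    refine Finset.sum_congr rfl fun x hx => ?_
    obtain ⟨h1, h2⟩ := Nat.mem_divisorsAntidiagonal.mp hx
    have h3 : x.2 ≠ 0 := by rintro h; simp [h] at h1; exact h2 h1.symm
    rw [← h1, quadArith_mul, ArithmeticFunction.pmul_apply,
      ArithmeticFunction.natCoe_apply, ArithmeticFunction.zeta_apply_ne h3]
    push_cast
    ring
  rw [h, ArithmeticFunction.coe_moebius_mul_coe_zeta, ArithmeticFunction.one_apply]
  split_ifs with hm
  · subst hm; simp [quadArith_apply]
  · simp

lemma corrArith_mul_quadArith (A B C D n : ℤ) :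
    corrArith A B C D n * quadArith (n ^ 2 - 4 * (A * D - B * C)) = singArith A B C D n := by
  rw [corrArith, mul_assoc, moebius_pmul_quadArith_mul, mul_one]

lemma corrArith_prime_pow (A B C D n : ℤ) {p : ℕ} (hp : p.Prime) (k : ℕ) :
    corrArith A B C D n (p ^ (k + 1)) = singArith A B C D n (p ^ (k + 1)) -
      quadArith (n ^ 2 - 4 * (A * D - B * C)) p * singArith A B C D n (p ^ k) := by
  set g := (moebius : ArithmeticFunction ℝ).pmul (quadArith (n ^ 2 - 4 * (A * D - B * C))) with hg
  rw [corrArith, ArithmeticFunction.mul_apply,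
    Nat.sum_divisorsAntidiagonal (f := fun a b => singArith A B C D n a * g b),
    Nat.sum_divisors_prime_pow hp, Finset.sum_range_succ, Finset.sum_range_succ,
    Finset.sum_eq_zero]
  · have h1 : p ^ (k + 1) / p ^ k = p := by
      rw [pow_succ]; exact Nat.mul_div_cancel_left _ (pow_pos hp.pos k)
    rw [h1, Nat.div_self (pow_pos hp.pos _)]
    simp only [hg, ArithmeticFunction.pmul_apply, ArithmeticFunction.intCoe_apply,
      ArithmeticFunction.moebius_apply_prime hp, ArithmeticFunction.moebius_apply_one,
      (isMultiplicative_quadArith _).1]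
    push_cast
    ring
  · intro i hi
    have hi' := Finset.mem_range.mp hi
    rw [Nat.pow_div (by omega) hp.pos]
    have h2 : moebius (p ^ (k + 1 - i)) = 0 := by
      rw [ArithmeticFunction.moebius_apply_prime_pow hp (by omega), if_neg (by omega)]
    simp [hg, ArithmeticFunction.pmul_apply, ArithmeticFunction.intCoe_apply, h2]

lemma abs_singArith_prime_pow_le {A B C D : ℤ}
    (hgcd : Int.gcd A (Int.gcd B (Int.gcd C D)) = 1) (hΔ0 : A * D - B * C ≠ 0) (n : ℤ)
    {p : ℕ} (hp : p.Prime) (k : ℕ) :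
    |singArith A B C D n (p ^ k)| * (p : ℝ) ^ ((k + 1) / 2) ≤ localC A B C D := by
  have : Fact p.Prime := ⟨hp⟩
  have : NeZero (p ^ k) := ⟨(pow_pos hp.pos _).ne'⟩
  rcases k with _ | k
  · rw [pow_zero, (isMultiplicative_singArith A B C D n).1, localC]
    have h1 : (1 : ℤ) ≤ (A * D - B * C) ^ 2 := by
      have := sq_pos_of_ne_zero hΔ0; omega
    have h2 : (1 : ℝ) ≤ ((A * D - B * C : ℤ) : ℝ) ^ 2 := by exact_mod_cast h1
    norm_num
    push_cast at h2
    linarith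
  · rw [singArith_apply, abs_singSeriesTerm]
    exact norm_cterm_prime_pow_le rfl hgcd hΔ0 _

lemma abs_corrArith_prime_pow_le {A B C D : ℤ}
    (hgcd : Int.gcd A (Int.gcd B (Int.gcd C D)) = 1) (hΔ0 : A * D - B * C ≠ 0) (n : ℤ)
    {p : ℕ} (hp : p.Prime) (k : ℕ) :
    |corrArith A B C D n (p ^ (k + 1))| * (p : ℝ) ^ ((k + 2) / 2) ≤ 2 * localC A B C D := by
  have hp0 : (0 : ℝ) < p := by exact_mod_cast hp.pos
  have hp1 : (1 : ℝ) ≤ p := by exact_mod_cast hp.one_le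
  have h1 := abs_singArith_prime_pow_le hgcd hΔ0 n hp (k + 1)
  have h2 := abs_singArith_prime_pow_le hgcd hΔ0 n hp k
  have h3 := abs_quadArith_le (n ^ 2 - 4 * (A * D - B * C)) p
  rw [corrArith_prime_pow A B C D n hp]
  set s := singArith A B C D n (p ^ (k + 1))
  set s' := singArith A B C D n (p ^ k)
  set χ := quadArith (n ^ 2 - 4 * (A * D - B * C)) p
  have h4 : (p : ℝ) ^ ((k + 2) / 2) ≤ p * (p : ℝ) ^ ((k + 1) / 2) := by
    rw [← pow_succ']
    exact pow_le_pow_right₀ hp1 (by omega)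
  calc |s - χ * s'| * (p : ℝ) ^ ((k + 2) / 2)
      ≤ (|s| + |χ| * |s'|) * (p : ℝ) ^ ((k + 2) / 2) := by
        gcongr
        rw [← abs_mul]
        exact abs_sub _ _
    _ = |s| * (p : ℝ) ^ ((k + 2) / 2) + |χ| * |s'| * (p : ℝ) ^ ((k + 2) / 2) := by ring
    _ ≤ localC A B C D + 1 / p * |s'| * (p * (p : ℝ) ^ ((k + 1) / 2)) := by gcongr
    _ = localC A B C D + |s'| * (p : ℝ) ^ ((k + 1) / 2) := by field_simp
    _ ≤ _ := by linarith

end Correction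

section CorrectionSum

open ArithmeticFunction (moebius)

lemma singArith_prime {A B C D : ℤ} (hgcd : Int.gcd A (Int.gcd B (Int.gcd C D)) = 1) (n : ℤ)
    {p : ℕ} (hp : p.Prime) (hp2 : p ≠ 2) (hΔ : ¬ (p : ℤ) ∣ A * D - B * C) :
    singArith A B C D n p =
      (p * quadChar (n ^ 2 - 4 * (A * D - B * C)) p + 1) / ((p : ℝ) ^ 2 - 1) := by
  have : Fact p.Prime := ⟨hp⟩
  have : NeZero p := ⟨hp.ne_zero⟩
  have h := cterm_prime hp2 hgcd n hΔ
  rw [← singSeriesTerm_eq_cterm, jacobiSym.legendreSym.to_jacobiSym] at h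
  rw [singArith_apply, quadChar_of_odd _ (hp.odd_of_ne_two hp2)]
  exact_mod_cast h

lemma singArith_prime_pow_eq_zero {A B C D : ℤ}
    (hgcd : Int.gcd A (Int.gcd B (Int.gcd C D)) = 1) {n : ℤ}
    {p : ℕ} (hp : p.Prime) (hΔ : ¬ (p : ℤ) ∣ A * D - B * C)
    (hD : ¬ (p : ℤ) ∣ n ^ 2 - 4 * (A * D - B * C)) (k : ℕ) :
    singArith A B C D n (p ^ (k + 2)) = 0 := by
  have : Fact p.Prime := ⟨hp⟩
  have : NeZero (p ^ (k + 2)) := ⟨(pow_pos hp.pos _).ne'⟩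
  have h := cterm_eq_zero (q := p ^ (k + 2)) (K := k + 1) rfl (by omega) hgcd hΔ hD
  rw [← singSeriesTerm_eq_cterm] at h
  exact_mod_cast h

/-- Away from `2Δ(n² - 4Δ)` the correction factor lives on `1, p, p²` and is `O(p⁻²)` there. -/
lemma corrArith_of_not_dvd {A B C D : ℤ}
    (hgcd : Int.gcd A (Int.gcd B (Int.gcd C D)) = 1) {n : ℤ} {p : ℕ} (hp : p.Prime) (hp2 : p ≠ 2)
    (hΔ : ¬ (p : ℤ) ∣ A * D - B * C) (hD : ¬ (p : ℤ) ∣ n ^ 2 - 4 * (A * D - B * C)) :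
    |corrArith A B C D n p| ≤ 2 / (p : ℝ) ^ 2 ∧ |corrArith A B C D n (p ^ 2)| ≤ 2 / (p : ℝ) ^ 2 ∧
      ∀ k, corrArith A B C D n (p ^ (k + 3)) = 0 := by
  have hp3 : (3 : ℝ) ≤ p := by
    have := hp.two_le
    exact_mod_cast (by omega : 3 ≤ p)
  have h1 := corrArith_prime_pow A B C D n hp 0
  have h2 := corrArith_prime_pow A B C D n hp 1
  have h3 : singArith A B C D n (p ^ 2) = 0 := singArith_prime_pow_eq_zero hgcd hp hΔ hD 0
  rw [zero_add, pow_one, pow_zero, (isMultiplicative_singArith A B C D n).1, mul_one] at h1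
  rw [one_add_one_eq_two, pow_one, h3, zero_sub] at h2
  rw [h1, h2, abs_neg, abs_mul, singArith_prime hgcd n hp hp2 hΔ, quadArith_apply]
  set ψ := quadChar (n ^ 2 - 4 * (A * D - B * C)) p
  have hψ : |ψ| ≤ 1 := abs_quadChar_le_one _ _
  obtain ⟨hψ1, hψ2⟩ := abs_le.mp hψ
  have e0 : (0 : ℝ) < (p : ℝ) ^ 2 - 1 := by nlinarith
  have e1 : |ψ / p| ≤ 1 / p := by
    rw [abs_div, Nat.abs_cast]; gcongr
  have e2 : |((p : ℝ) * ψ + 1) / ((p : ℝ) ^ 2 - 1)| ≤ 2 / (p : ℝ) := by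
    rw [abs_div, abs_of_pos e0, div_le_div_iff₀ e0 (by linarith)]
    have : |(p : ℝ) * ψ + 1| ≤ p + 1 := by
      rw [abs_le]; constructor <;> nlinarith
    nlinarith
  refine ⟨?_, ?_, fun k => ?_⟩
  · have e3 : ((p : ℝ) * ψ + 1) / ((p : ℝ) ^ 2 - 1) - ψ / p = (p + ψ) / (p * ((p : ℝ) ^ 2 - 1)) := by
      field_simp
      ring
    rw [e3, abs_div, abs_of_pos (by positivity : 0 < p * ((p : ℝ) ^ 2 - 1)),
      abs_of_nonneg (by linarith), div_le_div_iff₀ (by positivity) (by positivity)]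
    nlinarith [mul_nonneg (by linarith : (0 : ℝ) ≤ p) (by nlinarith : (0 : ℝ) ≤ (p : ℝ) - 3),
      mul_nonneg (by positivity : (0 : ℝ) ≤ (p : ℝ) ^ 2) (by linarith : 0 ≤ 1 - ψ),
      mul_nonneg (by positivity : (0 : ℝ) ≤ (p : ℝ) ^ 2) (by linarith : (0 : ℝ) ≤ (p : ℝ) - 3)]
  · calc _ ≤ 1 / (p : ℝ) * (2 / p) := by gcongr
      _ = _ := by ring
  · rw [corrArith_prime_pow A B C D n hp (k + 2), singArith_prime_pow_eq_zero hgcd hp hΔ hD k,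
      singArith_prime_pow_eq_zero hgcd hp hΔ hD (k + 1)]
    ring

/-- The ratio of the geometric series dominating the correction factor at every prime. -/
noncomputable def corrRatio : ℝ := 2 ^ (-(1 / 6) : ℝ)

lemma corrRatio_pos : 0 < corrRatio := by unfold corrRatio; positivity

lemma corrRatio_lt_one : corrRatio < 1 :=
  Real.rpow_lt_one_of_one_lt_of_neg (by norm_num) (by norm_num)

/-- The bound for the local sum of the correction factor at an exceptional prime. -/
noncomputable def corrBound (A B C D : ℤ) : ℝ := 2 * localC A B C D * (1 - corrRatio)⁻¹

lemma one_le_localC {A B C D : ℤ} (hΔ0 : A * D - B * C ≠ 0) : 1 ≤ localC A B C D := by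
  have h1 : (1 : ℤ) ≤ (A * D - B * C) ^ 2 := by
    have := sq_pos_of_ne_zero hΔ0; omega
  have h2 : (1 : ℝ) ≤ ((A * D - B * C : ℤ) : ℝ) ^ 2 := by exact_mod_cast h1
  rw [localC]
  linarith

lemma corrBound_nonneg (A B C D : ℤ) : 0 ≤ corrBound A B C D := by
  have h := corrRatio_lt_one
  have h1 : 0 ≤ localC A B C D := by unfold localC; positivity
  have h2 : 0 ≤ (1 - corrRatio)⁻¹ := inv_nonneg.mpr (by linarith)
  unfold corrBound
  positivity

lemma abs_corrArith_mul_rpow_le {A B C D : ℤ}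
    (hgcd : Int.gcd A (Int.gcd B (Int.gcd C D)) = 1) (hΔ0 : A * D - B * C ≠ 0) (n : ℤ)
    {p : ℕ} (hp : p.Prime) (k : ℕ) :
    |corrArith A B C D n (p ^ k)| * ((p ^ k : ℕ) : ℝ) ^ (1 / 3 : ℝ) ≤
      2 * localC A B C D * corrRatio ^ k := by
  have hp0 : (0 : ℝ) < p := by exact_mod_cast hp.pos
  have hp2 : (2 : ℝ) ≤ p := by exact_mod_cast hp.two_le
  rcases k with _ | k
  · rw [pow_zero, (isMultiplicative_corrArith A B C D n).1]
    norm_num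
    linarith [one_le_localC hΔ0]
  have h1 := abs_corrArith_prime_pow_le hgcd hΔ0 n hp k
  have h2 : ((p ^ (k + 1) : ℕ) : ℝ) ^ (1 / 3 : ℝ) ≤
      (p : ℝ) ^ ((k + 2) / 2) * corrRatio ^ (k + 1) := by
    have e1 : corrRatio ^ (k + 1) = (2 : ℝ) ^ (-((k + 1 : ℝ) / 6)) := by
      rw [corrRatio, ← Real.rpow_natCast, ← Real.rpow_mul (by norm_num)]
      congr 1; push_cast; ring
    have e2 : (p : ℝ) ^ (-((k + 1 : ℝ) / 6)) ≤ (2 : ℝ) ^ (-((k + 1 : ℝ) / 6)) :=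
      Real.rpow_le_rpow_of_nonpos (by norm_num) hp2 (by
        have : (0 : ℝ) ≤ k := Nat.cast_nonneg k
        linarith)
    rw [e1]
    refine le_trans ?_ (mul_le_mul_of_nonneg_left e2 (by positivity))
    rw [← Real.rpow_natCast (p : ℝ) ((k + 2) / 2), ← Real.rpow_add hp0, Nat.cast_pow,
      ← Real.rpow_natCast (p : ℝ) (k + 1), ← Real.rpow_mul hp0.le]
    refine Real.rpow_le_rpow_of_exponent_le (by linarith) ?_
    have e3 : k + 1 ≤ 2 * ((k + 2) / 2) := by omega
    have e4 : (k + 1 : ℝ) ≤ 2 * (((k + 2) / 2 : ℕ) : ℝ) := by exact_mod_cast e3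
    push_cast at e4 ⊢
    linarith
  calc _ ≤ |corrArith A B C D n (p ^ (k + 1))| *
        ((p : ℝ) ^ ((k + 2) / 2) * corrRatio ^ (k + 1)) := by gcongr
    _ = |corrArith A B C D n (p ^ (k + 1))| * (p : ℝ) ^ ((k + 2) / 2) * corrRatio ^ (k + 1) := by
        ring
    _ ≤ _ := mul_le_mul_of_nonneg_right h1 (pow_nonneg corrRatio_pos.le _)

lemma summable_corrArith_prime_pow {A B C D : ℤ}
    (hgcd : Int.gcd A (Int.gcd B (Int.gcd C D)) = 1) (hΔ0 : A * D - B * C ≠ 0) (n : ℤ)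
    {p : ℕ} (hp : p.Prime) :
    Summable (fun k => |corrArith A B C D n (p ^ k)| * ((p ^ k : ℕ) : ℝ) ^ (1 / 3 : ℝ)) ∧
    ∑' k, |corrArith A B C D n (p ^ k)| * ((p ^ k : ℕ) : ℝ) ^ (1 / 3 : ℝ) ≤ corrBound A B C D := by
  have h1 := (summable_geometric_of_lt_one corrRatio_pos.le corrRatio_lt_one).mul_left
    (2 * localC A B C D)
  have h2 := Summable.of_nonneg_of_le (fun k => by positivity)
    (abs_corrArith_mul_rpow_le hgcd hΔ0 n hp) h1
  refine ⟨h2, (h2.tsum_le_tsum (abs_corrArith_mul_rpow_le hgcd hΔ0 n hp) h1).trans_eq ?_⟩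
  rw [tsum_mul_left, tsum_geometric_of_lt_one corrRatio_pos.le corrRatio_lt_one, corrBound]

lemma tsum_corrArith_prime_pow_le {A B C D : ℤ}
    (hgcd : Int.gcd A (Int.gcd B (Int.gcd C D)) = 1) {n : ℤ} {p : ℕ} (hp : p.Prime) (hp2 : p ≠ 2)
    (hΔ : ¬ (p : ℤ) ∣ A * D - B * C) (hD : ¬ (p : ℤ) ∣ n ^ 2 - 4 * (A * D - B * C)) :
    ∑' k, |corrArith A B C D n (p ^ k)| * ((p ^ k : ℕ) : ℝ) ^ (1 / 3 : ℝ) ≤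
      1 + 4 * (p : ℝ) ^ (-(4 / 3) : ℝ) := by
  have hp0 : (0 : ℝ) < p := by exact_mod_cast hp.pos
  have hp1 : (1 : ℝ) ≤ p := by exact_mod_cast hp.one_le
  obtain ⟨h1, h2, h3⟩ := corrArith_of_not_dvd hgcd hp hp2 hΔ hD
  rw [tsum_eq_sum (s := Finset.range 3) fun k hk => ?_]
  · have e0 : 2 / (p : ℝ) ^ 2 = 2 * (p : ℝ) ^ (-2 : ℝ) := by
      rw [Real.rpow_neg hp0.le, ← div_eq_mul_inv]
      norm_cast
    have e1 : 2 / (p : ℝ) ^ 2 * (p : ℝ) ^ (1 / 3 : ℝ) ≤ 2 * (p : ℝ) ^ (-(4 / 3) : ℝ) := by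
      rw [e0, mul_assoc, ← Real.rpow_add hp0]
      gcongr
      norm_num
    have e2 : 2 / (p : ℝ) ^ 2 * ((p : ℝ) ^ 2) ^ (1 / 3 : ℝ) = 2 * (p : ℝ) ^ (-(4 / 3) : ℝ) := by
      rw [e0, mul_assoc, ← Real.rpow_natCast (p : ℝ) 2, ← Real.rpow_mul hp0.le,
        ← Real.rpow_add hp0]
      norm_num
    rw [Finset.sum_range_succ, Finset.sum_range_succ, Finset.sum_range_one, pow_zero, pow_one,
      (isMultiplicative_corrArith A B C D n).1]
    push_cast
    have e3 : |corrArith A B C D n p| * (p : ℝ) ^ (1 / 3 : ℝ) ≤ _ :=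
      (mul_le_mul_of_nonneg_right h1 (by positivity)).trans e1
    have e4 : |corrArith A B C D n (p ^ 2)| * ((p : ℝ) ^ 2) ^ (1 / 3 : ℝ) ≤ _ :=
      (mul_le_mul_of_nonneg_right h2 (by positivity)).trans_eq e2
    rw [abs_one, Real.one_rpow, one_mul]
    linarith
  · obtain ⟨j, rfl⟩ : ∃ j, k = j + 3 := ⟨k - 3, by simp at hk; omega⟩
    rw [h3 j]
    simp

/-- The weighted absolute sum of the correction factor. -/
lemma exists_tsum_corrArith_le {A B C D : ℤ}
    (hgcd : Int.gcd A (Int.gcd B (Int.gcd C D)) = 1) (hΔ0 : A * D - B * C ≠ 0) :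
    ∃ c : ℝ, 0 < c ∧ ∀ n : ℤ, n ^ 2 - 4 * (A * D - B * C) ≠ 0 →
      Summable (fun b : ℕ => |corrArith A B C D n b| * (b : ℝ) ^ (1 / 3 : ℝ)) ∧
      ∑' b : ℕ, |corrArith A B C D n b| * (b : ℝ) ^ (1 / 3 : ℝ) ≤
        c * (1 + corrBound A B C D) ^ (2 * (A * D - B * C) *
          (n ^ 2 - 4 * (A * D - B * C))).natAbs.primeFactors.card := by
  set v : ℕ → ℝ := fun p => 4 * (p : ℝ) ^ (-(4 / 3) : ℝ) with hv
  have hv0 : ∀ p, 0 ≤ v p := fun p => by positivity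
  have hvs : Summable v := (Real.summable_nat_rpow.mpr (by norm_num)).mul_left 4
  have hB := corrBound_nonneg A B C D
  refine ⟨Real.exp (∑' p, v p), Real.exp_pos _, fun n hn => ?_⟩
  generalize hF : (2 * (A * D - B * C) * (n ^ 2 - 4 * (A * D - B * C))).natAbs = F
  have hF0 : F ≠ 0 := by
    rw [← hF, Int.natAbs_ne_zero]
    exact mul_ne_zero (mul_ne_zero two_ne_zero hΔ0) hn
  have hmult := isMultiplicative_corrArith A B C D n
  set f : ℕ → ℝ := fun b => |corrArith A B C D n b| * (b : ℝ) ^ (1 / 3 : ℝ) with hf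
  have hf0 : f 0 = 0 := by rw [hf]; simp
  have hf1 : f 1 = 1 := by rw [hf]; simp [hmult.1]
  refine summable_of_multiplicative (f := f)
    (u := fun p => v p + if p ∣ F then corrBound A B C D else 0)
    (fun b => mul_nonneg (abs_nonneg _) (Real.rpow_nonneg (Nat.cast_nonneg b) _)) hf0 hf1 ?_
    (fun hp => (summable_corrArith_prime_pow hgcd hΔ0 n hp).1) ?_ ?_
  · intro a b hab
    simp only [hf]
    rw [hmult.2 hab, abs_mul, Nat.cast_mul, Real.mul_rpow (by positivity) (by positivity)]
    ring
  · intro p hp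
    by_cases hpF : p ∣ F
    · rw [if_pos hpF]
      linarith [(summable_corrArith_prime_pow hgcd hΔ0 n hp).2, hv0 p]
    · rw [if_neg hpF, add_zero]
      have h1 : ¬ (p : ℤ) ∣ 2 * (A * D - B * C) * (n ^ 2 - 4 * (A * D - B * C)) := by
        rwa [← hF, ← Int.natCast_dvd] at hpF
      refine tsum_corrArith_prime_pow_le hgcd hp ?_ ?_ ?_
      · rintro rfl
        exact h1 (Dvd.dvd.mul_right (Dvd.intro _ rfl) _)
      · exact fun h => h1 (Dvd.dvd.mul_right (Dvd.dvd.mul_left h _) _)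
      · exact fun h => h1 (Dvd.dvd.mul_left h _)
  · intro s hs
    calc ∏ p ∈ s, (1 + (v p + if p ∣ F then corrBound A B C D else 0))
        ≤ ∏ p ∈ s, ((1 + v p) * if p ∣ F then 1 + corrBound A B C D else 1) := by
          refine Finset.prod_le_prod (fun p _ => ?_) fun p _ => ?_
          · have := hv0 p
            split_ifs <;> linarith
          · have := mul_nonneg (hv0 p) hB
            split_ifs <;> linarith
      _ = (∏ p ∈ s, (1 + v p)) * (1 + corrBound A B C D) ^ (s.filter (· ∣ F)).card := by
          rw [Finset.prod_mul_distrib, ← Finset.prod_filter, Finset.prod_const]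
      _ ≤ _ := by
          gcongr
          · exact prod_one_add_le_exp hv0 hvs s
          · linarith
          · intro p hp
            obtain ⟨h1, h2⟩ := Finset.mem_filter.mp hp
            exact Nat.mem_primeFactors.mpr ⟨hs p h1, h2, hF0⟩

end CorrectionSum

section Limit

variable {A B C D : ℤ}

lemma sum_singArith_eq (A B C D n : ℤ) (X : ℕ) :
    ∑ q ∈ Finset.Ioc 0 X, singArith A B C D n q =
      ∑ b ∈ Finset.Ioc 0 X, corrArith A B C D n b *
        (quadLim (n ^ 2 - 4 * (A * D - B * C)) -
          quadTail (n ^ 2 - 4 * (A * D - B * C)) (X / b)) := by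
  rw [← corrArith_mul_quadArith, ArithmeticFunction.sum_Ioc_mul_eq_sum_sum]
  refine Finset.sum_congr rfl fun b _ => ?_
  rw [quadTail, sub_sub_cancel]
  rfl

lemma abs_corrArith_le_mul_rpow (A B C D n : ℤ) (b : ℕ) :
    |corrArith A B C D n b| ≤ |corrArith A B C D n b| * (b : ℝ) ^ (1 / 3 : ℝ) := by
  rcases Nat.eq_zero_or_pos b with rfl | hb
  · simp
  · exact le_mul_of_one_le_right (abs_nonneg _)
      (Real.one_le_rpow (by exact_mod_cast hb) (by norm_num))

lemma summable_abs_corrArith (hgcd : Int.gcd A (Int.gcd B (Int.gcd C D)) = 1)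
    (hΔ0 : A * D - B * C ≠ 0) {n : ℤ} (hn : n ^ 2 - 4 * (A * D - B * C) ≠ 0) :
    Summable fun b : ℕ => |corrArith A B C D n b| := by
  obtain ⟨c, -, hc⟩ := exists_tsum_corrArith_le hgcd hΔ0
  exact Summable.of_nonneg_of_le (fun _ => abs_nonneg _) (abs_corrArith_le_mul_rpow A B C D n)
    (hc n hn).1

/-- The value of the singular series at `n` (for `n² - 4Δ` not a square). -/
noncomputable def singLim (A B C D n : ℤ) : ℝ :=
  quadLim (n ^ 2 - 4 * (A * D - B * C)) * ∑' b, corrArith A B C D n b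

lemma sum_singArith_sub_singLim (hgcd : Int.gcd A (Int.gcd B (Int.gcd C D)) = 1)
    (hΔ0 : A * D - B * C ≠ 0) {n : ℤ} (hn : n ^ 2 - 4 * (A * D - B * C) ≠ 0) (X : ℕ) :
    ∑ q ∈ Finset.Ioc 0 X, singArith A B C D n q - singLim A B C D n =
      -∑' b, corrArith A B C D n b * quadTail (n ^ 2 - 4 * (A * D - B * C)) (X / b) := by
  set E := n ^ 2 - 4 * (A * D - B * C) with hE
  have h0 : ∀ b ∉ Finset.Ioc 0 X,
      corrArith A B C D n b * (quadLim E - quadTail E (X / b)) = 0 := by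
    intro b hb
    rcases Nat.eq_zero_or_pos b with rfl | hb0
    · simp
    · have : X / b = 0 := Nat.div_eq_of_lt (by rw [Finset.mem_Ioc] at hb; omega)
      rw [this, quadTail_zero, sub_self, mul_zero]
  have h1 : Summable fun b => corrArith A B C D n b * (quadLim E - quadTail E (X / b)) :=
    summable_of_ne_finset_zero h0
  have h2 := ((summable_abs_corrArith hgcd hΔ0 hn).of_abs).mul_left (quadLim E)
  have h3 := tsum_eq_sum (L := SummationFilter.unconditional ℕ) h0
  rw [sum_singArith_eq, ← h3, singLim, ← tsum_mul_left, ← h1.tsum_sub h2, ← tsum_neg]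
  refine tsum_congr fun b => ?_
  ring

/-- Convergence of the singular series. -/
lemma tendsto_singLim (hgcd : Int.gcd A (Int.gcd B (Int.gcd C D)) = 1)
    (hΔ0 : A * D - B * C ≠ 0) {n : ℤ} (hn : ¬ IsSquare (n ^ 2 - 4 * (A * D - B * C))) :
    Filter.Tendsto (fun X : ℕ => ∑ q ∈ Finset.Ioc 0 X, singArith A B C D n q) Filter.atTop
      (nhds (singLim A B C D n)) := by
  have hn0 : n ^ 2 - 4 * (A * D - B * C) ≠ 0 := fun h => hn (h ▸ ⟨0, by simp⟩)
  have h1 : (fun X : ℕ => ∑ q ∈ Finset.Ioc 0 X, singArith A B C D n q) = fun X : ℕ =>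
      singLim A B C D n + -∑' b, corrArith A B C D n b *
        quadTail (n ^ 2 - 4 * (A * D - B * C)) (X / b) := by
    funext X
    rw [← sum_singArith_sub_singLim hgcd hΔ0 hn0 X]
    ring
  set E := n ^ 2 - 4 * (A * D - B * C) with hE
  have h2 : Filter.Tendsto (fun X : ℕ => ∑' b, corrArith A B C D n b * quadTail E (X / b))
      Filter.atTop (nhds (∑' _ : ℕ, (0 : ℝ))) := by
    refine tendsto_tsum_of_dominated_convergence
      ((summable_abs_corrArith hgcd hΔ0 hn0).mul_right (9 + Real.log |(E : ℝ)|)) (fun b => ?_)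
      (Filter.Eventually.of_forall fun X b => ?_)
    · rcases Nat.eq_zero_or_pos b with rfl | hb
      · simp
      · have h3 : Filter.Tendsto (fun x : ℕ => quadTail E x) Filter.atTop (nhds 0) := by
          have := (tendsto_quadLim hn).const_sub (quadLim E)
          rwa [sub_self] at this
        have h4 := (h3.comp (Nat.tendsto_div_const_atTop hb.ne')).const_mul (corrArith A B C D n b)
        rwa [mul_zero] at h4
    · rw [Real.norm_eq_abs, abs_mul]
      exact mul_le_mul_of_nonneg_left (abs_quadTail_le_log hn _) (abs_nonneg _)
  rw [tsum_zero] at h2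
  rw [h1]
  simpa using h2.neg.const_add (singLim A B C D n)

/-- Pointwise bounds for the tails of the quadratic sums bound the tail of the singular series. -/
lemma abs_sum_singArith_sub_singLim_le (hgcd : Int.gcd A (Int.gcd B (Int.gcd C D)) = 1)
    (hΔ0 : A * D - B * C ≠ 0) {n : ℤ} (hn : n ^ 2 - 4 * (A * D - B * C) ≠ 0) {X : ℕ} {δ : ℝ}
    (h : ∀ b : ℕ, 1 ≤ b →
      |quadTail (n ^ 2 - 4 * (A * D - B * C)) (X / b)| ≤ δ * (b : ℝ) ^ (1 / 3 : ℝ)) :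
    |∑ q ∈ Finset.Ioc 0 X, singArith A B C D n q - singLim A B C D n| ≤
      δ * ∑' b : ℕ, |corrArith A B C D n b| * (b : ℝ) ^ (1 / 3 : ℝ) := by
  obtain ⟨c, -, hc⟩ := exists_tsum_corrArith_le hgcd hΔ0
  rw [sum_singArith_sub_singLim hgcd hΔ0 hn, abs_neg, ← Real.norm_eq_abs]
  refine tsum_of_norm_bounded ((hc n hn).1.hasSum.mul_left δ) fun b => ?_
  rw [Real.norm_eq_abs, abs_mul]
  rcases Nat.eq_zero_or_pos b with rfl | hb
  · simp
  · calc _ ≤ |corrArith A B C D n b| * (δ * (b : ℝ) ^ (1 / 3 : ℝ)) := by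
          gcongr
          exact h b hb
      _ = _ := by ring

/-- The weighted absolute sum of the correction factor is `O(N ^ ε)`. -/
lemma exists_tsum_corrArith_le_rpow (hgcd : Int.gcd A (Int.gcd B (Int.gcd C D)) = 1)
    (hΔ0 : A * D - B * C ≠ 0) {ε : ℝ} (hε : 0 < ε) :
    ∃ K : ℝ, 0 < K ∧ ∀ N : ℕ, ∀ n ∈ nonsquares (A * D - B * C) N,
      ∑' b : ℕ, |corrArith A B C D n b| * (b : ℝ) ^ (1 / 3 : ℝ) ≤ K * (N : ℝ) ^ ε := by
  obtain ⟨c, hc0, hc⟩ := exists_tsum_corrArith_le hgcd hΔ0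
  have hB := corrBound_nonneg A B C D
  obtain ⟨c', hc'1, hc'⟩ := pow_card_primeFactors_le_rpow
    (by linarith : 1 ≤ 1 + corrBound A B C D) (by positivity : 0 < ε / 2)
  generalize hΔ : A * D - B * C = Δ at *
  set R : ℝ := 2 * |(Δ : ℝ)| * (1 + 4 * |(Δ : ℝ)|) with hR
  have hΔp : 0 < |(Δ : ℝ)| := abs_pos.mpr (by exact_mod_cast hΔ0)
  refine ⟨c * c' * R ^ (ε / 2), by positivity, fun N n hn => ?_⟩
  obtain ⟨⟨hn1, hnN⟩, hsq⟩ := mem_nonsquares.mp hn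
  have hE0 : (n : ℤ) ^ 2 - 4 * Δ ≠ 0 := fun h => hsq (by rw [disc, h]; exact ⟨0, by simp⟩)
  refine (hc n hE0).2.trans ?_
  have h1 := hc' (2 * Δ * ((n : ℤ) ^ 2 - 4 * Δ)).natAbs
    (Int.natAbs_ne_zero.mpr (mul_ne_zero (mul_ne_zero two_ne_zero hΔ0) hE0))
  have h2 : ((2 * Δ * ((n : ℤ) ^ 2 - 4 * Δ)).natAbs : ℝ) ≤ R * (N : ℝ) ^ 2 := by
    have h3 := abs_disc_le Δ hn1 hnN
    rw [disc] at h3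
    rw [Nat.cast_natAbs, Int.cast_abs, Int.cast_mul, Int.cast_mul, abs_mul, abs_mul, hR]
    norm_num only [abs_two, Int.cast_ofNat]
    calc 2 * |(Δ : ℝ)| * |(((n : ℤ) ^ 2 - 4 * Δ : ℤ) : ℝ)| ≤
          2 * |(Δ : ℝ)| * ((1 + 4 * |(Δ : ℝ)|) * (N : ℝ) ^ 2) := by gcongr
      _ = _ := by ring
  calc _ ≤ c * (c' * (R * (N : ℝ) ^ 2) ^ (ε / 2)) := by
        gcongr
        refine h1.trans ?_
        gcongr
    _ = _ := by
        rw [Real.mul_rpow (by positivity) (by positivity), ← Real.rpow_natCast (N : ℝ) 2,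
          ← Real.rpow_mul (Nat.cast_nonneg N)]
        have : ((2 : ℕ) : ℝ) * (ε / 2) = ε := by push_cast; ring
        rw [this]
        ring

end Limit

section LongSums

variable {A B C D : ℤ}

lemma card_quadTail_div_ge_le {Δ : ℤ} (hΔ : Δ ≠ 0) :
    ∃ K : ℝ, 0 < K ∧ ∀ N X b : ℕ, 1 ≤ N → (N : ℝ) ^ (4 / 5 : ℝ) ≤ 2 * X → X ≤ N → 1 ≤ b →
      (b : ℝ) ≤ (N : ℝ) ^ (4 / 25 : ℝ) / 2 →
      (((nonsquares Δ N).filter fun n => (N : ℝ) ^ (-(13 / 250) : ℝ) * (b : ℝ) ^ (1 / 3 : ℝ) ≤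
        |quadTail (disc Δ n) (X / b)|).card : ℝ) ≤ K * (N : ℝ) ^ (37 / 50 : ℝ) := by
  obtain ⟨K, hK, h⟩ := card_quadTail_ge_le hΔ (by norm_num : (0 : ℝ) < 1 / 100)
  refine ⟨K * (1 + 4 ^ 7), by positivity, fun N X b hN hNX hXN hb hbZ => ?_⟩
  have hN1 : (1 : ℝ) ≤ N := by exact_mod_cast hN
  have hN0 : (0 : ℝ) < N := by linarith
  have hb1 : (1 : ℝ) ≤ b := by exact_mod_cast hb
  have hb0 : (0 : ℝ) < b := by linarith
  have hbX : b ≤ X := by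
    have h1 : (N : ℝ) ^ (4 / 25 : ℝ) ≤ (N : ℝ) ^ (4 / 5 : ℝ) :=
      Real.rpow_le_rpow_of_exponent_le hN1 (by norm_num)
    have : (b : ℝ) ≤ X := by linarith
    exact_mod_cast this
  have hx1 : 1 ≤ X / b := (Nat.one_le_div_iff hb).mpr hbX
  have hxN : X / b ≤ N ^ 3 :=
    (Nat.div_le_self _ _).trans (hXN.trans (Nat.le_self_pow (by norm_num) _))
  set x := X / b with hx
  have hxl : (N : ℝ) ^ (4 / 5 : ℝ) / (4 * b) ≤ x := by
    rw [div_le_iff₀ (by positivity)]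
    have h1 : X < b * (x + 1) := by rw [hx]; exact Nat.lt_mul_div_succ X hb
    have h2 : (X : ℝ) ≤ b * (x + 1) := by exact_mod_cast h1.le
    have h3 : (1 : ℝ) ≤ x := by exact_mod_cast hx1
    nlinarith
  have hmom : (N : ℝ) ^ 5 / (x : ℝ) ^ 7 ≤ 4 ^ 7 * (b : ℝ) ^ (14 / 3 : ℝ) := by
    have h1 : ((N : ℝ) ^ (4 / 5 : ℝ)) ^ 7 = (N : ℝ) ^ 5 * (N : ℝ) ^ (3 / 5 : ℝ) := by
      rw [← Real.rpow_natCast _ 7, ← Real.rpow_mul hN0.le, ← Real.rpow_natCast _ 5,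
        ← Real.rpow_add hN0]
      norm_num
    have h2 : (b : ℝ) ^ 7 = (b : ℝ) ^ (14 / 3 : ℝ) * (b : ℝ) ^ (7 / 3 : ℝ) := by
      rw [← Real.rpow_natCast _ 7, ← Real.rpow_add hb0]
      norm_num
    have h3 : (b : ℝ) ^ (7 / 3 : ℝ) ≤ (N : ℝ) ^ (3 / 5 : ℝ) := by
      have h4 : (b : ℝ) ≤ (N : ℝ) ^ (4 / 25 : ℝ) := by
        have : 0 < (N : ℝ) ^ (4 / 25 : ℝ) := by positivity
        linarith
      calc (b : ℝ) ^ (7 / 3 : ℝ) ≤ ((N : ℝ) ^ (4 / 25 : ℝ)) ^ (7 / 3 : ℝ) := by gcongr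
        _ = (N : ℝ) ^ ((4 / 25 : ℝ) * (7 / 3)) := (Real.rpow_mul hN0.le _ _).symm
        _ ≤ _ := Real.rpow_le_rpow_of_exponent_le hN1 (by norm_num)
    calc (N : ℝ) ^ 5 / (x : ℝ) ^ 7 ≤ (N : ℝ) ^ 5 / ((N : ℝ) ^ (4 / 5 : ℝ) / (4 * b)) ^ 7 := by
          gcongr
      _ = 4 ^ 7 * (b : ℝ) ^ 7 / (N : ℝ) ^ (3 / 5 : ℝ) := by
          rw [div_pow, h1]
          field_simp
      _ ≤ _ := by
          rw [div_le_iff₀ (by positivity), h2, ← mul_assoc]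
          gcongr
  have hbp : 1 ≤ (b : ℝ) ^ (14 / 3 : ℝ) := Real.one_le_rpow hb1 (by norm_num)
  refine (h N x hN hx1 hxN _ (by positivity)).trans ?_
  have ht : ((N : ℝ) ^ (-(13 / 250) : ℝ) * (b : ℝ) ^ (1 / 3 : ℝ)) ^ 14 =
      (N : ℝ) ^ (-(91 / 125) : ℝ) * (b : ℝ) ^ (14 / 3 : ℝ) := by
    rw [mul_pow, ← Real.rpow_natCast, ← Real.rpow_natCast, ← Real.rpow_mul hN0.le,
      ← Real.rpow_mul hb0.le]
    norm_num
  rw [ht, div_le_iff₀ (by positivity)]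
  calc K * (N : ℝ) ^ (1 / 100 : ℝ) * (1 + (N : ℝ) ^ 5 / (x : ℝ) ^ 7)
      ≤ K * (N : ℝ) ^ (1 / 100 : ℝ) *
          ((b : ℝ) ^ (14 / 3 : ℝ) + 4 ^ 7 * (b : ℝ) ^ (14 / 3 : ℝ)) := by gcongr
    _ = K * (1 + 4 ^ 7) * (N : ℝ) ^ (1 / 100 : ℝ) * (b : ℝ) ^ (14 / 3 : ℝ) := by ring
    _ ≤ K * (1 + 4 ^ 7) * ((N : ℝ) ^ (37 / 50 : ℝ) * (N : ℝ) ^ (-(91 / 125) : ℝ)) *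
          (b : ℝ) ^ (14 / 3 : ℝ) := by
        gcongr
        rw [← Real.rpow_add hN0]
        exact Real.rpow_le_rpow_of_exponent_le hN1 (by norm_num)
    _ = _ := by ring

lemma abs_quadTail_disc_le (Δ : ℤ) :
    ∃ c : ℝ, 1 ≤ c ∧ ∀ N, ∀ n ∈ nonsquares Δ N, ∀ x,
      |quadTail (disc Δ n) x| ≤ c * (N : ℝ) ^ (1 / 1000 : ℝ) := by
  set R : ℝ := 1 + 4 * |(Δ : ℝ)| with hR
  have hR1 : 1 ≤ R := by rw [hR]; linarith [abs_nonneg (Δ : ℝ)]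
  have hlR := Real.log_nonneg hR1
  refine ⟨(9 + Real.log R) * (1 + 2 / (1 / 1000)), by nlinarith, fun N n hn x => ?_⟩
  obtain ⟨⟨hn1, hnN⟩, hsq⟩ := mem_nonsquares.mp hn
  have hN1 : (1 : ℝ) ≤ N := by exact_mod_cast hn1.trans hnN
  have hlN := Real.log_nonneg hN1
  have hE0 : disc Δ n ≠ 0 := fun h => hsq (by rw [h]; exact ⟨0, by simp⟩)
  have h1 : Real.log |(disc Δ n : ℝ)| ≤ Real.log R + 2 * Real.log N := by
    calc _ ≤ Real.log (R * (N : ℝ) ^ 2) :=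
          Real.log_le_log (abs_pos.mpr (by exact_mod_cast hE0)) (abs_disc_le Δ hn1 hnN)
      _ = _ := by
          rw [Real.log_mul (by positivity) (by positivity), Real.log_pow]
          norm_num
  have h2 := one_add_log_le_rpow (by norm_num : (0 : ℝ) < 1 / 1000) hN1
  calc _ ≤ 9 + Real.log |(disc Δ n : ℝ)| := abs_quadTail_le_log hsq x
    _ ≤ (9 + Real.log R) * (1 + 2 * Real.log N) := by nlinarith
    _ ≤ (9 + Real.log R) * ((1 + 2 / (1 / 1000)) * (N : ℝ) ^ (1 / 1000 : ℝ)) := by gcongr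
    _ = _ := by ring

/-- Outside few exceptions, partial sums of length at least `N ^ (4 / 5)` are close to the full
singular series. -/
lemma card_sub_singLim_gt_le (hgcd : Int.gcd A (Int.gcd B (Int.gcd C D)) = 1)
    (hΔ0 : A * D - B * C ≠ 0) :
    ∃ K : ℝ, 0 < K ∧ ∀ N X : ℕ, 1 ≤ N → (N : ℝ) ^ (4 / 5 : ℝ) ≤ 2 * X → X ≤ N →
      (((nonsquares (A * D - B * C) N).filter fun n : ℕ => K * (N : ℝ) ^ (-(51 / 1000) : ℝ) <
        |∑ q ∈ Finset.Ioc 0 X, singArith A B C D n q - singLim A B C D n|).card : ℝ) ≤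
          K * (N : ℝ) ^ (9 / 10 : ℝ) := by
  obtain ⟨K₁, hK₁, h₁⟩ := card_quadTail_div_ge_le hΔ0
  obtain ⟨c, hc1, hc⟩ := abs_quadTail_disc_le (A * D - B * C)
  obtain ⟨K₂, hK₂, h₂⟩ := exists_tsum_corrArith_le_rpow hgcd hΔ0
    (by norm_num : (0 : ℝ) < 1 / 1000)
  refine ⟨K₁ + 2 * c * K₂, by positivity, fun N X hN hNX hXN => ?_⟩
  have hN1 : (1 : ℝ) ≤ N := by exact_mod_cast hN
  have hN0 : (0 : ℝ) < N := by linarith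
  set Z := ⌊(N : ℝ) ^ (4 / 25 : ℝ) / 2⌋₊ with hZ
  have hZN : (Z : ℝ) ≤ (N : ℝ) ^ (4 / 25 : ℝ) / 2 := Nat.floor_le (by positivity)
  set exc : ℕ → Finset ℕ := fun b => (nonsquares (A * D - B * C) N).filter fun n =>
    (N : ℝ) ^ (-(13 / 250) : ℝ) * (b : ℝ) ^ (1 / 3 : ℝ) ≤
      |quadTail (disc (A * D - B * C) n) (X / b)| with hexc
  have hsub : ((nonsquares (A * D - B * C) N).filter fun n : ℕ =>
      (K₁ + 2 * c * K₂) * (N : ℝ) ^ (-(51 / 1000) : ℝ) <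
        |∑ q ∈ Finset.Ioc 0 X, singArith A B C D n q - singLim A B C D n|) ⊆
      (Finset.Icc 1 Z).biUnion exc := by
    intro n hn
    obtain ⟨hn1, hn2⟩ := Finset.mem_filter.mp hn
    by_contra hcon
    have hsq := (mem_nonsquares.mp hn1).2
    have hE0 : (n : ℤ) ^ 2 - 4 * (A * D - B * C) ≠ 0 :=
      fun h => hsq (by rw [disc, h]; exact ⟨0, by simp⟩)
    have hbd : ∀ b : ℕ, 1 ≤ b → |quadTail ((n : ℤ) ^ 2 - 4 * (A * D - B * C)) (X / b)| ≤
        2 * c * (N : ℝ) ^ (-(13 / 250) : ℝ) * (b : ℝ) ^ (1 / 3 : ℝ) := by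
      intro b hb
      by_cases hbZ : b ≤ Z
      · have h3 : n ∉ exc b := fun h =>
          hcon (Finset.mem_biUnion.mpr ⟨b, Finset.mem_Icc.mpr ⟨hb, hbZ⟩, h⟩)
        rw [hexc, Finset.mem_filter, not_and, not_le] at h3
        refine (h3 hn1).le.trans ?_
        rw [mul_assoc (2 * c)]
        exact le_mul_of_one_le_left (by positivity) (by linarith)
      · have hbZ' : (N : ℝ) ^ (4 / 25 : ℝ) / 2 < b := Nat.lt_of_floor_lt (not_le.mp hbZ)
        have h4 : (N : ℝ) ^ (4 / 75 : ℝ) / 2 ≤ (b : ℝ) ^ (1 / 3 : ℝ) := by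
          calc (N : ℝ) ^ (4 / 75 : ℝ) / 2 ≤ (N : ℝ) ^ (4 / 75 : ℝ) / 2 ^ (1 / 3 : ℝ) := by
                gcongr
                calc (2 : ℝ) ^ (1 / 3 : ℝ) ≤ 2 ^ (1 : ℝ) :=
                      Real.rpow_le_rpow_of_exponent_le (by norm_num) (by norm_num)
                  _ = 2 := Real.rpow_one 2
            _ = ((N : ℝ) ^ (4 / 25 : ℝ) / 2) ^ (1 / 3 : ℝ) := by
                rw [Real.div_rpow (by positivity) (by norm_num), ← Real.rpow_mul hN0.le]
                norm_num
            _ ≤ _ := by gcongr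
        refine (hc N n hn1 _).trans ?_
        calc c * (N : ℝ) ^ (1 / 1000 : ℝ)
            ≤ c * ((N : ℝ) ^ (-(13 / 250) : ℝ) * (N : ℝ) ^ (4 / 75 : ℝ)) := by
              rw [← Real.rpow_add hN0]
              gcongr
              norm_num
          _ = 2 * c * (N : ℝ) ^ (-(13 / 250) : ℝ) * ((N : ℝ) ^ (4 / 75 : ℝ) / 2) := by ring
          _ ≤ _ := by gcongr
    have h5 := (abs_sum_singArith_sub_singLim_le hgcd hΔ0 hE0 hbd).trans
      (mul_le_mul_of_nonneg_left (h₂ N n hn1) (by positivity))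
    have h6 : 2 * c * (N : ℝ) ^ (-(13 / 250) : ℝ) * (K₂ * (N : ℝ) ^ (1 / 1000 : ℝ)) ≤
        (K₁ + 2 * c * K₂) * (N : ℝ) ^ (-(51 / 1000) : ℝ) := by
      have h7 : (N : ℝ) ^ (-(13 / 250) : ℝ) * (N : ℝ) ^ (1 / 1000 : ℝ) =
          (N : ℝ) ^ (-(51 / 1000) : ℝ) := by
        rw [← Real.rpow_add hN0]; norm_num
      calc _ = 2 * c * K₂ * ((N : ℝ) ^ (-(13 / 250) : ℝ) * (N : ℝ) ^ (1 / 1000 : ℝ)) := by ring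
        _ = 2 * c * K₂ * (N : ℝ) ^ (-(51 / 1000) : ℝ) := by rw [h7]
        _ ≤ _ := by gcongr; linarith
    linarith
  have hcard : ((((Finset.Icc 1 Z).biUnion exc).card : ℕ) : ℝ) ≤
      ∑ b ∈ Finset.Icc 1 Z, ((exc b).card : ℝ) := by exact_mod_cast Finset.card_biUnion_le
  calc _ ≤ ((((Finset.Icc 1 Z).biUnion exc).card : ℕ) : ℝ) := by
        exact_mod_cast Finset.card_le_card hsub
    _ ≤ ∑ b ∈ Finset.Icc 1 Z, K₁ * (N : ℝ) ^ (37 / 50 : ℝ) := by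
        refine hcard.trans (Finset.sum_le_sum fun b hb => ?_)
        obtain ⟨hb1, hb2⟩ := Finset.mem_Icc.mp hb
        exact h₁ N X b hN hNX hXN hb1 (le_trans (by exact_mod_cast hb2) hZN)
    _ = Z * (K₁ * (N : ℝ) ^ (37 / 50 : ℝ)) := by
        rw [Finset.sum_const, Nat.card_Icc, nsmul_eq_mul, Nat.add_sub_cancel]
    _ ≤ (N : ℝ) ^ (4 / 25 : ℝ) * (K₁ * (N : ℝ) ^ (37 / 50 : ℝ)) := by
        gcongr
        have : 0 < (N : ℝ) ^ (4 / 25 : ℝ) := by positivity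
        linarith
    _ = K₁ * (N : ℝ) ^ (9 / 10 : ℝ) := by
        rw [mul_left_comm, ← Real.rpow_add hN0]
        norm_num
    _ ≤ _ := by
        gcongr
        have : 0 < 2 * c * K₂ := by positivity
        linarith

end LongSums

section Assembly

variable {A B C D : ℤ}

lemma rpow_le_two_mul_floor {N : ℕ} (hN : 1 ≤ N) {a : ℝ} (ha : 0 ≤ a) :
    (N : ℝ) ^ a ≤ 2 * ⌊(N : ℝ) ^ a⌋₊ := by
  have h1 : 1 ≤ (N : ℝ) ^ a := Real.one_le_rpow (by exact_mod_cast hN) ha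
  have h2 : (1 : ℝ) ≤ (⌊(N : ℝ) ^ a⌋₊ : ℝ) := by exact_mod_cast (Nat.one_le_floor_iff _).mpr h1
  linarith [Nat.lt_floor_add_one ((N : ℝ) ^ a)]

/-- The block of terms between `N ^ α` and `N ^ (4 / 5)` is rarely large. -/
lemma card_sum_Ioc_ge_le (hgcd : Int.gcd A (Int.gcd B (Int.gcd C D)) = 1)
    (hΔ0 : A * D - B * C ≠ 0) {α η : ℝ} (hα : 0 < α) (hα' : α ≤ 4 / 5) (hη : 0 < η)
    (hηα : η < α / 6) (hη' : η < 1 / 20) :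
    ∃ K : ℝ, 0 < K ∧ ∀ N : ℕ, 1 ≤ N →
      (((Finset.Icc 1 N).filter fun n : ℕ => (N : ℝ) ^ (-η) / 2 ≤
        |∑ q ∈ Finset.Ioc ⌊(N : ℝ) ^ α⌋₊ ⌊(N : ℝ) ^ (4 / 5 : ℝ)⌋₊, singArith A B C D n q|).card : ℝ)
          ≤ K * (N : ℝ) ^ (1 - η) := by
  obtain ⟨ε, hε, hε1, hε2⟩ : ∃ ε : ℝ, 0 < ε ∧ ε ≤ α / 4 ∧ ε ≤ 1 / 40 :=
    ⟨min (α / 4) (1 / 40), by positivity, min_le_left _ _, min_le_right _ _⟩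
  obtain ⟨K, hK, h⟩ := sum_sq_Ioc_le hgcd hΔ0 hε (by linarith : ε < 1)
  refine ⟨12 * K, by positivity, fun N hN => ?_⟩
  have hN1 : (1 : ℝ) ≤ N := by exact_mod_cast hN
  have hN0 : (0 : ℝ) < N := by linarith
  set Q₀ := ⌊(N : ℝ) ^ α⌋₊ with hQ₀
  set Q₁ := ⌊(N : ℝ) ^ (4 / 5 : ℝ)⌋₊ with hQ₁
  have hQ01 : Q₀ ≤ Q₁ := Nat.floor_le_floor (Real.rpow_le_rpow_of_exponent_le hN1 hα')
  have hQ0 : 1 ≤ Q₀ := (Nat.one_le_floor_iff _).mpr (Real.one_le_rpow hN1 hα.le)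
  have hQ0l : (N : ℝ) ^ α ≤ 2 * Q₀ := rpow_le_two_mul_floor hN hα.le
  have hQ1u : (Q₁ : ℝ) ≤ (N : ℝ) ^ (4 / 5 : ℝ) := Nat.floor_le (by positivity)
  have e1 : (Q₁ : ℝ) ^ ε ≤ (N : ℝ) ^ (4 / 5 * ε) := by
    rw [Real.rpow_mul hN0.le]; gcongr
  have e2 : (Q₁ : ℝ) ^ (1 + ε) ≤ (N : ℝ) ^ (4 / 5 * (1 + ε)) := by
    rw [Real.rpow_mul hN0.le]; gcongr
  have e3 : (Q₀ : ℝ) ^ (-(1 - ε)) ≤ 2 * (N : ℝ) ^ (-(α * (1 - ε))) := by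
    calc (Q₀ : ℝ) ^ (-(1 - ε)) ≤ ((N : ℝ) ^ α / 2) ^ (-(1 - ε)) :=
          Real.rpow_le_rpow_of_nonpos (by positivity) (by linarith) (by linarith)
      _ = 2 ^ (1 - ε) * (N : ℝ) ^ (-(α * (1 - ε))) := by
          rw [Real.div_rpow (by positivity) (by norm_num), ← Real.rpow_mul hN0.le,
            Real.rpow_neg (by norm_num : (0 : ℝ) ≤ 2), div_inv_eq_mul, mul_comm, mul_neg]
      _ ≤ _ := by
          gcongr
          calc (2 : ℝ) ^ (1 - ε) ≤ 2 ^ (1 : ℝ) :=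
                Real.rpow_le_rpow_of_exponent_le (by norm_num) (by linarith)
            _ = 2 := Real.rpow_one 2
  have hmark := Finset.card_nsmul_le_sum ((Finset.Icc 1 N).filter fun n : ℕ =>
    (N : ℝ) ^ (-η) / 2 ≤ |∑ q ∈ Finset.Ioc Q₀ Q₁, singArith A B C D n q|)
    (fun n => (∑ q ∈ Finset.Ioc Q₀ Q₁, singArith A B C D n q) ^ 2) (((N : ℝ) ^ (-η) / 2) ^ 2)
    fun n hn => by
      rw [← sq_abs (∑ q ∈ Finset.Ioc Q₀ Q₁, singArith A B C D n q)]
      have := (Finset.mem_filter.mp hn).2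
      gcongr
  have hsum := (hmark.trans (Finset.sum_le_sum_of_subset_of_nonneg (Finset.filter_subset _ _)
    fun _ _ _ => sq_nonneg _)).trans (h Q₀ Q₁ N hQ0 hQ01)
  rw [nsmul_eq_mul, ← le_div_iff₀ (by positivity)] at hsum
  refine hsum.trans ?_
  rw [div_le_iff₀ (by positivity)]
  have e4 : ((N : ℝ) ^ (-η) / 2) ^ 2 = (N : ℝ) ^ (-(2 * η)) / 4 := by
    rw [div_pow, ← Real.rpow_natCast, ← Real.rpow_mul hN0.le]
    norm_num
    ring_nf
  calc K * (Q₁ : ℝ) ^ ε * (N * (Q₀ : ℝ) ^ (-(1 - ε)) + (Q₁ : ℝ) ^ (1 + ε))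
      ≤ K * (N : ℝ) ^ (4 / 5 * ε) * (N * (2 * (N : ℝ) ^ (-(α * (1 - ε)))) +
          (N : ℝ) ^ (4 / 5 * (1 + ε))) := by gcongr
    _ = 2 * K * (N : ℝ) ^ (4 / 5 * ε + 1 + -(α * (1 - ε))) +
          K * (N : ℝ) ^ (4 / 5 * ε + 4 / 5 * (1 + ε)) := by
        rw [Real.rpow_add hN0, Real.rpow_add hN0, Real.rpow_add hN0, Real.rpow_one]
        ring
    _ ≤ 2 * K * (N : ℝ) ^ (1 - 3 * η) + K * (N : ℝ) ^ (1 - 3 * η) := by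
        gcongr 2 * K * ?_ + K * ?_
        · exact Real.rpow_le_rpow_of_exponent_le hN1 (by nlinarith)
        · exact Real.rpow_le_rpow_of_exponent_le hN1 (by linarith)
    _ = 12 * K * ((N : ℝ) ^ (1 - η) * (N : ℝ) ^ (-(2 * η))) / 4 := by
        rw [← Real.rpow_add hN0, show 1 - η + -(2 * η) = 1 - 3 * η by ring]
        ring
    _ = _ := by rw [e4]; ring

/-- Sums of length at least `N ^ (4 / 5)` rarely deviate from the singular series. -/
lemma card_sub_singLim_ge_le (hgcd : Int.gcd A (Int.gcd B (Int.gcd C D)) = 1)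
    (hΔ0 : A * D - B * C ≠ 0) {η : ℝ} (hη : 0 < η) (hη' : η < 1 / 20) :
    ∃ K : ℝ, 0 < K ∧ ∀ N X : ℕ, 1 ≤ N → (N : ℝ) ^ (4 / 5 : ℝ) ≤ 2 * X → X ≤ N →
      (((nonsquares (A * D - B * C) N).filter fun n : ℕ => (N : ℝ) ^ (-η) / 2 ≤
        |∑ q ∈ Finset.Ioc 0 X, singArith A B C D n q - singLim A B C D n|).card : ℝ) ≤
          K * (N : ℝ) ^ (1 - η) := by
  obtain ⟨K, hK, h⟩ := card_sub_singLim_gt_le hgcd hΔ0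
  refine ⟨K + (2 * K) ^ 50, by positivity, fun N X hN hNX hXN => ?_⟩
  have hN1 : (1 : ℝ) ≤ N := by exact_mod_cast hN
  have hN0 : (0 : ℝ) < N := by linarith
  by_cases hlarge : K * (N : ℝ) ^ (-(51 / 1000) : ℝ) < (N : ℝ) ^ (-η) / 2
  · calc _ ≤ K * (N : ℝ) ^ (9 / 10 : ℝ) := by
          refine le_trans ?_ (h N X hN hNX hXN)
          exact_mod_cast Finset.card_le_card
            (Finset.monotone_filter_right _ fun n _ hn => hlarge.trans_le hn)
      _ ≤ (K + (2 * K) ^ 50) * (N : ℝ) ^ (1 - η) := by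
          gcongr
          · have : 0 < (2 * K) ^ 50 := by positivity
            linarith
          · linarith
  · have h1 : (N : ℝ) ^ (1 / 1000 : ℝ) ≤ 2 * K := by
      have h2 : (N : ℝ) ^ (-(50 / 1000) : ℝ) ≤ 2 * (K * (N : ℝ) ^ (-(51 / 1000) : ℝ)) := by
        have : (N : ℝ) ^ (-(50 / 1000) : ℝ) ≤ (N : ℝ) ^ (-η) :=
          Real.rpow_le_rpow_of_exponent_le hN1 (by linarith)
        linarith [not_lt.mp hlarge]
      calc (N : ℝ) ^ (1 / 1000 : ℝ)
          = (N : ℝ) ^ (-(50 / 1000) : ℝ) * (N : ℝ) ^ (51 / 1000 : ℝ) := by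
            rw [← Real.rpow_add hN0]; norm_num
        _ ≤ 2 * (K * (N : ℝ) ^ (-(51 / 1000) : ℝ)) * (N : ℝ) ^ (51 / 1000 : ℝ) := by gcongr
        _ = 2 * K * ((N : ℝ) ^ (-(51 / 1000) : ℝ) * (N : ℝ) ^ (51 / 1000 : ℝ)) := by ring
        _ = 2 * K := by rw [← Real.rpow_add hN0, neg_add_cancel, Real.rpow_zero, mul_one]
    have h3 : (N : ℝ) ^ η ≤ (2 * K) ^ 50 := by
      calc (N : ℝ) ^ η ≤ (N : ℝ) ^ (1 / 20 : ℝ) :=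
            Real.rpow_le_rpow_of_exponent_le hN1 hη'.le
        _ = ((N : ℝ) ^ (1 / 1000 : ℝ)) ^ 50 := by
            rw [← Real.rpow_natCast, ← Real.rpow_mul hN0.le]; norm_num
        _ ≤ _ := by gcongr
    have h4 : ((nonsquares (A * D - B * C) N).filter fun n : ℕ => (N : ℝ) ^ (-η) / 2 ≤
        |∑ q ∈ Finset.Ioc 0 X, singArith A B C D n q - singLim A B C D n|).card ≤ N :=
      (Finset.card_filter_le _ _).trans ((Finset.card_filter_le _ _).trans (by simp))
    calc _ ≤ (N : ℝ) := by exact_mod_cast h4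
      _ = (N : ℝ) ^ η * (N : ℝ) ^ (1 - η) := by rw [← Real.rpow_add hN0]; norm_num
      _ ≤ (K + (2 * K) ^ 50) * (N : ℝ) ^ (1 - η) := by gcongr; linarith

lemma card_short_sum_ge_le (hgcd : Int.gcd A (Int.gcd B (Int.gcd C D)) = 1)
    (hΔ0 : A * D - B * C ≠ 0) {α η : ℝ} (hα : 0 < α) (hα1 : α < 1) (hη : 0 < η)
    (hηα : η < α / 6) (hη' : η < 1 / 20) :
    ∃ K : ℝ, 0 < K ∧ ∀ N : ℕ, 1 ≤ N →
      (((nonsquares (A * D - B * C) N).filter fun n : ℕ => (N : ℝ) ^ (-η) ≤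
        |∑ q ∈ Finset.Ioc 0 ⌊(N : ℝ) ^ α⌋₊, singArith A B C D n q - singLim A B C D n|).card : ℝ) ≤
          K * (N : ℝ) ^ (1 - η) := by
  obtain ⟨K₁, hK₁, h₁⟩ := card_sub_singLim_ge_le hgcd hΔ0 hη hη'
  have hfloor : ∀ {N : ℕ} {a : ℝ}, 1 ≤ N → a ≤ 1 → ⌊(N : ℝ) ^ a⌋₊ ≤ N := by
    intro N a hN ha
    refine Nat.floor_le_of_le ?_
    calc (N : ℝ) ^ a ≤ (N : ℝ) ^ (1 : ℝ) :=
          Real.rpow_le_rpow_of_exponent_le (by exact_mod_cast hN) ha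
      _ = N := Real.rpow_one _
  rcases le_total (4 / 5) α with hα' | hα'
  · refine ⟨K₁, hK₁, fun N hN => le_trans ?_ (h₁ N ⌊(N : ℝ) ^ α⌋₊ hN ?_ (hfloor hN hα1.le))⟩
    · have : 0 ≤ (N : ℝ) ^ (-η) := by positivity
      exact_mod_cast Finset.card_le_card
        (Finset.monotone_filter_right _ fun n _ hn => by linarith)
    · exact (Real.rpow_le_rpow_of_exponent_le (by exact_mod_cast hN) hα').trans
        (rpow_le_two_mul_floor hN hα.le)
  · obtain ⟨K₂, hK₂, h₂⟩ := card_sum_Ioc_ge_le hgcd hΔ0 hα hα' hη hηα hη'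
    refine ⟨K₁ + K₂, by positivity, fun N hN => ?_⟩
    have hN1 : (1 : ℝ) ≤ N := by exact_mod_cast hN
    have h3 := h₁ N ⌊(N : ℝ) ^ (4 / 5 : ℝ)⌋₊ hN (rpow_le_two_mul_floor hN (by norm_num))
      (hfloor hN (by norm_num))
    have h4 := h₂ N hN
    have hQ : ⌊(N : ℝ) ^ α⌋₊ ≤ ⌊(N : ℝ) ^ (4 / 5 : ℝ)⌋₊ :=
      Nat.floor_le_floor (Real.rpow_le_rpow_of_exponent_le hN1 hα')
    set Q₀ := ⌊(N : ℝ) ^ α⌋₊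
    set Q₁ := ⌊(N : ℝ) ^ (4 / 5 : ℝ)⌋₊
    rw [add_mul]
    refine le_trans ?_ (add_le_add h3 h4)
    norm_cast
    refine (Finset.card_le_card fun n hn => ?_).trans (Finset.card_union_le _ _)
    obtain ⟨hn1, hn2⟩ := Finset.mem_filter.mp hn
    rw [Finset.mem_union, Finset.mem_filter, Finset.mem_filter]
    by_contra! hcon
    have h5 := hcon.1 hn1
    have h6 := hcon.2 (Finset.mem_Icc.mpr (mem_nonsquares.mp hn1).1)
    have h7 := Finset.sum_Ioc_consecutive (fun q => singArith A B C D n q) (Nat.zero_le Q₀) hQ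
    rw [← h7] at h5
    rw [abs_lt] at h5 h6
    have h8 : |∑ q ∈ Finset.Ioc 0 Q₀, singArith A B C D n q - singLim A B C D n| <
        (N : ℝ) ^ (-η) := by
      rw [abs_lt]
      constructor <;> linarith [h5.1, h5.2, h6.1, h6.2]
    linarith

lemma sum_range_succ_singSeriesTerm (A B C D n : ℤ) (Q : ℕ) :
    ∑ q ∈ Finset.range (Q + 1), singSeriesTerm A B C D q n =
      ∑ q ∈ Finset.Ioc 0 Q, singArith A B C D n q := by
  symm
  refine Finset.sum_subset (fun q hq => ?_) fun q hq hq' => ?_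
  · rw [Finset.mem_Ioc] at hq
    rw [Finset.mem_range]
    omega
  · rw [Finset.mem_Ioc] at hq'
    rw [Finset.mem_range] at hq
    obtain rfl : q = 0 := by omega
    exact (singArith A B C D n).map_zero

end Assembly

end SingSeries

/-- For `Δ = AD − BC ≠ 0`: (i) the singular series `𝔖(n) = lim_Q Σ_{q ≤ Q} 𝔖_q(n)` converges
for every `n` with `n² − 4Δ` not a perfect square, and (ii) up to at most `O(N^{1−η})`
exceptions `n ∈ [1, N]`, the very short sum `Σ_{q ≤ N^{α₀}} 𝔖_q(n)` approximates `𝔖(n)`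
to within `N^{−η}`. -/
theorem singSeries_short_sum_approx (A B C D : ℤ)
    (hgcd : Int.gcd A (Int.gcd B (Int.gcd C D)) = 1) (hΔ : A * D - B * C ≠ 0) :
    ∃ SSlim : ℤ → ℝ,
      (∀ n : ℤ, ¬ IsSquare (n ^ 2 - 4 * (A * D - B * C)) →
        Filter.Tendsto (fun Q : ℕ => ∑ q ∈ Finset.range (Q + 1), singSeriesTerm A B C D q n)
          Filter.atTop (nhds (SSlim n))) ∧
      (∀ α₀ : ℝ, 0 < α₀ → α₀ < 1 → ∀ η : ℝ, 0 < η → η < min (α₀ / 6) (1 / 20) →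
        ∃ K : ℝ, 0 < K ∧ ∀ N : ℕ, 2 ≤ N →
          (Set.ncard {n : ℤ | 1 ≤ n ∧ n ≤ (N : ℤ) ∧
              ¬ IsSquare (n ^ 2 - 4 * (A * D - B * C)) ∧
              (N : ℝ) ^ (-η) ≤
                |(∑ q ∈ Finset.Icc 1 ⌊(N : ℝ) ^ α₀⌋₊, singSeriesTerm A B C D q n) -
                  SSlim n|} : ℝ) ≤ K * (N : ℝ) ^ ((1 : ℝ) - η)) := by
  refine ⟨SingSeries.singLim A B C D, fun n hn => ?_, fun α hα hα1 η hη hη' => ?_⟩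
  · simp_rw [SingSeries.sum_range_succ_singSeriesTerm]
    exact SingSeries.tendsto_singLim hgcd hΔ hn
  · obtain ⟨K, hK, h⟩ := SingSeries.card_short_sum_ge_le hgcd hΔ hα hα1 hη
      (hη'.trans_le (min_le_left _ _)) (hη'.trans_le (min_le_right _ _))
    refine ⟨K, hK, fun N hN => le_trans (le_of_eq ?_) (h N (by omega))⟩
    rw [← Set.ncard_coe_finset, ← Set.ncard_image_of_injective _ (Nat.cast_injective (R := ℤ))]
    congr 2
    ext n
    simp only [Set.mem_ofPred_eq, Set.mem_image, Finset.coe_filter, SingSeries.mem_nonsquares]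
    have hIcc : Finset.Icc 1 ⌊(N : ℝ) ^ α⌋₊ = Finset.Ioc 0 ⌊(N : ℝ) ^ α⌋₊ := by
      ext q
      rw [Finset.mem_Icc, Finset.mem_Ioc]
      omega
    rw [hIcc]
    constructor
    · rintro ⟨h1, h2, h3, h4⟩
      lift n to ℕ using by omega
      exact ⟨n, ⟨⟨⟨by omega, by omega⟩, h3⟩, h4⟩, rfl⟩
    · rintro ⟨m, ⟨⟨⟨h1, h2⟩, h3⟩, h4⟩, rfl⟩
      exact ⟨by omega, by omega, h3, h4⟩
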